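/- Let k be a field, let G be a transitive subgroup of the symmetric group S5 (acting on {1,2,3,4,5}), and let L/k be a finite Galois extension with Gal(L/k) = G. Let G act on the rational function field L(x1,x2,x3,x4), extending its Galois action on L, by σ(x_i) = x_{σ(i)} for 1 ≤ i ≤ 4 with σ(i) ≤ 4, and σ(x_i) = 1/(x1·x2·x3·x4) when σ(i) = 5 (so that, setting x5 := 1/(x1·x2·x3·x4), G permutes x1,…,x5 according to its action on {1,…,5}); the fixed field L(x1,x2,x3,x4)^G is the function field of the norm one torus R^{(1)}_{K/k}(G_m) of the degree-5 separable extension K = L^{Stab_G(5)}. Then: (1) L(x1,x2,x3,x4)^G is stably k-rational if and only if G is isomorphic to C5, D5 (dihedral of order 10), or A5; (2) L(x1,x2,x3,x4)^G is not stably k-rational but is retract k-rational if and only if G is isomorphic to F20 (the Frobenius group of order 20, C5 ⋊ C4) or S5. -/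

import Mathlib

open MvPolynomial

noncomputable section

/-- A field extension `K` of `k` is `k`-rational if it is isomorphic, as a `k`-algebra,
to a rational function field `k(x₁, …, xₙ)` in finitely many variables. -/
def IsRational (k K : Type*) [Field k] [Field K] [Algebra k K] : Prop :=
  ∃ n : ℕ, Nonempty (K ≃ₐ[k] FractionRing (MvPolynomial (Fin n) k))

/-- A field extension `K` of `k` is stably `k`-rational if a rational function field
`K(y₁, …, y_m)` over `K` in finitely many variables is `k`-rational. -/
def IsStablyRational (k K : Type*) [Field k] [Field K] [Algebra k K] : Prop :=
  ∃ m : ℕ, IsRational k (FractionRing (MvPolynomial (Fin m) K))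

/-- A field extension `K` of `k` is retract `k`-rational if there is a `k`-subalgebra `A` of `K`
whose fraction field is `K`, together with a nonzero polynomial `f ∈ k[x₁,…,xₙ]` and `k`-algebra
homomorphisms `φ : A → k[x₁,…,xₙ][1/f]` and `ψ : k[x₁,…,xₙ][1/f] → A` with `ψ ∘ φ = id_A`. -/
def IsRetractRational (k K : Type*) [Field k] [Field K] [Algebra k K] : Prop :=
  ∃ A : Subalgebra k K, IsFractionRing A K ∧
    ∃ (n : ℕ) (f : MvPolynomial (Fin n) k), f ≠ 0 ∧
      ∃ (φ : A →ₐ[k] Localization.Away f) (ψ : Localization.Away f →ₐ[k] A),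
        ψ.comp φ = AlgHom.id k A

/-- `H` is (isomorphic to) the Frobenius group `F₂₀ = C₅ ⋊ C₄` of order 20, presented as
`⟨a, b ∣ a⁵ = b⁴ = 1, b a b⁻¹ = a²⟩`. -/
def IsFrobeniusGroup20 (H : Type*) [Group H] : Prop :=
  ∃ a b : H, orderOf a = 5 ∧ orderOf b = 4 ∧ b * a * b⁻¹ = a ^ 2 ∧
    Subgroup.closure ({a, b} : Set H) = ⊤

section PermFive

open Equiv

theorem exists_conj_finRotate_five : ∀ c : Perm (Fin 5), c ^ 5 = 1 → c ≠ 1 →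
    ∃ p : Perm (Fin 5), c = p * finRotate 5 * p⁻¹ := by
  intro c h5 h1
  have : IsConj (finRotate 5) c := by
    rw [Perm.isConj_iff_cycleType_eq, cycleType_finRotate]
    have : Fact (Nat.Prime 5) := ⟨Nat.prime_five⟩
    have ho : orderOf c = 5 := orderOf_eq_prime h5 h1
    have : c.cycleType.lcm = 5 := by rw [Perm.lcm_cycleType, ho]
    obtain ⟨n, hn⟩ := Perm.cycleType_prime_order (by rw [ho]; norm_num : (orderOf c).Prime)
    have hs := Perm.sum_cycleType_le c
    rw [hn, ho] at hs ⊢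
    simp at hs
    have : n = 0 := by omega
    subst this; simp
  obtain ⟨p, hp⟩ := isConj_iff.1 this
  exact ⟨p, hp.symm⟩

theorem finRotate_five_normalize_or : ∀ d : Perm (Fin 5),
    (∃ m : Fin 5, d * finRotate 5 * d⁻¹ = finRotate 5 ^ (m : ℕ)) ∨
      ∃ i j : Fin 5, (finRotate 5 ^ (i : ℕ) *
        (d * finRotate 5 * d⁻¹) ^ (j : ℕ)).support.card = 3 := by
  decide +kernel

theorem finRotate_five_commute : ∀ d : Perm (Fin 5),
    d * finRotate 5 * d⁻¹ = finRotate 5 → ∃ i : Fin 5, d = finRotate 5 ^ (i : ℕ) := by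
  decide +kernel

theorem finRotate_five_conj_two : ∀ d : Perm (Fin 5),
    d * finRotate 5 * d⁻¹ = finRotate 5 ^ 2 →
      d ^ 4 = 1 ∧ d ^ 2 ≠ 1 ∧ Perm.sign d = -1 := by
  decide +kernel

theorem finRotate_five_conj_four : ∀ d : Perm (Fin 5),
    d * finRotate 5 * d⁻¹ = finRotate 5 ^ 4 → d ^ 2 = 1 ∧ Perm.sign d = 1 := by
  decide +kernel

theorem five_cycle_normalize_or {c : Perm (Fin 5)} (h5 : c ^ 5 = 1) (h1 : c ≠ 1)
    (d : Perm (Fin 5)) :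
    (∃ m : Fin 5, d * c * d⁻¹ = c ^ (m : ℕ)) ∨
      ∃ i j : Fin 5, (c ^ (i : ℕ) * (d * c * d⁻¹) ^ (j : ℕ)).IsThreeCycle := by
  obtain ⟨p, rfl⟩ := exists_conj_finRotate_five c h5 h1
  rcases finRotate_five_normalize_or (p⁻¹ * d * p) with ⟨m, hm⟩ | ⟨i, j, h⟩
  · left
    refine ⟨m, ?_⟩
    rw [conj_pow, ← hm]; group
  · right
    refine ⟨i, j, ?_⟩
    rw [card_support_eq_three_iff] at h
    rw [Perm.IsThreeCycle, ← Perm.cycleType_conj (τ := p)] at h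
    rw [Perm.IsThreeCycle, ← h]
    simp only [conj_pow]
    group

theorem five_cycle_commute {c : Perm (Fin 5)} (h5 : c ^ 5 = 1) (h1 : c ≠ 1)
    {d : Perm (Fin 5)} (h : d * c * d⁻¹ = c) : ∃ i : ℕ, d = c ^ i := by
  obtain ⟨p, rfl⟩ := exists_conj_finRotate_five c h5 h1
  obtain ⟨i, hi⟩ := finRotate_five_commute (p⁻¹ * d * p) (by
    calc _ = p⁻¹ * (d * (p * finRotate 5 * p⁻¹) * d⁻¹) * p := by group
      _ = _ := by rw [h]; group)
  exact ⟨i, by rw [conj_pow, ← hi]; group⟩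

theorem five_cycle_conj_two {c : Perm (Fin 5)} (h5 : c ^ 5 = 1) (h1 : c ≠ 1)
    {d : Perm (Fin 5)} (h : d * c * d⁻¹ = c ^ 2) :
    d ^ 4 = 1 ∧ d ^ 2 ≠ 1 ∧ Perm.sign d = -1 := by
  obtain ⟨p, rfl⟩ := exists_conj_finRotate_five c h5 h1
  have hd : d = p * (p⁻¹ * d * p) * p⁻¹ := by group
  obtain ⟨h4, h2, hs⟩ := finRotate_five_conj_two (p⁻¹ * d * p) (by
    calc _ = p⁻¹ * (d * (p * finRotate 5 * p⁻¹) * d⁻¹) * p := by group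
      _ = _ := by rw [h, conj_pow]; group)
  refine ⟨?_, fun h' => h2 ?_, ?_⟩
  · rw [hd, conj_pow, h4]; simp
  · rw [hd, conj_pow] at h'
    simpa using h'
  · rw [← hs, map_mul, map_mul, Perm.sign_inv, mul_right_comm, Int.units_mul_self, one_mul]

theorem five_cycle_conj_four {c : Perm (Fin 5)} (h5 : c ^ 5 = 1) (h1 : c ≠ 1)
    {d : Perm (Fin 5)} (h : d * c * d⁻¹ = c ^ 4) : d ^ 2 = 1 ∧ Perm.sign d = 1 := by
  obtain ⟨p, rfl⟩ := exists_conj_finRotate_five c h5 h1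
  have hd : d = p * (p⁻¹ * d * p) * p⁻¹ := by group
  obtain ⟨h2, hs⟩ := finRotate_five_conj_four (p⁻¹ * d * p) (by
    calc _ = p⁻¹ * (d * (p * finRotate 5 * p⁻¹) * d⁻¹) * p := by group
      _ = _ := by rw [h, conj_pow]; group)
  refine ⟨?_, ?_⟩
  · rw [hd, conj_pow, h2]; simp
  · rw [← hs, map_mul, map_mul, Perm.sign_inv, mul_right_comm, Int.units_mul_self, one_mul]

theorem nonempty_mulEquiv_dihedralGroup_five {H : Type*} [Group H] {c s : H} (h5 : c ^ 5 = 1)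
    (h1 : c ≠ 1) (hs : s ^ 2 = 1) (hc : s * c * s⁻¹ = c⁻¹)
    (hH : ∀ h : H, (∃ i : ℕ, h = c ^ i) ∨ ∃ i : ℕ, h = s * c ^ i) :
    Nonempty (H ≃* DihedralGroup 5) := by
  have hne : (1 - -1 : ZMod 5) ≠ 0 := by decide
  have : Fact (Nat.Prime 5) := ⟨Nat.prime_five⟩
  have ho : orderOf c = 5 := orderOf_eq_prime h5 h1
  have hss : s * s = 1 := by rw [← sq, hs]
  have hsi : s⁻¹ = s := inv_eq_of_mul_eq_one_left hss
  let f : ZMod 5 → H := fun i => c ^ i.val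
  have fadd : ∀ i j, f (i + j) = f i * f j := fun i j => by
    simp only [f, ZMod.val_add, ← pow_add]
    conv_rhs => rw [← pow_mod_orderOf, ho]
  have fzero : f 0 = 1 := by simp [f]
  have fneg : ∀ i, f (-i) = (f i)⁻¹ := fun i => by
    rw [eq_inv_iff_mul_eq_one, ← fadd, neg_add_cancel, fzero]
  have fsub : ∀ i j, f (i - j) = f i * (f j)⁻¹ := fun i j => by
    rw [sub_eq_add_neg, fadd, fneg]
  have finj : ∀ i, f i = 1 → i = 0 := fun i hi => by
    have := orderOf_dvd_of_pow_eq_one hi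
    rw [ho] at this
    exact (ZMod.val_eq_zero i).1 (Nat.eq_zero_of_dvd_of_lt this i.val_lt)
  have fs : ∀ i, s * f i * s⁻¹ = (f i)⁻¹ := fun i => by
    simp only [f]; rw [← conj_pow, hc, inv_pow]
  have fs' : ∀ i, f i * s = s * (f i)⁻¹ := fun i => by
    rw [← fs, hsi, ← mul_assoc, ← mul_assoc, hss, one_mul]
  have fcomm : ∀ i j, (f i)⁻¹ * f j = f j * (f i)⁻¹ := fun i j => by
    rw [← fneg, ← fadd, ← fadd, add_comm]
  let φ : DihedralGroup 5 →* H :=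
    { toFun := fun x => match x with
        | .r i => f i
        | .sr i => s * f i
      map_one' := fzero
      map_mul' := by
        rintro (i | i) (j | j)
        · simp [DihedralGroup.r_mul_r, fadd]
        · simp only [DihedralGroup.r_mul_sr, fsub]
          rw [← mul_assoc (f i), fs', mul_assoc, fcomm]
        · simp [DihedralGroup.sr_mul_r, fadd, mul_assoc]
        · simp only [DihedralGroup.sr_mul_sr, fsub]
          rw [mul_assoc, ← mul_assoc (f i), fs', mul_assoc, ← mul_assoc, hss, one_mul, fcomm] }
  have hsf : ∀ i, s * f i ≠ 1 := by
    intro i hi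
    have : s = (f i)⁻¹ := eq_inv_of_mul_eq_one_left hi
    have h2 := fs 1
    rw [this, ← fneg, ← fneg, ← fneg, ← fadd, ← fadd, neg_neg, neg_add_cancel_comm] at h2
    have h3 : (1 - -1 : ZMod 5) = 0 := finj _ (by rw [fsub, ← h2, mul_inv_cancel])
    exact hne h3
  refine ⟨(MulEquiv.ofBijective φ ⟨(injective_iff_map_eq_one φ).2 ?_, ?_⟩).symm⟩
  · rintro (i | i) hi
    · rw [finj i hi]; rfl
    · exact absurd hi (hsf i)
  · have key : ∀ i : ℕ, f i = c ^ i := fun i => by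
      simp only [f, ZMod.val_natCast]; rw [← ho, pow_mod_orderOf]
    intro h
    rcases hH h with ⟨i, rfl⟩ | ⟨i, rfl⟩
    · exact ⟨.r i, key i⟩
    · exact ⟨.sr i, by rw [← key]; rfl⟩

theorem transitive_subgroup_perm_five (G : Subgroup (Perm (Fin 5)))
    (htrans : ∀ i j : Fin 5, ∃ σ ∈ G, σ i = j) :
    ∃ c ∈ G, c ^ 5 = 1 ∧ c ≠ 1 ∧
    ((G ≤ alternatingGroup (Fin 5) ∧ (Nonempty (G ≃* Multiplicative (ZMod 5)) ∨
        Nonempty (G ≃* DihedralGroup 5) ∨ Nonempty (G ≃* alternatingGroup (Fin 5)))) ∨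
      ((IsFrobeniusGroup20 G ∨ Nonempty (G ≃* Perm (Fin 5))) ∧
        ∃ τ ∈ G, τ * c * τ⁻¹ = c ^ 2)) := by
  have : Fact (Nat.Prime 5) := ⟨Nat.prime_five⟩
  have htr : MulAction.IsPretransitive G (Fin 5) :=
    ⟨fun i j => by obtain ⟨σ, hσ, h⟩ := htrans i j; exact ⟨⟨σ, hσ⟩, h⟩⟩
  have hdvd : 5 ∣ Nat.card G := by
    have h1 := MulAction.index_stabilizer_of_transitive G (0 : Fin 5)
    have h2 := (MulAction.stabilizer G (0 : Fin 5)).index_dvd_card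
    rw [h1] at h2
    simpa using h2
  obtain ⟨⟨c, hcG⟩, hc⟩ := exists_prime_orderOf_dvd_card' 5 hdvd
  rw [Subgroup.orderOf_mk] at hc
  have h5 : c ^ 5 = 1 := orderOf_dvd_iff_pow_eq_one.1 (by rw [hc])
  have h1 : c ≠ 1 := by rintro rfl; simp at hc
  have hsc : Perm.sign c = 1 := by
    have := congrArg Perm.sign h5
    rw [map_pow, map_one] at this
    rcases Int.units_eq_one_or (Perm.sign c) with h | h
    · exact h
    · rw [h] at this; exact absurd this (by decide)
  by_cases hn : ∀ d ∈ G, ∃ m : Fin 5, d * c * d⁻¹ = c ^ (m : ℕ)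
  · refine ⟨c, hcG, h5, h1, ?_⟩
    by_cases h2 : ∃ τ ∈ G, τ * c * τ⁻¹ = c ^ 2
    · right
      refine ⟨Or.inl ?_, h2⟩
      obtain ⟨τ, hτG, hτ⟩ := h2
      obtain ⟨ht4, ht2, -⟩ := five_cycle_conj_two h5 h1 hτ
      refine ⟨⟨c, hcG⟩, ⟨τ, hτG⟩, by rwa [Subgroup.orderOf_mk], ?_, Subtype.ext hτ, ?_⟩
      · rw [Subgroup.orderOf_mk]
        exact orderOf_eq_prime_pow (p := 2) (n := 1) (by simpa using ht2) (by simpa using ht4)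
      · rw [eq_top_iff]
        rintro ⟨d, hd⟩ -
        set C := Subgroup.closure ({⟨c, hcG⟩, ⟨τ, hτG⟩} : Set G)
        have hcC : (⟨c, hcG⟩ : G) ∈ C := Subgroup.subset_closure (by simp)
        have htC : (⟨τ, hτG⟩ : G) ∈ C := Subgroup.subset_closure (by simp)
        have key : ∃ n : ℕ, d * c * d⁻¹ = τ ^ n * c * (τ ^ n)⁻¹ := by
          have p1 : τ ^ 1 * c * (τ ^ 1)⁻¹ = c ^ 2 := by simpa using hτ
          have p2 : τ ^ 2 * c * (τ ^ 2)⁻¹ = c ^ 4 := by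
            calc _ = τ * (τ * c * τ⁻¹) * τ⁻¹ := by rw [sq]; group
              _ = (τ * c * τ⁻¹) ^ 2 := by rw [conj_pow, hτ]
              _ = c ^ 4 := by rw [hτ, ← pow_mul]
          have p3 : τ ^ 3 * c * (τ ^ 3)⁻¹ = c ^ 3 := by
            calc _ = τ * (τ ^ 2 * c * (τ ^ 2)⁻¹) * τ⁻¹ := by rw [pow_succ' τ 2]; group
              _ = (τ * c * τ⁻¹) ^ 4 := by rw [conj_pow, p2]
              _ = c ^ 5 * c ^ 3 := by rw [hτ, ← pow_mul, ← pow_add]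
              _ = c ^ 3 := by rw [h5, one_mul]
          obtain ⟨m, hm⟩ := hn d hd
          fin_cases m
          · exfalso
            simp at hm
            exact h1 hm
          · exact ⟨0, by simpa using hm⟩
          · exact ⟨1, by rw [hm, p1]⟩
          · exact ⟨3, by rw [hm, p3]⟩
          · exact ⟨2, by rw [hm, p2]⟩
        obtain ⟨n, hn'⟩ := key
        obtain ⟨i, hi⟩ := five_cycle_commute h5 h1 (d := (τ ^ n)⁻¹ * d) (by
          calc _ = (τ ^ n)⁻¹ * (d * c * d⁻¹) * τ ^ n := by group
            _ = c := by rw [hn']; group)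
        have : (⟨d, hd⟩ : G) = ⟨τ, hτG⟩ ^ n * ⟨c, hcG⟩ ^ i := by
          apply Subtype.ext
          simp [← hi]
        rw [this]
        exact mul_mem (pow_mem htC _) (pow_mem hcC _)
    · left
      have hm : ∀ d ∈ G, d * c * d⁻¹ = c ∨ d * c * d⁻¹ = c ^ 4 := by
        intro d hd
        obtain ⟨m, hm⟩ := hn d hd
        fin_cases m
        · exfalso
          simp at hm
          exact h1 hm
        · left; simpa using hm
        · exact absurd ⟨d, hd, by simpa using hm⟩ h2
        · refine absurd ⟨d⁻¹, inv_mem hd, ?_⟩ h2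
          have h3 : d * c * d⁻¹ = c ^ 3 := by simpa using hm
          calc _ = d⁻¹ * (c ^ 5 * c) * d := by rw [h5]; group
            _ = d⁻¹ * (c ^ 3) ^ 2 * d := by rw [← pow_succ, ← pow_mul]
            _ = c ^ 2 := by rw [← h3, conj_pow]; group
        · right; simpa using hm
      refine ⟨fun d hd => Perm.mem_alternatingGroup.2 ?_, ?_⟩
      · rcases hm d hd with h | h
        · obtain ⟨i, rfl⟩ := five_cycle_commute h5 h1 h
          simp [hsc]
        · exact (five_cycle_conj_four h5 h1 h).2
      · by_cases h4 : ∃ s ∈ G, s * c * s⁻¹ = c ^ 4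
        · right; left
          obtain ⟨s, hsG, hs⟩ := h4
          have hs2 := (five_cycle_conj_four h5 h1 hs).1
          have hinv : c ^ 4 = c⁻¹ := by
            rw [eq_inv_iff_mul_eq_one, ← pow_succ, h5]
          refine nonempty_mulEquiv_dihedralGroup_five (c := ⟨c, hcG⟩) (s := ⟨s, hsG⟩)
            (Subtype.ext h5) (fun h => h1 (congrArg Subtype.val h)) (Subtype.ext hs2)
            (Subtype.ext (hs.trans hinv)) ?_
          rintro ⟨d, hd⟩
          rcases hm d hd with h | h
          · left
            obtain ⟨i, hi⟩ := five_cycle_commute h5 h1 h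
            exact ⟨i, Subtype.ext (by simp [hi])⟩
          · right
            obtain ⟨i, hi⟩ := five_cycle_commute h5 h1 (d := s⁻¹ * d) (by
              calc _ = s⁻¹ * (d * c * d⁻¹) * s := by group
                _ = c := by rw [h, ← hs]; group)
            exact ⟨i, Subtype.ext (by simp [← hi])⟩
        · left
          have hG : ∀ g : G, g ∈ Subgroup.zpowers (⟨c, hcG⟩ : G) := by
            rintro ⟨d, hd⟩
            rcases hm d hd with h | h
            · obtain ⟨i, hi⟩ := five_cycle_commute h5 h1 h
              exact ⟨i, Subtype.ext (by simp [hi])⟩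
            · exact absurd ⟨d, hd, h⟩ h4
          have hcard : Nat.card G = 5 := by
            rw [← orderOf_eq_card_of_forall_mem_zpowers hG, Subgroup.orderOf_mk, hc]
          exact ⟨mulEquivOfPrimeCardEq (p := 5) hcard (by simp)⟩
  · push Not at hn
    obtain ⟨d, hd, hdm⟩ := hn
    obtain ⟨i, j, hij⟩ := (five_cycle_normalize_or h5 h1 d).resolve_left
      (fun ⟨m, hm⟩ => hdm m hm)
    have hle : alternatingGroup (Fin 5) ≤ G :=
      Perm.alternatingGroup_le_of_isPreprimitive_of_isThreeCycle_mem
        (MulAction.IsPreprimitive.of_prime_card (by simp [Nat.prime_five])) hij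
        (mul_mem (pow_mem hcG _) (pow_mem (mul_mem (mul_mem hd hcG) (inv_mem hd)) _))
    by_cases hGA : G ≤ alternatingGroup (Fin 5)
    · refine ⟨c, hcG, h5, h1, Or.inl ⟨hGA, Or.inr (Or.inr ?_)⟩⟩
      rw [le_antisymm hGA hle]
      exact ⟨MulEquiv.refl _⟩
    · obtain ⟨s, hsG, hs⟩ := SetLike.not_le_iff_exists.1 hGA
      have hs' : Perm.sign s = -1 :=
        (Int.units_eq_one_or _).resolve_left (fun h => hs (Perm.mem_alternatingGroup.2 h))
      have htop : G = ⊤ := by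
        rw [eq_top_iff]
        intro g _
        rcases Int.units_eq_one_or (Perm.sign g) with h | h
        · exact hle (Perm.mem_alternatingGroup.2 h)
        · have : s⁻¹ * g ∈ G := hle (Perm.mem_alternatingGroup.2 (by simp [h, hs']))
          simpa using mul_mem hsG this
      subst htop
      refine ⟨finRotate 5, trivial, by decide, by decide,
        Or.inr ⟨Or.inr ⟨Subgroup.topEquiv⟩, ?_⟩⟩
      have : ∃ τ : Perm (Fin 5), τ * finRotate 5 * τ⁻¹ = finRotate 5 ^ 2 := by
        refine ⟨⟨fun i => 2 * i, fun i => 3 * i, by decide, by decide⟩, by decide⟩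
      obtain ⟨τ, hτ⟩ := this
      exact ⟨τ, trivial, hτ⟩

theorem not_frobenius_or_perm_of_mulEquiv {G : Type*} [Group G]
    (h : Nonempty (G ≃* Multiplicative (ZMod 5)) ∨ Nonempty (G ≃* DihedralGroup 5) ∨
      Nonempty (G ≃* alternatingGroup (Fin 5))) :
    ¬ (IsFrobeniusGroup20 G ∨ Nonempty (G ≃* Perm (Fin 5))) := by
  have hcard : Nat.card G = 5 ∨ Nat.card G = 10 ∨ Nat.card G = 60 := by
    rcases h with ⟨⟨f⟩⟩ | ⟨⟨f⟩⟩ | ⟨⟨f⟩⟩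
    · left; rw [Nat.card_congr f.toEquiv]; simp
    · right; left; rw [Nat.card_congr f.toEquiv, DihedralGroup.nat_card]
    · right; right; rw [Nat.card_congr f.toEquiv]; simp; rfl
  rintro (⟨a, b, ha, hb, hab, htop⟩ | ⟨⟨f⟩⟩)
  · have : Finite G := Nat.finite_of_card_ne_zero (by omega)
    have h4 : 4 ∣ Nat.card G := hb ▸ orderOf_dvd_natCard b
    obtain ⟨f⟩ : Nonempty (G ≃* alternatingGroup (Fin 5)) := by
      rcases h with ⟨⟨f⟩⟩ | ⟨⟨f⟩⟩ | h
      · exfalso; rw [Nat.card_congr f.toEquiv] at h4; revert h4; simp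
      · exfalso; rw [Nat.card_congr f.toEquiv, DihedralGroup.nat_card] at h4; omega
      · exact h
    have key : ∀ s : Perm (Fin 5), s ^ 4 = 1 → Perm.sign s = 1 → s ^ 2 = 1 := by decide +kernel
    have hb2 : (f b) ^ 2 = 1 := Subtype.ext (key (f b)
      (by rw [← Subgroup.coe_pow, ← map_pow, ← hb, pow_orderOf_eq_one, map_one]; rfl)
      (Perm.mem_alternatingGroup.1 (f b).2))
    have : orderOf (f b) ∣ 2 := orderOf_dvd_of_pow_eq_one hb2
    rw [MulEquiv.orderOf_eq, hb] at this
    revert this; decide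
  · have := Nat.card_congr f.toEquiv
    rw [Nat.card_perm, Nat.card_fin] at this
    have h120 : Nat.factorial 5 = 120 := rfl
    omega

end PermFive

section InvariantGenerators

theorem algebraicIndependent_of_adjoin_eq_top {F E S T : Type*} [Field F] [Field E] [Algebra F E]
    [Finite S] [Finite T] (hcard : Nat.card T ≤ Nat.card S) {y : S → E}
    (hy : AlgebraicIndependent F y) {z : T → E}
    (hz : IntermediateField.adjoin F (Set.range z) = ⊤) : AlgebraicIndependent F z := by
  have halg : Algebra.IsAlgebraic (Algebra.adjoin F (Set.range z)) E := by
    refine IntermediateField.isAlgebraic_adjoin_iff_top.1 ?_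
    rw [hz]
    exact ⟨fun x => isAlgebraic_algebraMap (⟨x, trivial⟩ : (⊤ : IntermediateField F E))⟩
  have h1 := hy.lift_cardinalMk_le_trdeg
  refine (Algebra.IsAlgebraic.isTranscendenceBasis_of_lift_le_trdeg_of_finite F z ?_).1
  have := Fintype.ofFinite S
  have := Fintype.ofFinite T
  simp only [Nat.card_eq_fintype_card] at hcard
  simp only [Cardinal.mk_fintype, Cardinal.lift_natCast, Cardinal.nat_le_lift_iff] at h1 ⊢
  exact le_trans (by exact_mod_cast hcard) h1

variable {Γ K F E S : Type*} [Group Γ] [Field K] [Field F] [Field E]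
  [Algebra K F] [Algebra F E]

theorem ringHom_aeval_eq_of_fixed {R A σ : Type*} [CommRing R] [CommRing A] [Algebra R A]
    {f : R →+* R} {φ : A →+* A} (hcomp : ∀ a, φ (algebraMap R A a) = algebraMap R A (f a))
    {z : σ → A} (hz : ∀ s, φ (z s) = z s) (p : MvPolynomial σ R) :
    φ (aeval z p) = aeval z (MvPolynomial.map f p) := by
  rw [aeval_def, aeval_def, eval₂_map, hom_eval₂]
  congr 1
  · exact RingHom.ext hcomp
  · exact funext hz

theorem exists_map_eq_of_aeval_fixed (ρF : Γ →* (F →+* F)) (ρE : Γ →* (E →+* E))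
    (hcomp : ∀ g a, ρE g (algebraMap F E a) = algebraMap F E (ρF g a))
    (hfix : ∀ a : F, (∀ g, ρF g a = a) → ∃ b, algebraMap K F b = a) {z : S → E}
    (hz : AlgebraicIndependent F z) (hzfix : ∀ g s, ρE g (z s) = z s)
    {p : MvPolynomial S F} (hp : ∀ g, ρE g (aeval z p) = aeval z p) :
    ∃ q : MvPolynomial S K, MvPolynomial.map (algebraMap K F) q = p := by
  rw [← Set.mem_range, MvPolynomial.mem_range_map_iff_coeffs_subset]
  intro c hc
  obtain ⟨n, -, rfl⟩ := MvPolynomial.mem_coeffs_iff.1 hc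
  refine hfix _ fun g => ?_
  have : MvPolynomial.map (ρF g) p = p :=
    hz ((ringHom_aeval_eq_of_fixed (hcomp g) (hzfix g) p).symm.trans (hp g))
  conv_rhs => rw [← this, coeff_map]

theorem span_invariants_eq [Finite Γ] (ρF : Γ →* (F →+* F)) (hinj : Function.Injective ρF)
    (ρE : Γ →* (E →+* E)) (hcomp : ∀ g a, ρE g (algebraMap F E a) = algebraMap F E (ρF g a))
    (V : Submodule F E) (hV : ∀ g, ∀ v ∈ V, ρE g v ∈ V) :
    Submodule.span F {v | v ∈ V ∧ ∀ g, ρE g v = v} = V := by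
  classical
  have := Fintype.ofFinite Γ
  refine le_antisymm (Submodule.span_le.2 fun v hv => hv.1) fun v hv => ?_
  by_contra hvn
  obtain ⟨ℓ, hℓ, hker⟩ := Submodule.exists_le_ker_of_notMem hvn
  have hsum : ∀ b : F, ∑ g, ℓ (ρE g v) * ρF g b = 0 := by
    intro b
    have hinvt : ∑ g, ρF g b • ρE g v ∈ {v | v ∈ V ∧ ∀ g, ρE g v = v} := by
      refine ⟨Submodule.sum_mem _ fun g _ => V.smul_mem _ (hV g v hv), fun h => ?_⟩
      rw [map_sum]
      refine Fintype.sum_equiv (Equiv.mulLeft h) _ _ fun g => ?_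
      simp [Algebra.smul_def, hcomp]
    have h0 := hker (Submodule.subset_span hinvt)
    rw [LinearMap.mem_ker, map_sum] at h0
    rw [← h0]
    exact Finset.sum_congr rfl fun g _ => by rw [map_smul, smul_eq_mul, mul_comm]
  have hli := (linearIndependent_monoidHom F F).comp
    (fun g : Γ => ((ρF g : F →+* F) : F →* F)) (fun g h hgh => hinj (RingHom.ext fun x =>
      congrArg (fun f : F →* F => f x) hgh))
  have := Fintype.linearIndependent_iff.1 hli (fun g => ℓ (ρE g v)) (funext fun b => by
    simpa using hsum b) 1
  apply hℓ
  simpa using this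

theorem exists_invariant_generators [Algebra K E] [IsScalarTower K F E] [Finite Γ] [Finite S] (ρF : Γ →* (F →+* F))
    (hinj : Function.Injective ρF)
    (ρE : Γ →* (E →+* E)) (hcomp : ∀ g a, ρE g (algebraMap F E a) = algebraMap F E (ρF g a))
    (hfix : ∀ a : F, (∀ g, ρF g a = a) → ∃ b, algebraMap K F b = a) {q : S → E}
    (hq : AlgebraicIndependent F q) (hqtop : IntermediateField.adjoin F (Set.range q) = ⊤)
    (hperm : ∀ g s, ∃ s', ρE g (q s) = q s') :
    ∃ z : S → E, (∀ g s, ρE g (z s) = z s) ∧ AlgebraicIndependent F z ∧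
      IntermediateField.adjoin F (Set.range z) = ⊤ ∧
      Submodule.span F (Set.range z) = Submodule.span F (Set.range q) ∧
      ∀ e, (∀ g, ρE g e = e) → e ∈ IntermediateField.adjoin K (Set.range z) := by
  classical
  have := Fintype.ofFinite Γ
  set V := Submodule.span F (Set.range q)
  have hV : ∀ g, ∀ v ∈ V, ρE g v ∈ V := by
    intro g v hv
    induction hv using Submodule.span_induction with
    | mem x hx =>
      obtain ⟨s, rfl⟩ := hx
      obtain ⟨s', hs'⟩ := hperm g s
      rw [hs']
      exact Submodule.subset_span ⟨s', rfl⟩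
    | zero => simp
    | add x y _ _ hx hy => rw [map_add]; exact add_mem hx hy
    | smul a x _ hx =>
      rw [Algebra.smul_def, map_mul, hcomp, ← Algebra.smul_def]
      exact V.smul_mem _ hx
  obtain ⟨b, hbI, hbspan, hbli⟩ := exists_linearIndependent F {v | v ∈ V ∧ ∀ g, ρE g v = v}
  rw [span_invariants_eq ρF hinj ρE hcomp V hV] at hbspan
  have hqb : LinearIndependent F q := hq.linearIndependent
  let B1 := Module.Basis.span hqb
  let B2 := (Module.Basis.span hbli).map
    (LinearEquiv.ofEq (Submodule.span F (Set.range ((↑) : b → E))) V (by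
      rw [Subtype.range_coe, hbspan]))
  let ε := B1.indexEquiv B2
  let z : S → E := fun s => (ε s : E)
  have hzr : Set.range z = b := by
    rw [show z = ((↑) : b → E) ∘ ε from rfl, ε.surjective.range_comp, Subtype.range_coe]
  have hzfix : ∀ g s, ρE g (z s) = z s := fun g s => (hbI (ε s).2).2 g
  have hzspan : Submodule.span F (Set.range z) = V := by rw [hzr, hbspan]
  have hztop : IntermediateField.adjoin F (Set.range z) = ⊤ := by
    rw [eq_top_iff, ← hqtop, IntermediateField.adjoin_le_iff]
    rintro _ ⟨s, rfl⟩
    have h1 : q s ∈ Submodule.span F (Set.range z) := hzspan ▸ Submodule.subset_span ⟨s, rfl⟩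
    have h2 : Submodule.span F (Set.range z) ≤
        Subalgebra.toSubmodule (IntermediateField.adjoin F (Set.range z)).toSubalgebra :=
      Submodule.span_le.2 (IntermediateField.subset_adjoin F _)
    exact h2 h1
  have hz : AlgebraicIndependent F z := algebraicIndependent_of_adjoin_eq_top le_rfl hq hztop
  refine ⟨z, hzfix, hz, hztop, hzspan, fun e he => ?_⟩
  have hmem : ∀ p : MvPolynomial S F, (∀ g, ρE g (aeval z p) = aeval z p) →
      aeval z p ∈ IntermediateField.adjoin K (Set.range z) := by
    intro p hp
    obtain ⟨r, rfl⟩ := exists_map_eq_of_aeval_fixed ρF ρE hcomp hfix hz hzfix hp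
    rw [aeval_map_algebraMap]
    have h3 : aeval z r ∈ Algebra.adjoin K (Set.range z) := by
      rw [Algebra.adjoin_range_eq_range_aeval]; exact ⟨r, rfl⟩
    exact IntermediateField.algebra_adjoin_le_adjoin K _ h3
  have hetop : e ∈ IntermediateField.adjoin F (Set.range z) := hztop ▸ trivial
  obtain ⟨p, r, hpr⟩ := (IntermediateField.mem_adjoin_range_iff F z e).1 hetop
  by_cases hr : aeval z r = 0
  · rw [hpr, hr, div_zero]; exact zero_mem _
  let D : MvPolynomial S F := ∏ g, MvPolynomial.map (ρF g) r
  let N : MvPolynomial S F := p * ∏ g ∈ Finset.univ.erase 1, MvPolynomial.map (ρF g) r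
  have hDval : aeval z D = ∏ g, ρE g (aeval z r) := by
    simp only [D, map_prod, ringHom_aeval_eq_of_fixed (hcomp _) (hzfix _)]
  have hD0 : aeval z D ≠ 0 := by
    rw [hDval]
    exact Finset.prod_ne_zero_iff.2 fun g _ => (map_ne_zero _).2 hr
  have hDfix : ∀ g, ρE g (aeval z D) = aeval z D := fun h => by
    rw [hDval, map_prod]
    exact Fintype.prod_equiv (Equiv.mulLeft h) _ _ fun g => by
      rw [Equiv.coe_mulLeft, map_mul]; rfl
  have hN : aeval z N = e * aeval z D := by
    have h1 : D = r * ∏ g ∈ Finset.univ.erase 1, MvPolynomial.map (ρF g) r := by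
      have h2 := Finset.mul_prod_erase Finset.univ (fun g => MvPolynomial.map (ρF g) r)
        (Finset.mem_univ (1 : Γ))
      rw [map_one] at h2
      rw [show D = _ from h2.symm]
      congr 1
      exact MvPolynomial.map_id r
    rw [h1, map_mul, map_mul, ← mul_assoc, hpr, div_mul_cancel₀ _ hr]
  have : e = aeval z N / aeval z D := by rw [hN, mul_div_cancel_right₀ _ hD0]
  rw [this]
  exact div_mem (hmem _ fun g => by rw [hN, map_mul, he, hDfix]) (hmem _ hDfix)

end InvariantGenerators

section StablyRational

theorem algebraicIndependent_fractionRing_X (F σ : Type*) [Field F] :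
    AlgebraicIndependent F
      (fun i => algebraMap (MvPolynomial σ F) (FractionRing (MvPolynomial σ F)) (X i)) :=
  (MvPolynomial.algebraicIndependent_X σ F).map'
    (f := IsScalarTower.toAlgHom F (MvPolynomial σ F) (FractionRing (MvPolynomial σ F)))
    (IsFractionRing.injective _ _)

theorem algebraMap_fractionRing_eq_aeval {F σ : Type*} [Field F] (p : MvPolynomial σ F) :
    algebraMap (MvPolynomial σ F) (FractionRing (MvPolynomial σ F)) p =
      aeval (fun i => algebraMap (MvPolynomial σ F) (FractionRing (MvPolynomial σ F)) (X i)) p :=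
  DFunLike.congr_fun (MvPolynomial.algHom_ext
    (f := IsScalarTower.toAlgHom F (MvPolynomial σ F) (FractionRing (MvPolynomial σ F)))
    (g := aeval _) fun i => by simp) p

theorem adjoin_fractionRing_X (F σ : Type*) [Field F] :
    IntermediateField.adjoin F (Set.range
      (fun i => algebraMap (MvPolynomial σ F) (FractionRing (MvPolynomial σ F)) (X i))) = ⊤ := by
  rw [eq_top_iff]
  rintro a -
  obtain ⟨p, q, -, rfl⟩ := IsFractionRing.div_surjective (A := MvPolynomial σ F) a
  rw [algebraMap_fractionRing_eq_aeval, algebraMap_fractionRing_eq_aeval]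
  exact (IntermediateField.mem_adjoin_range_iff _ _ _).2 ⟨p, q, rfl⟩

variable {k K E : Type*} [Field k] [Field K] [Field E] [Algebra k K] [Algebra K E] [Algebra k E]
  [IsScalarTower k K E]

theorem isStablyRational_of_adjoin_eq {S T : Type*} [Finite S] [Finite T] {y : S → E} {z : T → E}
    (hy : AlgebraicIndependent K y) (hz : AlgebraicIndependent k z)
    (h : (IntermediateField.adjoin K (Set.range y)).restrictScalars k =
      IntermediateField.adjoin k (Set.range z)) : IsStablyRational k K := by
  obtain ⟨m, ⟨σ⟩⟩ := Finite.exists_equiv_fin S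
  obtain ⟨n, ⟨τ⟩⟩ := Finite.exists_equiv_fin T
  have hy' : AlgebraicIndependent K (y ∘ σ.symm) := hy.comp _ σ.symm.injective
  have hz' : AlgebraicIndependent k (z ∘ τ.symm) := hz.comp _ τ.symm.injective
  have hyr : Set.range (y ∘ σ.symm) = Set.range y := σ.symm.surjective.range_comp y
  have hzr : Set.range (z ∘ τ.symm) = Set.range z := τ.symm.surjective.range_comp z
  have h' : (IntermediateField.adjoin K (Set.range (y ∘ σ.symm))).restrictScalars k =
      IntermediateField.adjoin k (Set.range (z ∘ τ.symm)) := by rw [hyr, hzr, h]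
  exact ⟨m, n, ⟨(hy'.aevalEquivField.restrictScalars k).trans
    ((IntermediateField.equivOfEq h').trans hz'.aevalEquivField.symm)⟩⟩

theorem exists_generators_of_algEquiv {m n : ℕ}
    (f : FractionRing (MvPolynomial (Fin m) K) ≃ₐ[k] FractionRing (MvPolynomial (Fin n) k))
    {y : Fin m → E} (hy : AlgebraicIndependent K y) :
    ∃ z : Fin n → E, AlgebraicIndependent k z ∧
      (IntermediateField.adjoin K (Set.range y)).restrictScalars k =
        IntermediateField.adjoin k (Set.range z) := by
  let j : FractionRing (MvPolynomial (Fin n) k) →ₐ[k] E :=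
    ((IntermediateField.adjoin K (Set.range y)).val.restrictScalars k).comp
      (f.symm.trans (hy.aevalEquivField.restrictScalars k)).toAlgHom
  let X' : Fin n → FractionRing (MvPolynomial (Fin n) k) := fun i =>
    algebraMap (MvPolynomial (Fin n) k) _ (X i)
  have hX : AlgebraicIndependent k X' := algebraicIndependent_fractionRing_X k (Fin n)
  have hXtop : IntermediateField.adjoin k (Set.range X') = ⊤ := adjoin_fractionRing_X k (Fin n)
  refine ⟨fun i => j (X' i), hX.map' j.toRingHom.injective, ?_⟩
  rw [show Set.range (fun i => j (X' i)) = j '' Set.range X' from Set.range_comp j X',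
    ← IntermediateField.adjoin_map, hXtop]
  ext e
  simp only [IntermediateField.mem_restrictScalars, IntermediateField.mem_map,
    IntermediateField.mem_top, true_and]
  constructor
  · intro he
    exact ⟨f (hy.aevalEquivField.symm ⟨e, he⟩), by simp [j]⟩
  · rintro ⟨a, rfl⟩
    exact Subtype.property _

end StablyRational

section Actions

variable {Γ : Type*} [Group Γ]

/-- The action on the fraction field induced by an action on a domain. -/
def fracAct {A : Type*} [CommRing A] [IsDomain A] (ρ : Γ →* (A →+* A)) :
    Γ →* (FractionRing A →+* FractionRing A) where
  toFun g := IsFractionRing.map (A := A) (B := A) (K := FractionRing A) (L := FractionRing A)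
    (j := ρ g) (Function.LeftInverse.injective (g := ρ g⁻¹) fun a => by
      change (ρ g⁻¹ * ρ g) a = a
      rw [← map_mul, inv_mul_cancel, map_one]; rfl)
  map_one' := by
    refine IsLocalization.ringHom_ext (nonZeroDivisors A) (RingHom.ext fun a => ?_)
    simp [IsFractionRing.map]
  map_mul' g h := by
    refine IsLocalization.ringHom_ext (nonZeroDivisors A) (RingHom.ext fun a => ?_)
    simp [IsFractionRing.map]

@[simp]
theorem fracAct_algebraMap {A : Type*} [CommRing A] [IsDomain A] (ρ : Γ →* (A →+* A)) (g : Γ)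
    (a : A) : fracAct ρ g (algebraMap A (FractionRing A) a) = algebraMap A _ (ρ g a) := by
  simp [fracAct, IsFractionRing.map]

/-- The action on a polynomial ring induced by an action on coefficients and on the variables. -/
def polyAct {R S : Type*} [CommRing R] (ρ : Γ →* (R →+* R)) (π : Γ →* Equiv.Perm S) :
    Γ →* (MvPolynomial S R →+* MvPolynomial S R) where
  toFun g := eval₂Hom (C.comp (ρ g)) fun s => X (π g s)
  map_one' := by ext <;> simp
  map_mul' g h := by ext <;> simp

@[simp]
theorem polyAct_C {R S : Type*} [CommRing R] (ρ : Γ →* (R →+* R)) (π : Γ →* Equiv.Perm S) (g : Γ)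
    (a : R) : polyAct ρ π g (C a) = C (ρ g a) := by
  simp [polyAct]

@[simp]
theorem polyAct_X {R S : Type*} [CommRing R] (ρ : Γ →* (R →+* R)) (π : Γ →* Equiv.Perm S) (g : Γ)
    (s : S) : polyAct ρ π g (X s) = X (π g s) := by
  simp [polyAct]

end Actions

section FiveCycle

theorem exists_pow_five_cycle {c : Equiv.Perm (Fin 5)} (h5 : c ^ 5 = 1) (h1 : c ≠ 1)
    (i j : Fin 5) : ∃ l : Fin 5, (c ^ (l : ℕ)) i = j := by
  obtain ⟨p, rfl⟩ := exists_conj_finRotate_five c h5 h1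
  have key : ∀ i j : Fin 5, ∃ l : Fin 5, (finRotate 5 ^ (l : ℕ)) i = j := by decide
  obtain ⟨l, hl⟩ := key (p⁻¹ i) (p⁻¹ j)
  refine ⟨l, ?_⟩
  rw [conj_pow]
  change p ((finRotate 5 ^ (l : ℕ)) (p⁻¹ i)) = j
  rw [hl]
  exact p.apply_symm_apply j

theorem bijective_pow_five_cycle {c : Equiv.Perm (Fin 5)} (h5 : c ^ 5 = 1) (h1 : c ≠ 1)
    (i : Fin 5) : Function.Bijective fun l : Fin 5 => (c ^ (l : ℕ)) i :=
  Function.Surjective.bijective_of_finite fun j => exists_pow_five_cycle h5 h1 i j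

theorem prod_pow_five_cycle {M : Type*} [CommMonoid M] {c : Equiv.Perm (Fin 5)} (h5 : c ^ 5 = 1)
    (h1 : c ≠ 1) (f : Fin 5 → M) (i : Fin 5) :
    ∏ l ∈ Finset.range 5, f ((c ^ l) i) = ∏ i, f i := by
  rw [← Fin.prod_univ_eq_prod_range (fun l => f ((c ^ l) i))]
  exact Fintype.prod_bijective _ (bijective_pow_five_cycle h5 h1 i) _ _ fun _ => rfl

theorem sum_pow_five_cycle {M : Type*} [AddCommMonoid M] {c : Equiv.Perm (Fin 5)} (h5 : c ^ 5 = 1)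
    (h1 : c ≠ 1) (f : Fin 5 → M) (i : Fin 5) :
    ∑ l ∈ Finset.range 5, f ((c ^ l) i) = ∑ i, f i :=
  prod_pow_five_cycle (M := Multiplicative M) h5 h1 f i

end FiveCycle

section CycleElement

variable {F : Type*} [Field F]

/-- An element `y` with `y (c i) = x i * y i` for a five-cycle `c` and `∏ x = 1`. -/
def cycleElement (x : Fin 5 → F) (c : Equiv.Perm (Fin 5)) (i : Fin 5) : F :=
  ∑ n ∈ Finset.range 5, ∏ l ∈ Finset.range n, (x ((c ^ l) i))⁻¹

theorem cycleElement_apply {x : Fin 5 → F} (hx : ∏ i, x i = 1) {c : Equiv.Perm (Fin 5)}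
    (h5 : c ^ 5 = 1) (h1 : c ≠ 1) (i : Fin 5) :
    cycleElement x c (c i) = x i * cycleElement x c i := by
  have hx0 : x i ≠ 0 := fun h => by
    rw [Finset.prod_eq_zero (Finset.mem_univ i) h] at hx; exact zero_ne_one hx
  have hp : ∏ l ∈ Finset.range 5, (x ((c ^ l) i))⁻¹ = 1 := by
    rw [Finset.prod_inv_distrib, prod_pow_five_cycle h5 h1, hx, inv_one]
  have key : ∀ n, ∏ l ∈ Finset.range n, (x ((c ^ l) (c i)))⁻¹ =
      x i * ∏ l ∈ Finset.range (n + 1), (x ((c ^ l) i))⁻¹ := fun n => by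
    rw [Finset.prod_range_succ', mul_comm, mul_assoc, pow_zero, Equiv.Perm.one_apply,
      inv_mul_cancel₀ hx0, mul_one]
    rfl
  have hs : ∑ n ∈ Finset.range 5, ∏ l ∈ Finset.range (n + 1), (x ((c ^ l) i))⁻¹ =
      ∑ n ∈ Finset.range 5, ∏ l ∈ Finset.range n, (x ((c ^ l) i))⁻¹ := by
    have h6 := Finset.sum_range_succ' (fun n => ∏ l ∈ Finset.range n, (x ((c ^ l) i))⁻¹) 5
    rw [Finset.sum_range_succ, hp, Finset.range_zero, Finset.prod_empty] at h6
    exact (add_right_cancel h6).symm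
  rw [cycleElement, Finset.sum_congr rfl fun n _ => key n, ← Finset.mul_sum, hs, cycleElement]

theorem map_cycleElement {x : Fin 5 → F} {f : F →+* F} {p : Equiv.Perm (Fin 5)}
    (hf : ∀ i, f (x i) = x (p i)) (c : Equiv.Perm (Fin 5)) (i : Fin 5) :
    f (cycleElement x c i) = cycleElement x (p * c * p⁻¹) (p i) := by
  simp [cycleElement, map_sum, map_prod, hf, conj_pow]

theorem cycleElement_ne_zero {L : Type*} [Field L] [Algebra L F] {x : Fin 5 → F}
    (hx : ∏ i, x i = 1) (hind : AlgebraicIndependent L fun i : Fin 4 => x i.castSucc)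
    {c : Equiv.Perm (Fin 5)} (h5 : c ^ 5 = 1) (h1 : c ≠ 1) (i : Fin 5) :
    cycleElement x c i ≠ 0 := by
  have hx0 : ∀ i, x i ≠ 0 := fun i h => by
    rw [Finset.prod_eq_zero (Finset.mem_univ i) h] at hx; exact zero_ne_one hx
  intro h0
  have hall : ∀ n : ℕ, cycleElement x c ((c ^ n) i) = 0 := by
    intro n
    induction n with
    | zero => simpa using h0
    | succ n ih =>
      rw [pow_succ', Equiv.Perm.mul_apply, cycleElement_apply hx h5 h1, ih, mul_zero]
  obtain ⟨l, hl⟩ := exists_pow_five_cycle h5 h1 i (c 4)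
  have hj := hall l
  rw [hl] at hj
  have hne : ∀ l : Fin 4, (c ^ (l : ℕ)) (c 4) ≠ 4 := by
    intro l h
    have h' : (c ^ ((l.succ : Fin 5) : ℕ)) 4 = (c ^ ((0 : Fin 5) : ℕ)) 4 := by
      rw [Fin.val_succ, pow_succ, Equiv.Perm.mul_apply, h]; simp
    exact absurd ((bijective_pow_five_cycle h5 h1 4).1 h') (Fin.succ_ne_zero l)
  choose f hf using fun l : Fin 4 => Fin.exists_castSucc_eq.2 (hne l)
  let p : MvPolynomial (Fin 4) L := X (f 0) * X (f 1) * X (f 2) * X (f 3) +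
    X (f 1) * X (f 2) * X (f 3) + X (f 2) * X (f 3) + X (f 3) + 1
  have hp : aeval (fun i : Fin 4 => x i.castSucc) p = 0 := by
    have e0 := hx0 ((c ^ 0) (c 4))
    have e1 := hx0 ((c ^ 1) (c 4))
    have e2 := hx0 ((c ^ 2) (c 4))
    have e3 := hx0 ((c ^ 3) (c 4))
    have f0 : x (f 0).castSucc = x ((c ^ 0) (c 4)) := by rw [hf]; rfl
    have f1 : x (f 1).castSucc = x ((c ^ 1) (c 4)) := by rw [hf]; rfl
    have f2 : x (f 2).castSucc = x ((c ^ 2) (c 4)) := by rw [hf]; rfl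
    have f3 : x (f 3).castSucc = x ((c ^ 3) (c 4)) := by rw [hf]; rfl
    simp only [p, map_add, map_mul, aeval_X, map_one, f0, f1, f2, f3]
    simp only [cycleElement, Finset.sum_range_succ, Finset.prod_range_succ, Finset.range_zero,
      Finset.sum_empty, Finset.prod_empty] at hj
    generalize x ((c ^ 0) (c 4)) = a at *
    generalize x ((c ^ 1) (c 4)) = b at *
    generalize x ((c ^ 2) (c 4)) = d at *
    generalize x ((c ^ 3) (c 4)) = e at *
    field_simp at hj
    linear_combination hj
  have hp0 : p = 0 := hind (hp.trans (map_zero _).symm)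
  have := congrArg (MvPolynomial.eval (0 : Fin 4 → L)) hp0
  simp [p] at this

end CycleElement

/-- The action of a finite group `Γ` on the function field `F` of a norm one torus of degree five
over `k` with splitting field `L`; `K` is the field of invariants. -/
structure NormOneAction (k L K F Γ : Type*) [Field k] [Field L] [Field K] [Field F] [Algebra k L]
    [Algebra k K] [Algebra L F] [Algebra K F] [Algebra k F] [Group Γ] where
  x : Fin 5 → F
  prod_x : ∏ i, x i = 1
  algInd : AlgebraicIndependent L fun i : Fin 4 => x i.castSucc
  adjoin_x : IntermediateField.adjoin L (Set.range fun i : Fin 4 => x i.castSucc) = ⊤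
  σ : Γ →* (L →+* L)
  ρ : Γ →* (F →+* F)
  π : Γ →* Equiv.Perm (Fin 5)
  σ_injective : Function.Injective σ
  π_injective : Function.Injective π
  ρ_algebraMap : ∀ g a, ρ g (algebraMap L F a) = algebraMap L F (σ g a)
  ρ_x : ∀ g i, ρ g (x i) = x (π g i)
  σ_base : ∀ g b, σ g (algebraMap k L b) = algebraMap k L b
  σ_fixed : ∀ a, (∀ g, σ g a = a) → ∃ b, algebraMap k L b = a
  ρ_base : ∀ g b, ρ g (algebraMap K F b) = algebraMap K F b
  ρ_fixed : ∀ a, (∀ g, ρ g a = a) → ∃ b, algebraMap K F b = a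
  transitive : ∀ i j, ∃ g, π g i = j

namespace NormOneAction

variable {k L K F Γ : Type*} [Field k] [Field L] [Field K] [Field F] [Algebra k L]
    [Algebra k K] [Algebra L F] [Algebra K F] [Algebra k F] [Group Γ]
    (T : NormOneAction k L K F Γ)

theorem x_ne_zero (i : Fin 5) : T.x i ≠ 0 := fun h => by
  have := T.prod_x
  rw [Finset.prod_eq_zero (Finset.mem_univ i) h] at this
  exact zero_ne_one this

theorem ρ_injective : Function.Injective T.ρ := fun g h hgh =>
  T.σ_injective (RingHom.ext fun a => (algebraMap L F).injective (by
    rw [← T.ρ_algebraMap, ← T.ρ_algebraMap, hgh]))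

end NormOneAction

section FiveCycles

/-- The values of the twelve five-cycles conjugate to `finRotate 5` in `A₅`; the entries `b` and
`b + 6` are inverse to each other. -/
def fiveCycleTable : Fin 12 → Fin 5 → Fin 5 :=
  ![![1, 2, 3, 4, 0], ![1, 3, 0, 4, 2], ![1, 4, 3, 0, 2], ![2, 4, 1, 0, 3], ![2, 4, 3, 1, 0],
    ![3, 2, 4, 1, 0], ![4, 0, 1, 2, 3], ![2, 0, 4, 1, 3], ![3, 0, 4, 2, 1], ![3, 2, 0, 4, 1],
    ![4, 3, 0, 2, 1], ![4, 3, 1, 0, 2]]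

/-- The twelve five-cycles conjugate to `finRotate 5` in `A₅`. -/
def fiveCycle (b : Fin 12) : Equiv.Perm (Fin 5) where
  toFun := fiveCycleTable b
  invFun := fiveCycleTable (b + 6)
  left_inv := by revert b; decide
  right_inv := by revert b; decide

theorem fiveCycle_injective : Function.Injective fiveCycle := by decide +kernel

theorem fiveCycle_pow (b : Fin 12) : fiveCycle b ^ 5 = 1 := by revert b; decide +kernel

theorem fiveCycle_ne_one (b : Fin 12) : fiveCycle b ≠ 1 := by revert b; decide +kernel

theorem fiveCycle_add_six (b : Fin 12) : fiveCycle (b + 6) = (fiveCycle b)⁻¹ := by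
  revert b; decide +kernel

theorem exists_fiveCycle_conj {p : Equiv.Perm (Fin 5)} (hp : p.sign = 1) (a : Fin 12) :
    ∃ b, fiveCycle b = MulAut.conj p (fiveCycle a) := by
  have key : ∀ p : Equiv.Perm (Fin 5), p.sign = 1 → ∀ a, ∃ b, fiveCycle b * p = p * fiveCycle a := by
    decide +kernel
  obtain ⟨b, hb⟩ := key p hp a
  exact ⟨b, by rw [MulAut.conj_apply, ← hb, mul_inv_cancel_right]⟩

theorem exists_castAdd_eq_or_add_six (b : Fin 12) :
    ∃ a : Fin 6, b = Fin.castAdd 6 a ∨ b = Fin.castAdd 6 a + 6 := by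
  revert b; decide

theorem natAdd_eq_castAdd_add_six (a : Fin 6) : Fin.natAdd 6 a = Fin.castAdd 6 a + 6 := by
  revert a; decide

/-- Conjugation by even permutations, as an action on the indices of `fiveCycle`. -/
theorem exists_hom_fiveCycle {Γ : Type*} [Group Γ] (π : Γ →* Equiv.Perm (Fin 5))
    (hπ : ∀ g, (π g).sign = 1) :
    ∃ β : Γ →* Equiv.Perm (Fin 12), ∀ g a, fiveCycle (β g a) = π g * fiveCycle a * (π g)⁻¹ := by
  choose f hf using fun g => exists_fiveCycle_conj (hπ g)
  simp only [MulAut.conj_apply] at hf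
  let φ : Γ →* Function.End (Fin 12) :=
    { toFun := f
      map_one' := funext fun a => fiveCycle_injective (by rw [hf]; simp; rfl)
      map_mul' := fun g h => funext fun a => fiveCycle_injective (by
        change _ = fiveCycle (f g (f h a))
        rw [hf, hf, hf, map_mul]
        group) }
  exact ⟨φ.toHomPerm, fun g a => hf g a⟩

end FiveCycles

section Generators

variable {E : Type*} [Field E]

/-- The product of the sections attached to a five-cycle and to its inverse. -/
def pairElement (x : Fin 5 → E) (Y : Fin 12 → Fin 5 → E) (b : Fin 12) (i : Fin 5) : E :=
  Y b i * Y (b + 6) i * x i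

/-- The generators indexed by ordered pairs. -/
def arrowElement (x : Fin 5 → E) (R : Sym2 (Fin 5) → E) (Y : Fin 12 → Fin 5 → E)
    (i j : Fin 5) : E :=
  x i * R s(i, j) * ∏ b with fiveCycle b (fiveCycle b i) = j, Y b i

/-- The generators indexed by five-cycles up to inversion. -/
def pentagonElement (x : Fin 5 → E) (R : Sym2 (Fin 5) → E) (Y : Fin 12 → Fin 5 → E)
    (b : Fin 12) : E :=
  (∏ i, R s(i, fiveCycle b (fiveCycle b i))) * pairElement x Y b 0 *
    ∏ a : Fin 6, pairElement x Y (Fin.castAdd 6 a) 0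

variable {x : Fin 5 → E} {R : Sym2 (Fin 5) → E} {Y : Fin 12 → Fin 5 → E}

theorem pairElement_add_six (b : Fin 12) (i : Fin 5) :
    pairElement x Y (b + 6) i = pairElement x Y b i := by
  have : b + 6 + 6 = b := by revert b; decide
  rw [pairElement, pairElement, this, mul_comm (Y (b + 6) i)]

theorem pairElement_eq (hY : ∀ b i, Y b (fiveCycle b i) = x i * Y b i) (b : Fin 12)
    (i j : Fin 5) : pairElement x Y b i = pairElement x Y b j := by
  have step : ∀ i, pairElement x Y b (fiveCycle b i) = pairElement x Y b i := fun i => by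
    have h := hY (b + 6) (fiveCycle b i)
    rw [fiveCycle_add_six, ← Equiv.Perm.mul_apply, inv_mul_cancel, Equiv.Perm.one_apply] at h
    rw [pairElement, pairElement, hY, h]
    ring
  have all : ∀ n : ℕ, pairElement x Y b ((fiveCycle b ^ n) i) = pairElement x Y b i := by
    intro n
    induction n with
    | zero => simp
    | succ n ih => rw [pow_succ', Equiv.Perm.mul_apply, step, ih]
  obtain ⟨l, rfl⟩ := exists_pow_five_cycle (fiveCycle_pow b) (fiveCycle_ne_one b) i j
  exact (all l).symm

theorem prod_pairElement (i : Fin 5) :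
    ∏ a : Fin 6, pairElement x Y (Fin.castAdd 6 a) i = x i ^ 6 * ∏ b, Y b i := by
  have h : ∏ b, Y b i =
      (∏ a : Fin 6, Y (Fin.castAdd 6 a) i) * ∏ a : Fin 6, Y (Fin.natAdd 6 a) i :=
    Fin.prod_univ_add (a := 6) (b := 6) fun b : Fin (6 + 6) => Y b i
  simp only [pairElement, Finset.prod_mul_distrib, h, natAdd_eq_castAdd_add_six, Finset.prod_const,
    Finset.card_univ, Fintype.card_fin]
  ring

theorem prod_pairElement_eq (hY : ∀ b i, Y b (fiveCycle b i) = x i * Y b i) (i j : Fin 5) :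
    x i ^ 6 * ∏ b, Y b i = x j ^ 6 * ∏ b, Y b j := by
  rw [← prod_pairElement, ← prod_pairElement]
  exact Finset.prod_congr rfl fun a _ => pairElement_eq hY _ i j

theorem pentagonElement_add_six (b : Fin 12) :
    pentagonElement x R Y (b + 6) = pentagonElement x R Y b := by
  rw [pentagonElement, pentagonElement, pairElement_add_six, fiveCycle_add_six]
  congr 2
  refine Fintype.prod_equiv ((fiveCycle b)⁻¹ * (fiveCycle b)⁻¹) _ _ fun i => ?_
  rw [Sym2.eq_swap]
  simp

section Equivariance

variable {f : E →+* E} {p : Equiv.Perm (Fin 5)} {q : Equiv.Perm (Fin 12)}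

theorem map_arrowElement (hx : ∀ i, f (x i) = x (p i)) (hR : ∀ i j, f (R s(i, j)) = R s(p i, p j))
    (hY : ∀ b i, f (Y b i) = Y (q b) (p i))
    (hq : ∀ b, fiveCycle (q b) = p * fiveCycle b * p⁻¹) (i j : Fin 5) :
    f (arrowElement x R Y i j) = arrowElement x R Y (p i) (p j) := by
  rw [arrowElement, arrowElement, map_mul, map_mul, hx, hR, map_prod]
  congr 1
  refine Finset.prod_equiv q (fun b => ?_) fun b _ => hY b i
  simp [hq]

theorem map_pentagonElement (hxY : ∀ b i, Y b (fiveCycle b i) = x i * Y b i)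
    (hx : ∀ i, f (x i) = x (p i)) (hR : ∀ i j, f (R s(i, j)) = R s(p i, p j))
    (hY : ∀ b i, f (Y b i) = Y (q b) (p i))
    (hq : ∀ b, fiveCycle (q b) = p * fiveCycle b * p⁻¹) (b : Fin 12) :
    f (pentagonElement x R Y b) = pentagonElement x R Y (q b) := by
  have h6 : ∀ b, q (b + 6) = q b + 6 := fun b => fiveCycle_injective (by
    rw [hq, fiveCycle_add_six, fiveCycle_add_six, hq]; group)
  have h1 : f (∏ i, R s(i, fiveCycle b (fiveCycle b i))) =
      ∏ i, R s(i, fiveCycle (q b) (fiveCycle (q b) i)) := by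
    rw [map_prod]
    refine Fintype.prod_equiv p _ _ fun i => ?_
    simp [hq, hR]
  have h2 : f (pairElement x Y b 0) = pairElement x Y (q b) 0 := by
    rw [pairElement_eq hxY (q b) 0 (p 0)]
    simp only [map_mul, hx, hY, pairElement, h6]
  have h3 : f (x 0 ^ 6 * ∏ b, Y b 0) = x 0 ^ 6 * ∏ b, Y b 0 := by
    rw [map_mul, map_pow, hx,
      map_prod, prod_pairElement_eq hxY 0 (p 0)]
    congr 1
    exact Fintype.prod_equiv q _ _ fun b => hY b 0
  rw [pentagonElement, pentagonElement, prod_pairElement, map_mul, map_mul, h1, h2, h3]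

end Equivariance

theorem prod_fiveCycle_pow_inv (hx : ∏ i, x i = 1) (n : Fin 2) (j : Fin 5) :
    (∏ b, x ((fiveCycle b ^ (n.val + 1))⁻¹ j)) * x j ^ 3 = 1 := by
  have h : ∀ (n : Fin 2) (j i : Fin 5),
      Finset.card {b : Fin 12 | (fiveCycle b ^ (n.val + 1))⁻¹ j = i} + (if i = j then 3 else 0) = 3 := by
    decide +kernel
  have h3 : x j ^ 3 = ∏ i, x i ^ (if i = j then 3 else 0) := by
    simp [pow_ite]
  rw [h3, Finset.prod_comp x fun b => (fiveCycle b ^ (n.val + 1))⁻¹ j, Finset.prod_subset (Finset.subset_univ _),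
    ← Finset.prod_mul_distrib]
  · simp only [← pow_add, h, Finset.prod_pow, hx, one_pow]
  · intro i _ hi
    rw [Finset.card_eq_zero.2, pow_zero]
    simpa [Finset.filter_eq_empty_iff] using hi

theorem prod_arrowElement_right (i : Fin 5) :
    ∏ j, arrowElement x R Y i j = x i ^ 5 * (∏ j, R s(i, j)) * ∏ b, Y b i := by
  simp only [arrowElement, Finset.prod_mul_distrib, Finset.prod_const, Finset.card_univ,
    Fintype.card_fin]
  congr 1
  exact Finset.prod_fiberwise _ _ _

theorem prod_arrowElement_left (hx : ∏ i, x i = 1)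
    (hY : ∀ b i, Y b (fiveCycle b i) = x i * Y b i) (i : Fin 5) :
    ∏ j, arrowElement x R Y j i = x i ^ 6 * (∏ j, R s(i, j)) * ∏ b, Y b i := by
  have h1 : ∀ b i, Y b i =
      x ((fiveCycle b ^ (0 + 1))⁻¹ i) * x ((fiveCycle b ^ (1 + 1))⁻¹ i) * Y b ((fiveCycle b ^ (1 + 1))⁻¹ i) := by
    intro b i
    obtain ⟨m, rfl⟩ := (fiveCycle b ^ (1 + 1)).surjective i
    have e1 : (fiveCycle b ^ (0 + 1))⁻¹ ((fiveCycle b ^ (1 + 1)) m) = fiveCycle b m := by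
      rw [← Equiv.Perm.mul_apply]; congr 1; group
    have e2 : (fiveCycle b ^ (1 + 1))⁻¹ ((fiveCycle b ^ (1 + 1)) m) = m := by
      rw [← Equiv.Perm.mul_apply, inv_mul_cancel]; rfl
    rw [e1, e2, mul_assoc, ← hY, ← hY]
    rfl
  have h2 : ∏ j, ∏ b with fiveCycle b (fiveCycle b j) = i, Y b j =
      ∏ b, Y b ((fiveCycle b ^ (1 + 1))⁻¹ i) := by
    simp only [Finset.prod_filter]
    rw [Finset.prod_comm]
    refine Finset.prod_congr rfl fun b _ => ?_
    rw [Finset.prod_eq_single ((fiveCycle b ^ (1 + 1))⁻¹ i)]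
    · exact if_pos ((fiveCycle b ^ 2).apply_symm_apply i)
    · intro j _ hj
      exact if_neg fun h => hj (by rw [← h]; exact ((fiveCycle b ^ 2).symm_apply_apply j).symm)
    · simp
  simp only [arrowElement, Finset.prod_mul_distrib, hx, one_mul, h2, Sym2.eq_swap (b := i)]
  rw [Finset.prod_congr rfl fun b _ => h1 b i, Finset.prod_mul_distrib, Finset.prod_mul_distrib]
  have a1 := prod_fiveCycle_pow_inv hx 0 i
  have a2 := prod_fiveCycle_pow_inv hx 1 i
  simp only [Fin.val_zero, Fin.val_one] at a1 a2
  linear_combination (-(∏ j, R s(i, j)) * ∏ b, Y b ((fiveCycle b ^ (1 + 1))⁻¹ i)) *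
    (a1 * (∏ b, x ((fiveCycle b ^ (1 + 1))⁻¹ i)) * x i ^ 3 + a2)

section Recovery

variable {L : Type*} [Field L] [Algebra L E] {M : IntermediateField L E}

theorem mem_of_arrowElement_mem (hx : ∏ i, x i = 1)
    (hY : ∀ b i, Y b (fiveCycle b i) = x i * Y b i) (hR0 : ∀ s, R s ≠ 0) (hY0 : ∀ b i, Y b i ≠ 0)
    (ht : ∀ i j, arrowElement x R Y i j ∈ M) (i : Fin 5) : x i ∈ M := by
  have hx0 : x i ≠ 0 := fun h => by
    rw [Finset.prod_eq_zero (Finset.mem_univ i) h] at hx; exact zero_ne_one hx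
  have h : x i = (∏ j, arrowElement x R Y j i) / ∏ j, arrowElement x R Y i j := by
    rw [prod_arrowElement_left hx hY, prod_arrowElement_right, eq_div_iff]
    · ring
    · exact mul_ne_zero (mul_ne_zero (pow_ne_zero _ hx0) (Finset.prod_ne_zero_iff.2 fun _ _ => hR0 _))
        (Finset.prod_ne_zero_iff.2 fun _ _ => hY0 _ _)
  rw [h]
  exact div_mem (prod_mem fun j _ => ht j i) (prod_mem fun j _ => ht i j)

theorem monomial_identity (P : Fin 12 → E) (b : Fin 12) :
    let c := fiveCycle b
    let B : Fin 5 → Fin 5 → E := fun i j => ∏ b with fiveCycle b (fiveCycle b i) = j, P b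
    P b * (P b * P (b + 6) * ∏ b, P b) * B 0 (c 0) =
      B ((c ^ 2) 0) 0 * B (c 0) ((c ^ 3) 0) * B (c 0) ((c ^ 4) 0) * B ((c ^ 2) 0) ((c ^ 4) 0) *
        B ((c ^ 3) 0) 0 * B (c 0) 0 := by
  have hB : ∀ i j, (∏ b with fiveCycle b (fiveCycle b i) = j, P b) =
      ∏ b, P b ^ (if fiveCycle b (fiveCycle b i) = j then 1 else 0) := fun i j => by
    rw [Finset.prod_filter]; exact Finset.prod_congr rfl fun b _ => by split_ifs <;> simp
  have hP : ∀ b, P b = ∏ b', P b' ^ (if b' = b then 1 else 0) := fun b => by simp [pow_ite]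
  have h1 : ∏ b, P b = ∏ b, P b ^ 1 := by simp
  intro c B
  simp only [B, hB]
  rw [h1]
  conv_lhs => rw [hP b, hP (b + 6)]
  simp only [← Finset.prod_mul_distrib, ← pow_add]
  refine Finset.prod_congr rfl fun b' _ => congrArg _ ?_
  revert b b'
  decide +kernel

theorem mem_of_generators_mem {y : Fin 12 → Fin 5 → E} {P : Fin 12 → E}
    (hY : ∀ b i, Y b i = y b i * P b) (hx0 : ∀ i, x i ≠ 0) (hy0 : ∀ b i, y b i ≠ 0)
    (hP0 : ∀ b, P b ≠ 0) (hR0 : ∀ s, R s ≠ 0) (hx : ∀ i, x i ∈ M) (hy : ∀ b i, y b i ∈ M)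
    (ht : ∀ i j, arrowElement x R Y i j ∈ M) (hu : ∀ b, pentagonElement x R Y b ∈ M) :
    (∀ b, P b ∈ M) ∧ ∀ s, R s ∈ M := by
  let B : Fin 5 → Fin 5 → E := fun i j => ∏ b with fiveCycle b (fiveCycle b i) = j, P b
  have hB0 : ∀ i j, B i j ≠ 0 := fun i j => Finset.prod_ne_zero_iff.2 fun b _ => hP0 b
  have hT : ∀ i j, R s(i, j) * B i j ∈ M := by
    intro i j
    have h : R s(i, j) * B i j = arrowElement x R Y i j /
        (x i * ∏ b with fiveCycle b (fiveCycle b i) = j, y b i) := by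
      rw [eq_div_iff (mul_ne_zero (hx0 i) (Finset.prod_ne_zero_iff.2 fun b _ => hy0 b i)),
        arrowElement]
      simp only [hY, Finset.prod_mul_distrib, B]
      ring
    rw [h]
    exact div_mem (ht i j) (mul_mem (hx i) (prod_mem fun b _ => hy b i))
  have hU : ∀ b, (∏ i, R s(i, fiveCycle b (fiveCycle b i))) * (P b * P (b + 6) * ∏ b, P b) ∈ M := by
    intro b
    have h : (∏ i, R s(i, fiveCycle b (fiveCycle b i))) * (P b * P (b + 6) * ∏ b, P b) =
        pentagonElement x R Y b / (y b 0 * y (b + 6) 0 * x 0 * (x 0 ^ 6 * ∏ b, y b 0)) := by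
      rw [eq_div_iff, pentagonElement, prod_pairElement, pairElement]
      · simp only [hY, Finset.prod_mul_distrib]
        ring
      · exact mul_ne_zero (mul_ne_zero (mul_ne_zero (hy0 _ _) (hy0 _ _)) (hx0 0))
          (mul_ne_zero (pow_ne_zero _ (hx0 0)) (Finset.prod_ne_zero_iff.2 fun b _ => hy0 b 0))
    rw [h]
    exact div_mem (hu b) (mul_mem (mul_mem (mul_mem (hy _ _) (hy _ _)) (hx 0))
      (mul_mem (pow_mem (hx 0) _) (prod_mem fun b _ => hy b 0)))
  have hP : ∀ b, P b ∈ M := by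
    intro b
    have hm := monomial_identity P b
    have hp := prod_pow_five_cycle (fiveCycle_pow b) (fiveCycle_ne_one b)
      (fun i => R s(i, fiveCycle b (fiveCycle b i))) 0
    have h5 := fiveCycle_pow b
    have hU := hU b
    set c := fiveCycle b
    change P b * (P b * P (b + 6) * ∏ b, P b) * B 0 (c 0) = _ * _ * _ * _ * _ * B (c 0) 0 at hm
    have e2 : c (c 0) = (c ^ 2) 0 := rfl
    have e4 : c (c ((c ^ 2) 0)) = (c ^ 4) 0 := rfl
    have e5 : c (c ((c ^ 3) 0)) = 0 := by
      change (c ^ 5) 0 = 0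
      rw [h5]; rfl
    have e6 : c (c ((c ^ 4) 0)) = c 0 := by
      change c ((c ^ 5) 0) = c 0
      rw [h5]; rfl
    simp only [Finset.prod_range_succ, Finset.prod_range_zero, pow_zero, pow_one, one_mul,
      Equiv.Perm.one_apply, e2, e4, e5, e6] at hp
    rw [← hp] at hU
    have hPm : ∏ b, P b ≠ 0 := Finset.prod_ne_zero_iff.2 fun b _ => hP0 b
    have h : P b = (R s((c ^ 2) 0, 0) * B ((c ^ 2) 0) 0) * (R s(c 0, (c ^ 3) 0) * B (c 0) ((c ^ 3) 0)) *
        (R s(c 0, (c ^ 4) 0) * B (c 0) ((c ^ 4) 0)) * (R s((c ^ 2) 0, (c ^ 4) 0) * B ((c ^ 2) 0) ((c ^ 4) 0)) *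
        (R s((c ^ 3) 0, 0) * B ((c ^ 3) 0) 0) * (R s(c 0, 0) * B (c 0) 0) /
        ((R s(0, (c ^ 2) 0) * R s(c 0, (c ^ 3) 0) * R s((c ^ 2) 0, (c ^ 4) 0) * R s((c ^ 3) 0, 0) *
          R s((c ^ 4) 0, c 0) * (P b * P (b + 6) * ∏ b, P b)) * (R s(0, c 0) * B 0 (c 0))) := by
      rw [eq_div_iff]
      · rw [Sym2.eq_swap (a := 0) (b := (c ^ 2) 0), Sym2.eq_swap (a := 0) (b := c 0),
          Sym2.eq_swap (a := (c ^ 4) 0) (b := c 0)]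
        linear_combination (R s((c ^ 2) 0, 0) * R s(c 0, (c ^ 3) 0) * R s((c ^ 2) 0, (c ^ 4) 0) *
          R s((c ^ 3) 0, 0) * R s(c 0, (c ^ 4) 0) * R s(c 0, 0)) * hm
      · have := hP0 b
        have := hP0 (b + 6)
        simp [hR0, hB0, hP0, hPm]
    rw [h]
    exact div_mem (mul_mem (mul_mem (mul_mem (mul_mem (mul_mem (hT _ _) (hT _ _)) (hT _ _)) (hT _ _))
      (hT _ _)) (hT _ _)) (mul_mem hU (hT _ _))
  refine ⟨hP, fun s => ?_⟩
  induction s with | _ i j => ?_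
  rw [← mul_div_cancel_right₀ (R s(i, j)) (hB0 i j)]
  exact div_mem (hT i j) (prod_mem fun b _ => hP b)

end Recovery

end Generators

namespace NormOneAction

variable {k L K F Γ : Type*} [Field k] [Field L] [Field K] [Field F] [Algebra k L]
    [Algebra k K] [Algebra L F] [Algebra K F] [Algebra k F] [Group Γ]
    (T : NormOneAction k L K F Γ)

theorem isStablyRational_of_generators [Finite Γ] {E S S' : Type*} [Field E] [Finite S] [Finite S']
    [Algebra F E] [Algebra L E] [Algebra K E] [Algebra k E] [IsScalarTower k L E]
    [IsScalarTower k K E] [IsScalarTower K F E] [IsScalarTower L F E] {ρE : Γ →* (E →+* E)}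
    (hρE : ∀ g a, ρE g (algebraMap F E a) = algebraMap F E (T.ρ g a))
    {q : S → E} (hq : AlgebraicIndependent F q)
    (hqtop : IntermediateField.adjoin F (Set.range q) = ⊤) (hqperm : ∀ g s, ∃ s', ρE g (q s) = q s')
    {t : S' → E} (ht : AlgebraicIndependent L t)
    (httop : IntermediateField.adjoin L (Set.range t) = ⊤) (htperm : ∀ g s, ∃ s', ρE g (t s) = t s') :
    IsStablyRational k K := by
  have hρL : ∀ g a, ρE g (algebraMap L E a) = algebraMap L E (T.σ g a) := fun g a => by
    rw [IsScalarTower.algebraMap_apply L F E, hρE, T.ρ_algebraMap, ← IsScalarTower.algebraMap_apply]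
  have hρK : ∀ g a, ρE g (algebraMap K E a) = algebraMap K E a := fun g a => by
    rw [IsScalarTower.algebraMap_apply K F E, hρE, T.ρ_base]
  have hρk : ∀ g a, ρE g (algebraMap k E a) = algebraMap k E a := fun g a => by
    rw [IsScalarTower.algebraMap_apply k L E, hρL, T.σ_base]
  obtain ⟨y, hyfix, hy, -, -, hymem⟩ := exists_invariant_generators (K := K) T.ρ T.ρ_injective ρE
    hρE T.ρ_fixed hq hqtop hqperm
  obtain ⟨z, hzfix, hz, -, -, hzmem⟩ := exists_invariant_generators (K := k) T.σ T.σ_injective ρE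
    hρL T.σ_fixed ht httop htperm
  have hKF : Function.Injective (algebraMap K F) := (algebraMap K F).injective
  have hkL : Function.Injective (algebraMap k L) := (algebraMap k L).injective
  refine isStablyRational_of_adjoin_eq (hy.restrictScalars hKF) (hz.restrictScalars hkL) ?_
  have hfixK : ∀ e ∈ IntermediateField.adjoin K (Set.range y), ∀ g, ρE g e = e := by
    intro e he g
    induction he using IntermediateField.adjoin_induction with
    | mem x hx => obtain ⟨s, rfl⟩ := hx; exact hyfix g s
    | algebraMap a => exact hρK g a
    | add a b _ _ ha hb => rw [map_add, ha, hb]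
    | inv a _ ha => rw [map_inv₀, ha]
    | mul a b _ _ ha hb => rw [map_mul, ha, hb]
  have hfixk : ∀ e ∈ IntermediateField.adjoin k (Set.range z), ∀ g, ρE g e = e := by
    intro e he g
    induction he using IntermediateField.adjoin_induction with
    | mem x hx => obtain ⟨s, rfl⟩ := hx; exact hzfix g s
    | algebraMap a => exact hρk g a
    | add a b _ _ ha hb => rw [map_add, ha, hb]
    | inv a _ ha => rw [map_inv₀, ha]
    | mul a b _ _ ha hb => rw [map_mul, ha, hb]
  ext e
  exact ⟨fun h => hzmem e (hfixK e h), fun h => hymem e (hfixk e h)⟩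

theorem isStablyRational_of_fiveCycle [Finite Γ] {E : Type*} [Field E]
    [Algebra F E] [Algebra L E] [Algebra K E] [Algebra k E] [IsScalarTower k L E]
    [IsScalarTower k K E] [IsScalarTower K F E] [IsScalarTower L F E] {ρE : Γ →* (E →+* E)}
    (hρE : ∀ g a, ρE g (algebraMap F E a) = algebraMap F E (T.ρ g a)) {β : Γ →* Equiv.Perm (Fin 12)}
    (hβ : ∀ g a, fiveCycle (β g a) = T.π g * fiveCycle a * (T.π g)⁻¹)
    {P : Fin 12 → E} {R : Sym2 (Fin 5) → E} (hq : AlgebraicIndependent F (Sum.elim P R))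
    (hqtop : IntermediateField.adjoin F (Set.range (Sum.elim P R)) = ⊤)
    (hP : ∀ g b, ρE g (P b) = P (β g b)) (hR : ∀ g s, ρE g (R s) = R (Sym2.map (T.π g) s)) :
    IsStablyRational k K := by
  let x : Fin 5 → E := fun i => algebraMap F E (T.x i)
  let y : Fin 12 → Fin 5 → E := fun b i => algebraMap F E (cycleElement T.x (fiveCycle b) i)
  let Y : Fin 12 → Fin 5 → E := fun b i => y b i * P b
  have hxprod : ∏ i, x i = 1 := by simp only [x, ← map_prod, T.prod_x, map_one]
  have hx0 : ∀ i, x i ≠ 0 := fun i => (map_ne_zero _).2 (T.x_ne_zero i)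
  have hy0 : ∀ b i, y b i ≠ 0 := fun b i => (map_ne_zero _).2
    (cycleElement_ne_zero T.prod_x T.algInd (fiveCycle_pow b) (fiveCycle_ne_one b) i)
  have hP0 : ∀ b, P b ≠ 0 := fun b => hq.ne_zero (Sum.inl b)
  have hR0 : ∀ s, R s ≠ 0 := fun s => hq.ne_zero (Sum.inr s)
  have hY : ∀ b i, Y b (fiveCycle b i) = x i * Y b i := fun b i => by
    simp only [Y, y, x]
    rw [cycleElement_apply T.prod_x (fiveCycle_pow b) (fiveCycle_ne_one b), map_mul, mul_assoc]
  have hxact : ∀ g i, ρE g (x i) = x (T.π g i) := fun g i => by simp only [x, hρE, T.ρ_x]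
  have hYact : ∀ g b i, ρE g (Y b i) = Y (β g b) (T.π g i) := fun g b i => by
    simp only [Y, y, map_mul, hρE, hP, hβ, map_cycleElement (T.ρ_x g)]
  let u : (Fin 5 × Fin 5) ⊕ Fin 6 → E := Sum.elim (fun ij => arrowElement x R Y ij.1 ij.2)
    fun a => pentagonElement x R Y (Fin.castAdd 6 a)
  have hu : ∀ b, ∃ s, pentagonElement x R Y b = u s := by
    intro b
    obtain ⟨a, rfl | rfl⟩ := exists_castAdd_eq_or_add_six b
    exacts [⟨Sum.inr a, rfl⟩, ⟨Sum.inr a, pentagonElement_add_six _⟩]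
  have huperm : ∀ g s, ∃ s', ρE g (u s) = u s' := by
    rintro g (⟨i, j⟩ | a)
    · exact ⟨Sum.inl (T.π g i, T.π g j), map_arrowElement (hxact g) (fun i j => hR g s(i, j))
        (hYact g) (hβ g) i j⟩
    · obtain ⟨s, hs⟩ := hu (β g (Fin.castAdd 6 a))
      exact ⟨s, (map_pentagonElement hY (hxact g) (fun i j => hR g s(i, j))
        (hYact g) (hβ g) _).trans hs⟩
  have hutop : IntermediateField.adjoin L (Set.range u) = ⊤ := by
    set M := IntermediateField.adjoin L (Set.range u)
    have hmem : ∀ s, u s ∈ M := fun s => IntermediateField.subset_adjoin L _ ⟨s, rfl⟩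
    have ht : ∀ i j, arrowElement x R Y i j ∈ M := fun i j => hmem (Sum.inl (i, j))
    have hp : ∀ b, pentagonElement x R Y b ∈ M := fun b => by
      obtain ⟨s, hs⟩ := hu b
      rw [hs]
      exact hmem s
    have hx : ∀ i, x i ∈ M := mem_of_arrowElement_mem hxprod hY hR0
      (fun b i => mul_ne_zero (hy0 b i) (hP0 b)) ht
    have hF : ∀ a : F, algebraMap F E a ∈ M := by
      intro a
      have ha : a ∈ IntermediateField.adjoin L (Set.range fun i : Fin 4 => T.x i.castSucc) :=
        T.adjoin_x ▸ trivial
      induction ha using IntermediateField.adjoin_induction with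
      | mem a ha => obtain ⟨i, rfl⟩ := ha; exact hx i.castSucc
      | algebraMap a =>
        rw [← IsScalarTower.algebraMap_apply]
        exact M.algebraMap_mem a
      | add a b _ _ ha hb => rw [map_add]; exact add_mem ha hb
      | inv a _ ha => rw [map_inv₀]; exact inv_mem ha
      | mul a b _ _ ha hb => rw [map_mul]; exact mul_mem ha hb
    obtain ⟨hPM, hRM⟩ := mem_of_generators_mem (fun b i => rfl) hx0 hy0 hP0 hR0 hx
      (fun b i => hF _) ht hp
    rw [eq_top_iff]
    intro e _
    have he : e ∈ IntermediateField.adjoin F (Set.range (Sum.elim P R)) := hqtop ▸ trivial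
    induction he using IntermediateField.adjoin_induction with
    | mem a ha =>
      obtain ⟨b | s, rfl⟩ := ha
      exacts [hPM b, hRM s]
    | algebraMap a => exact hF a
    | add a b _ _ ha hb => exact add_mem (ha trivial) (hb trivial)
    | inv a _ ha => exact inv_mem (ha trivial)
    | mul a b _ _ ha hb => exact mul_mem (ha trivial) (hb trivial)
  have hcard : Nat.card ((Fin 5 × Fin 5) ⊕ Fin 6) ≤
      Nat.card ((Fin 12 ⊕ Sym2 (Fin 5)) ⊕ Fin 4) := by
    have : Fintype.card (Sym2 (Fin 5)) = 15 := by decide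
    simp [this]
  refine T.isStablyRational_of_generators hρE hq hqtop ?_
    (algebraicIndependent_of_adjoin_eq_top hcard (T.algInd.sumElim_comp hq) hutop) hutop huperm
  rintro g (b | s)
  exacts [⟨Sum.inl (β g b), hP g b⟩, ⟨Sum.inr (Sym2.map (T.π g) s), hR g s⟩]

theorem isStablyRational_of_sign_eq_one [Finite Γ] [IsScalarTower k L F] [IsScalarTower k K F]
    (hG : ∀ g, (T.π g).sign = 1) : IsStablyRational k K := by
  obtain ⟨β, hβ⟩ := exists_hom_fiveCycle T.π hG
  let γ : Γ →* Function.End (Sym2 (Fin 5)) :=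
    { toFun := fun g => Sym2.map (T.π g)
      map_one' := by
        rw [map_one]
        exact Sym2.map_id
      map_mul' := fun g h => by
        rw [map_mul]
        exact funext fun s => (Sym2.map_map (g := T.π g) (f := T.π h) s).symm }
  let δ : Γ →* Equiv.Perm (Fin 12 ⊕ Sym2 (Fin 5)) :=
    (Equiv.Perm.sumCongrHom _ _).comp (β.prod γ.toHomPerm)
  let q : Fin 12 ⊕ Sym2 (Fin 5) → FractionRing (MvPolynomial (Fin 12 ⊕ Sym2 (Fin 5)) F) :=
    fun s => algebraMap (MvPolynomial (Fin 12 ⊕ Sym2 (Fin 5)) F) _ (X s)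
  have hq : Sum.elim (fun b => q (Sum.inl b)) (fun s => q (Sum.inr s)) = q :=
    Sum.elim_comp_inl_inr q
  refine T.isStablyRational_of_fiveCycle (ρE := fracAct (polyAct T.ρ δ)) (P := fun b => q (Sum.inl b))
    (R := fun s => q (Sum.inr s)) (fun g a => ?_) hβ ?_ ?_ (fun g b => ?_) fun g s => ?_
  · have h : ∀ a, algebraMap F (FractionRing (MvPolynomial (Fin 12 ⊕ Sym2 (Fin 5)) F)) a =
        algebraMap (MvPolynomial (Fin 12 ⊕ Sym2 (Fin 5)) F) _ (C a) := fun a =>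
      IsScalarTower.algebraMap_apply F (MvPolynomial (Fin 12 ⊕ Sym2 (Fin 5)) F) _ a
    rw [h, h, fracAct_algebraMap, polyAct_C]
  · rw [hq]
    exact algebraicIndependent_fractionRing_X F _
  · rw [hq]
    exact adjoin_fractionRing_X F _
  · simp only [q, fracAct_algebraMap, polyAct_X]
    rfl
  · simp only [q, fracAct_algebraMap, polyAct_X]
    rfl

end NormOneAction

section RetractRational

variable {k K : Type*} [Field k] [Field K] [Algebra k K]

theorem exists_algHom_localizationAway {B P : Type*} [CommRing B] [Algebra k B] [Field P]
    [Algebra k P] (ψ : B →ₐ[k] P) {f : B} (hf : ψ f ≠ 0) :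
    ∃ g : Localization.Away f →ₐ[k] P, ∀ b, g (algebraMap B _ b) = ψ b := by
  have h : ∀ y : Submonoid.powers f, IsUnit (ψ y) := by
    rintro ⟨_, m, rfl⟩
    rw [map_pow]
    exact (pow_ne_zero m hf).isUnit
  exact ⟨IsLocalization.liftAlgHom h, fun b => IsLocalization.lift_eq _ b⟩

theorem exists_mul_pow_eq_of_localizationAway {B P : Type*} [CommRing B] [Algebra k B] [Field P]
    [Algebra k P] {ψ : B →ₐ[k] P} {f : B} {g : Localization.Away f →ₐ[k] P}
    (hg : ∀ b, g (algebraMap B _ b) = ψ b) (l : Localization.Away f) :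
    ∃ (m : ℕ) (b : B), l * algebraMap B _ f ^ m = algebraMap B _ b ∧ g l * ψ f ^ m = ψ b := by
  obtain ⟨m, b, h⟩ := IsLocalization.Away.surj f l
  refine ⟨m, b, h, ?_⟩
  rw [← hg, ← map_pow, ← map_mul, h, hg]

/-- A field is retract rational as soon as it has a rational section on a polynomial ring. -/
theorem isRetractRational_of_section {n : ℕ} (ψ : MvPolynomial (Fin n) k →ₐ[k] K)
    (φ : K →ₐ[k] FractionRing (MvPolynomial (Fin n) k))
    (h : ∀ a, ∃ p q, ψ q ≠ 0 ∧ φ a * algebraMap _ _ q = algebraMap _ _ p ∧ a * ψ q = ψ p) :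
    IsRetractRational k K := by
  have hinj : Function.Injective (algebraMap (MvPolynomial (Fin n) k)
      (FractionRing (MvPolynomial (Fin n) k))) := IsFractionRing.injective _ _
  have hsec : ∀ a p q, φ a * algebraMap _ _ q = algebraMap _ _ p → a * ψ q = ψ p := by
    intro a p q hpq
    obtain ⟨p', q', hq', h1, h2⟩ := h a
    have h3 : p * q' = p' * q := hinj (by rw [map_mul, map_mul, ← hpq, ← h1]; ring)
    refine mul_right_cancel₀ hq' ?_
    rw [← map_mul, h3, map_mul, ← h2]
    ring
  choose p q hq hpq using fun j : Fin n => h (ψ (X j))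
  let f₀ := ∏ j, q j
  have hf₀ : ψ f₀ ≠ 0 := by
    simp only [f₀, map_prod]
    exact Finset.prod_ne_zero_iff.2 fun j _ => hq j
  have hden : ∀ b, ∃ (m : ℕ) (r : MvPolynomial (Fin n) k),
      φ (ψ b) * algebraMap _ _ f₀ ^ m = algebraMap _ _ r := by
    intro b
    induction b using MvPolynomial.induction_on with
    | C a =>
      refine ⟨0, C a, ?_⟩
      rw [pow_zero, mul_one, ← MvPolynomial.algebraMap_eq, AlgHom.commutes, AlgHom.commutes,
        ← IsScalarTower.algebraMap_apply]
    | add b c hb hc =>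
      obtain ⟨m, r, hr⟩ := hb
      obtain ⟨m', r', hr'⟩ := hc
      refine ⟨m + m', r * f₀ ^ m' + r' * f₀ ^ m, ?_⟩
      simp only [map_add, map_mul, map_pow, ← hr, ← hr']
      ring
    | mul_X b j hb =>
      obtain ⟨m, r, hr⟩ := hb
      refine ⟨m + 1, r * (p j * ∏ i ∈ Finset.univ.erase j, q i), ?_⟩
      have h2 : f₀ = q j * ∏ i ∈ Finset.univ.erase j, q i :=
        (Finset.mul_prod_erase _ _ (Finset.mem_univ j)).symm
      have h3 := (hpq j).1
      simp only [map_mul, ← hr, ← h3]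
      rw [pow_succ]
      nth_rewrite 2 [h2]
      rw [map_mul]
      ring
  obtain ⟨m, r, hr⟩ := hden f₀
  have hψr : ψ r = ψ f₀ * ψ f₀ ^ m := by
    rw [← map_pow]
    exact (hsec (ψ f₀) r (f₀ ^ m) (by rw [map_pow, hr])).symm
  let f := f₀ * r
  have hψf : ψ f ≠ 0 := by
    simp only [f, map_mul, hψr]
    exact mul_ne_zero hf₀ (mul_ne_zero hf₀ (pow_ne_zero _ hf₀))
  have hf : f ≠ 0 := fun h0 => hψf (by rw [h0, map_zero])
  obtain ⟨ψf, hψf'⟩ := exists_algHom_localizationAway ψ hψf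
  obtain ⟨ι, hι⟩ := exists_algHom_localizationAway (f := f)
    (IsScalarTower.toAlgHom k (MvPolynomial (Fin n) k) (FractionRing (MvPolynomial (Fin n) k)))
    (fun h0 => hf (hinj (by rw [map_zero]; exact h0)))
  have hιinj : Function.Injective ι := by
    refine (injective_iff_map_eq_zero ι).2 fun l hl => ?_
    obtain ⟨i, b, h1, h2⟩ := exists_mul_pow_eq_of_localizationAway hι l
    rw [hl, zero_mul] at h2
    have hb : b = 0 := hinj (by rw [map_zero]; exact h2.symm)
    rw [hb, map_zero] at h1
    exact (((IsLocalization.Away.algebraMap_isUnit f).pow i).mul_left_eq_zero).1 h1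
  let α := algebraMap (MvPolynomial (Fin n) k) (FractionRing (MvPolynomial (Fin n) k))
  have hα0 : ∀ b, b ≠ 0 → α b ≠ 0 := fun b hb h0 => hb (hinj (h0.trans (map_zero _).symm))
  have hf₀0 : f₀ ≠ 0 := left_ne_zero_of_mul hf
  have hr0 : r ≠ 0 := right_ne_zero_of_mul hf
  have hmem : ∀ b, α b ∈ ι.range := fun b => ⟨_, hι b⟩
  have hfinv : (α f)⁻¹ ∈ ι.range := by
    refine ⟨IsLocalization.Away.invSelf f, eq_inv_of_mul_eq_one_left ?_⟩
    have h1 : ι (algebraMap _ _ f) = α f := hι f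
    rw [← h1]
    change ι _ * ι _ = 1
    rw [← map_mul, mul_comm, IsLocalization.Away.mul_invSelf, map_one]
  have hf₀inv : (α f₀)⁻¹ ∈ ι.range := by
    have : (α f₀)⁻¹ = α r * (α f)⁻¹ := by
      have := hα0 _ hr0
      have := hα0 _ hf₀0
      simp only [f, map_mul]
      field_simp
    rw [this]
    exact mul_mem (hmem r) hfinv
  have hrinv : (α r)⁻¹ ∈ ι.range := by
    have : (α r)⁻¹ = α f₀ * (α f)⁻¹ := by
      have := hα0 _ hr0
      have := hα0 _ hf₀0
      simp only [f, map_mul]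
      field_simp
    rw [this]
    exact mul_mem (hmem f₀) hfinv
  have hφψ : ∀ b, φ (ψ b) ∈ ι.range := by
    intro b
    obtain ⟨i, s, hs⟩ := hden b
    have : φ (ψ b) = α s * (α f₀)⁻¹ ^ i := by
      rw [inv_pow, ← div_eq_mul_inv, eq_div_iff (pow_ne_zero _ (hα0 _ hf₀0))]
      exact hs
    rw [this]
    exact mul_mem (hmem s) (pow_mem hf₀inv i)
  have hφf₀ : (φ (ψ f₀))⁻¹ ∈ ι.range := by
    have : (φ (ψ f₀))⁻¹ = α f₀ ^ m * (α r)⁻¹ := by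
      rw [← div_eq_mul_inv, eq_div_iff (hα0 _ hr0), inv_mul_eq_iff_eq_mul₀]
      · exact hr.symm
      · rwa [Ne, map_eq_zero]
    rw [this]
    exact mul_mem (pow_mem (hmem f₀) m) hrinv
  have hφf : (φ (ψ f))⁻¹ ∈ ι.range := by
    have : (φ (ψ f))⁻¹ = (φ (ψ f₀))⁻¹ ^ (m + 2) := by
      simp only [f, map_mul, hψr, map_pow, mul_inv, inv_pow]
      ring
    rw [this]
    exact pow_mem hφf₀ _
  have hφA : ∀ a ∈ ψf.range, φ a ∈ ι.range := by
    rintro _ ⟨l, rfl⟩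
    obtain ⟨i, b, -, h2⟩ := exists_mul_pow_eq_of_localizationAway hψf' l
    have : φ (ψf l) = φ (ψ b) * (φ (ψ f))⁻¹ ^ i := by
      rw [← h2, map_mul, map_pow, inv_pow, mul_inv_cancel_right₀]
      exact pow_ne_zero _ (by rwa [Ne, map_eq_zero])
    change φ (ψf l) ∈ ι.range
    rw [this]
    exact mul_mem (hφψ b) (pow_mem hφf i)
  refine ⟨ψf.range, ?_, n, f, hf, (AlgEquiv.ofInjective ι hιinj).symm.toAlgHom.comp
    ((φ.comp ψf.range.val).codRestrict ι.range fun a => hφA a a.2), ψf.rangeRestrict, ?_⟩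
  · refine IsFractionRing.of_field _ _ fun a => ?_
    obtain ⟨p, q, hq, -, h2⟩ := h a
    exact ⟨⟨ψ p, _, hψf' p⟩, ⟨ψ q, _, hψf' q⟩, (eq_div_iff hq).2 h2⟩
  · refine AlgHom.ext fun a => Subtype.ext ?_
    obtain ⟨l, hl⟩ := hφA a a.2
    have h1 : (AlgEquiv.ofInjective ι hιinj).symm
        (((φ.comp ψf.range.val).codRestrict ι.range fun a => hφA a a.2) a) = l := by
      rw [AlgEquiv.symm_apply_eq]
      exact Subtype.ext hl.symm
    change ψf ((AlgEquiv.ofInjective ι hιinj).symm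
        (((φ.comp ψf.range.val).codRestrict ι.range fun a => hφA a a.2) a)) = a
    rw [h1]
    obtain ⟨i, b, h2, h3⟩ := exists_mul_pow_eq_of_localizationAway hψf' l
    refine mul_right_cancel₀ (pow_ne_zero i hψf) (h3.trans ?_)
    rw [← map_pow]
    refine (hsec _ _ _ ?_).symm
    have h4 := congrArg ι h2
    rw [map_mul, map_pow, hι, hι] at h4
    rw [map_pow]
    exact (congrArg (· * α f ^ i) hl.symm).trans h4

end RetractRational

namespace NormOneAction

variable {k L K F Γ : Type*} [Field k] [Field L] [Field K] [Field F] [Algebra k L]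
    [Algebra k K] [Algebra L F] [Algebra K F] [Algebra k F] [Group Γ]
    (T : NormOneAction k L K F Γ)

theorem isRetractRational_of_equivariant_section [Finite Γ] [IsScalarTower k L F]
    [IsScalarTower k K F] {S : Type*} [Finite S] (δ : Γ →* Equiv.Perm S) {w : S → F}
    (hw : ∀ g s, T.ρ g (w s) = w (δ g s)) (φ : F →ₐ[L] FractionRing (MvPolynomial S L))
    (hφ : ∀ g a, φ (T.ρ g a) = fracAct (polyAct T.σ δ) g (φ a))
    (h : ∀ a, ∃ p q : MvPolynomial S L, aeval w q ≠ 0 ∧ φ a * algebraMap _ _ q = algebraMap _ _ p ∧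
      a * aeval w q = aeval w p) : IsRetractRational k K := by
  classical
  have := Fintype.ofFinite Γ
  let α := algebraMap (MvPolynomial S L) (FractionRing (MvPolynomial S L))
  have hα : Function.Injective α := IsFractionRing.injective _ _
  let ρE := fracAct (polyAct T.σ δ)
  have hαC : ∀ a, algebraMap L (FractionRing (MvPolynomial S L)) a = α (C a) := fun a =>
    IsScalarTower.algebraMap_apply L (MvPolynomial S L) _ a
  have hρE : ∀ g a, ρE g (algebraMap L _ a) = algebraMap L _ (T.σ g a) := fun g a => by
    rw [hαC, hαC, fracAct_algebraMap, polyAct_C]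
  have hwact : ∀ g b, T.ρ g (aeval w b) = aeval w (polyAct T.σ δ g b) := by
    intro g b
    induction b using MvPolynomial.induction_on with
    | C a => rw [polyAct_C, ← MvPolynomial.algebraMap_eq, AlgHom.commutes, AlgHom.commutes,
        T.ρ_algebraMap]
    | add b c hb hc => rw [map_add, map_add, map_add, map_add, hb, hc]
    | mul_X b s hb => rw [map_mul, map_mul, map_mul, map_mul, hb, polyAct_X, aeval_X, aeval_X, hw]
  obtain ⟨z', hzfix', hz', -, hzspan', hzmem'⟩ := exists_invariant_generators (K := k) T.σ
    T.σ_injective ρE hρE T.σ_fixed (algebraicIndependent_fractionRing_X L S)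
    (adjoin_fractionRing_X L S) fun g s => ⟨δ g s, by rw [fracAct_algebraMap, polyAct_X]⟩
  obtain ⟨n, ⟨e⟩⟩ := Finite.exists_equiv_fin S
  let z : Fin n → FractionRing (MvPolynomial S L) := z' ∘ e.symm
  have hzr : Set.range z = Set.range z' := e.symm.surjective.range_comp z'
  have hzfix : ∀ g s, ρE g (z s) = z s := fun g s => hzfix' g _
  have hz : AlgebraicIndependent L z := hz'.comp _ e.symm.injective
  rw [← hzr] at hzspan' hzmem'
  have hZ : ∀ s, ∃ b, α b = z s := by
    intro s
    have h1 : z s ∈ Submodule.span L (Set.range fun s => α (X s)) := by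
      rw [← hzspan']
      exact Submodule.subset_span ⟨s, rfl⟩
    have h2 : Submodule.span L (Set.range fun s => α (X s)) ≤
        (IsScalarTower.toAlgHom L (MvPolynomial S L) _).range.toSubmodule :=
      Submodule.span_le.2 (by rintro _ ⟨s, rfl⟩; exact ⟨X s, rfl⟩)
    exact h2 h1
  choose Z hZ using hZ
  have hZsurj : ∀ b, ∃ r : MvPolynomial (Fin n) L, α b = aeval z r := by
    intro b
    have hmem : α b ∈ Algebra.adjoin L (Set.range z) := by
      induction b using MvPolynomial.induction_on with
      | C a => rw [← hαC]; exact Subalgebra.algebraMap_mem _ a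
      | add b c hb hc => rw [map_add]; exact add_mem hb hc
      | mul_X b s hb =>
        rw [map_mul]
        refine mul_mem hb ?_
        have h1 : α (X s) ∈ Submodule.span L (Set.range z) := by
          rw [hzspan']
          exact Submodule.subset_span ⟨s, rfl⟩
        exact Algebra.span_le_adjoin L _ h1
    rw [Algebra.adjoin_range_eq_range_aeval] at hmem
    obtain ⟨r, hr⟩ := hmem
    exact ⟨r, hr.symm⟩
  have hinv : ∀ b, (∀ g, ρE g (α b) = α b) → ∃ r : MvPolynomial (Fin n) k, α b = aeval z r := by
    intro b hb
    obtain ⟨r, hr⟩ := hZsurj b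
    obtain ⟨r', rfl⟩ := exists_map_eq_of_aeval_fixed (K := k) T.σ ρE hρE T.σ_fixed hz hzfix
      (p := r) (fun g => by rw [← hr, hb])
    exact ⟨r', by rw [hr, aeval_map_algebraMap]⟩
  have hκ : ∀ s, ∃ a : K, algebraMap K F a = aeval w (Z s) := by
    refine fun s => T.ρ_fixed _ fun g => ?_
    rw [hwact]
    congr 1
    refine hα ?_
    rw [← fracAct_algebraMap, hZ]
    exact hzfix g s
  choose κ hκ using hκ
  have hzk : AlgebraicIndependent k z := hz.restrictScalars (algebraMap k L).injective
  let ψ : MvPolynomial (Fin n) k →ₐ[k] K := aeval κ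
  have hψ : ∀ r b, α b = aeval z r → algebraMap K F (ψ r) = aeval w b := by
    intro r b hb
    have h1 : b = aeval Z r := by
      refine hα (hb.trans ?_)
      rw [← IsScalarTower.toAlgHom_apply k (MvPolynomial S L), ← AlgHom.comp_apply, comp_aeval]
      congr 2
      exact funext fun s => (hZ s).symm
    rw [h1]
    change (IsScalarTower.toAlgHom k K F) (aeval κ r) = ((aeval w).restrictScalars k) (aeval Z r)
    rw [← AlgHom.comp_apply, ← AlgHom.comp_apply, comp_aeval, comp_aeval]
    congr 2
    exact funext hκ
  have hφmem : ∀ a : K, φ (algebraMap K F a) ∈ IntermediateField.adjoin k (Set.range z) :=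
    fun a => hzmem' _ fun g => by rw [← hφ, T.ρ_base]
  let φ' : K →ₐ[k] FractionRing (MvPolynomial (Fin n) k) :=
    hzk.aevalEquivField.symm.toAlgHom.comp
      (((φ.restrictScalars k).comp (IsScalarTower.toAlgHom k K F)).codRestrict
        (IntermediateField.adjoin k (Set.range z)).toSubalgebra hφmem)
  have hφ' : ∀ a, (hzk.aevalEquivField (φ' a) : FractionRing (MvPolynomial S L)) =
      φ (algebraMap K F a) := fun a =>
    congrArg Subtype.val (hzk.aevalEquivField.apply_symm_apply _)
  refine isRetractRational_of_section ψ φ' fun a => ?_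
  obtain ⟨p, q, hq, h1, h2⟩ := h (algebraMap K F a)
  let Q := ∏ g ∈ Finset.univ.erase 1, polyAct T.σ δ g q
  have hqQ : q * Q = ∏ g, polyAct T.σ δ g q := by
    rw [← Finset.mul_prod_erase Finset.univ _ (Finset.mem_univ 1), map_one]
    rfl
  have hqQ0 : aeval w (q * Q) ≠ 0 := by
    rw [hqQ, map_prod]
    refine Finset.prod_ne_zero_iff.2 fun g _ => ?_
    rw [← hwact]
    exact (map_ne_zero _).2 hq
  have hinv1 : ∀ g, ρE g (α (q * Q)) = α (q * Q) := fun g => by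
    rw [hqQ, fracAct_algebraMap, map_prod]
    congr 1
    exact Fintype.prod_equiv (Equiv.mulLeft g) _ _ fun g' => by
      rw [Equiv.coe_mulLeft, map_mul]; rfl
  have h3 : φ (algebraMap K F a) * α (q * Q) = α (p * Q) := by
    rw [map_mul, map_mul, ← h1, mul_assoc]
  have hinv2 : ∀ g, ρE g (α (p * Q)) = α (p * Q) := fun g => by
    rw [← h3, map_mul, hinv1, ← hφ, T.ρ_base]
  obtain ⟨r, hr⟩ := hinv _ hinv1
  obtain ⟨s, hs⟩ := hinv _ hinv2
  refine ⟨s, r, fun h0 => hqQ0 ?_, ?_, ?_⟩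
  · rw [← hψ _ _ hr, h0, map_zero]
  · apply hzk.aevalEquivField.injective
    apply Subtype.ext
    rw [map_mul]
    change (hzk.aevalEquivField (φ' a) : FractionRing (MvPolynomial S L)) *
      (hzk.aevalEquivField _ : FractionRing (MvPolynomial S L)) = _
    rw [hφ', hzk.aevalEquivField_algebraMap_apply_coe, hzk.aevalEquivField_algebraMap_apply_coe,
      ← hr, ← hs, h3]
  · apply (algebraMap K F).injective
    rw [map_mul, hψ _ _ hr, hψ _ _ hs, map_mul, map_mul, ← h2, mul_assoc]

end NormOneAction

section Specialization

variable {L F S : Type*} [Field L] [Field F] [Algebra L F]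

/-- The rational function `e` is defined at `w`, where it takes the value `a`. -/
def HasSpecialization (w : S → F) (e : FractionRing (MvPolynomial S L)) (a : F) : Prop :=
  ∃ p q : MvPolynomial S L, aeval w q ≠ 0 ∧ e * algebraMap _ _ q = algebraMap _ _ p ∧
    a * aeval w q = aeval w p

namespace HasSpecialization

variable {w : S → F} {e e' : FractionRing (MvPolynomial S L)} {a a' : F}

theorem unique (h : HasSpecialization w e a) (h' : HasSpecialization w e a') : a = a' := by
  obtain ⟨p, q, hq, h1, h2⟩ := h
  obtain ⟨p', q', hq', h1', h2'⟩ := h'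
  have h3 : p * q' = p' * q := IsFractionRing.injective _ (FractionRing (MvPolynomial S L)) (by
    rw [map_mul, map_mul, ← h1, ← h1']; ring)
  have h4 := congrArg (aeval w) h3
  rw [map_mul, map_mul, ← h2, ← h2'] at h4
  exact mul_right_cancel₀ (mul_ne_zero hq hq') (by linear_combination h4)

theorem of_polynomial (p : MvPolynomial S L) : HasSpecialization w (algebraMap (MvPolynomial S L) (FractionRing (MvPolynomial S L)) p)
      (MvPolynomial.aeval w p) :=
  ⟨p, 1, by simp, by simp, by simp⟩

theorem add (h : HasSpecialization w e a) (h' : HasSpecialization w e' a') :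
    HasSpecialization w (e + e') (a + a') := by
  obtain ⟨p, q, hq, h1, h2⟩ := h
  obtain ⟨p', q', hq', h1', h2'⟩ := h'
  refine ⟨p * q' + p' * q, q * q', by rw [map_mul]; exact mul_ne_zero hq hq', ?_, ?_⟩
  · simp only [map_add, map_mul, ← h1, ← h1']; ring
  · simp only [map_add, map_mul, ← h2, ← h2']; ring

theorem mul (h : HasSpecialization w e a) (h' : HasSpecialization w e' a') :
    HasSpecialization w (e * e') (a * a') := by
  obtain ⟨p, q, hq, h1, h2⟩ := h
  obtain ⟨p', q', hq', h1', h2'⟩ := h'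
  refine ⟨p * p', q * q', by rw [map_mul]; exact mul_ne_zero hq hq', ?_, ?_⟩
  · simp only [map_mul, ← h1, ← h1']; ring
  · simp only [map_mul, ← h2, ← h2']; ring

theorem inv (h : HasSpecialization w e a) (ha : a ≠ 0) : HasSpecialization w e⁻¹ a⁻¹ := by
  obtain ⟨p, q, hq, h1, h2⟩ := h
  have hp : aeval w p ≠ 0 := h2 ▸ mul_ne_zero ha hq
  have he : e ≠ 0 := fun h0 => hp (by
    rw [h0, zero_mul] at h1
    rw [IsFractionRing.injective _ (FractionRing (MvPolynomial S L))
      (h1.symm.trans (map_zero _).symm), map_zero])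
  exact ⟨q, p, hp, by rw [← h1, inv_mul_cancel_left₀ he], by rw [← h2, inv_mul_cancel_left₀ ha]⟩

theorem div (h : HasSpecialization w e a) (h' : HasSpecialization w e' a') (ha' : a' ≠ 0) :
    HasSpecialization w (e / e') (a / a') := by
  rw [div_eq_mul_inv, div_eq_mul_inv]
  exact h.mul (h'.inv ha')

theorem one : HasSpecialization w (1 : FractionRing (MvPolynomial S L)) 1 := by
  simpa using of_polynomial (w := w) (1 : MvPolynomial S L)

theorem pow (h : HasSpecialization w e a) (n : ℕ) : HasSpecialization w (e ^ n) (a ^ n) := by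
  induction n with
  | zero => simpa using one
  | succ n ih => rw [pow_succ, pow_succ]; exact ih.mul h

theorem zpow (h : HasSpecialization w e a) (ha : a ≠ 0) (n : ℤ) : HasSpecialization w (e ^ n) (a ^ n) := by
  cases n with
  | ofNat n => simpa using h.pow n
  | negSucc n =>
    rw [zpow_negSucc, zpow_negSucc]
    exact (h.pow _).inv (pow_ne_zero _ ha)

theorem prod {ι : Type*} (s : Finset ι) {e : ι → FractionRing (MvPolynomial S L)} {a : ι → F}
    (h : ∀ i, HasSpecialization w (e i) (a i)) : HasSpecialization w (∏ i ∈ s, e i) (∏ i ∈ s, a i) := by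
  classical
  induction s using Finset.induction_on with
  | empty => simpa using one
  | insert i s hi ih => rw [Finset.prod_insert hi, Finset.prod_insert hi]; exact (h i).mul ih

theorem aeval {τ : Type*} {e : τ → FractionRing (MvPolynomial S L)} {a : τ → F}
    (h : ∀ i, HasSpecialization w (e i) (a i)) (p : MvPolynomial τ L) :
    HasSpecialization w (MvPolynomial.aeval e p) (MvPolynomial.aeval a p) := by
  induction p using MvPolynomial.induction_on with
  | C b =>
    have := of_polynomial (w := w) (C b : MvPolynomial S L)
    rw [← MvPolynomial.algebraMap_eq, AlgHom.commutes, ← IsScalarTower.algebraMap_apply] at this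
    rwa [← MvPolynomial.algebraMap_eq, AlgHom.commutes, AlgHom.commutes]
  | add p q hp hq => rw [map_add, map_add]; exact hp.add hq
  | mul_X p i hp =>
    rw [map_mul, map_mul, aeval_X, aeval_X]
    exact hp.mul (h i)

end HasSpecialization

theorem ringHom_ext_of_adjoin_eq_top {τ E : Type*} [Field E] {x : τ → F}
    (hx : IntermediateField.adjoin L (Set.range x) = ⊤) {f g : F →+* E}
    (hL : ∀ a, f (algebraMap L F a) = g (algebraMap L F a)) (hfg : ∀ i, f (x i) = g (x i)) :
    f = g := by
  have hp : ∀ p : MvPolynomial τ L, f (aeval x p) = g (aeval x p) := fun p => by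
    induction p using MvPolynomial.induction_on with
    | C b => rw [← MvPolynomial.algebraMap_eq, AlgHom.commutes, hL]
    | add p q hp hq => rw [map_add, map_add, map_add, hp, hq]
    | mul_X p i hp => rw [map_mul, map_mul, map_mul, aeval_X, hp, hfg]
  refine RingHom.ext fun a => ?_
  obtain ⟨p, q, rfl⟩ := (IntermediateField.mem_adjoin_range_iff L x a).1 (hx ▸ trivial)
  rw [map_div₀, map_div₀, hp, hp]

/-- Elements of `L(S)` specializing to generators of a rational function field `F` over `L`
define an embedding of `F` into `L(S)`. -/
theorem exists_algHom_specializes {τ : Type*} {x : τ → F} (hx : AlgebraicIndependent L x)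
    (hxtop : IntermediateField.adjoin L (Set.range x) = ⊤) {w : S → F}
    {y : τ → FractionRing (MvPolynomial S L)} (h : ∀ i, HasSpecialization w (y i) (x i)) :
    ∃ φ : F →ₐ[L] FractionRing (MvPolynomial S L), (∀ i, φ (x i) = y i) ∧
      ∀ a, HasSpecialization w (φ a) a := by
  have hy : AlgebraicIndependent L y := by
    rw [algebraicIndependent_iff]
    intro p hp
    refine (algebraicIndependent_iff.1 hx) p ?_
    refine (HasSpecialization.aeval h p).unique ?_
    rw [hp]
    simpa using HasSpecialization.of_polynomial (w := w) (0 : MvPolynomial S L)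
  let φ : F →ₐ[L] FractionRing (MvPolynomial S L) :=
    (IntermediateField.adjoin L (Set.range y)).val.comp
      (((IntermediateField.topEquiv.symm.trans (IntermediateField.equivOfEq hxtop.symm)).trans
        hx.aevalEquivField.symm).trans hy.aevalEquivField).toAlgHom
  have hφ : ∀ i, φ (x i) = y i := by
    intro i
    have h1 : hx.aevalEquivField.symm ((IntermediateField.equivOfEq hxtop.symm)
        (IntermediateField.topEquiv.symm (x i))) = algebraMap (MvPolynomial τ L) _ (X i) := by
      rw [AlgEquiv.symm_apply_eq]
      refine Subtype.ext ?_
      rw [hx.aevalEquivField_algebraMap_apply_coe, aeval_X]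
      rfl
    change ((hy.aevalEquivField (hx.aevalEquivField.symm _) : IntermediateField.adjoin L _) :
      FractionRing (MvPolynomial S L)) = _
    erw [h1]
    rw [hy.aevalEquivField_algebraMap_apply_coe, aeval_X]
  refine ⟨φ, hφ, fun a => ?_⟩
  obtain ⟨p, q, rfl⟩ := (IntermediateField.mem_adjoin_range_iff L x a).1 (hxtop ▸ trivial)
  have hp : ∀ p : MvPolynomial τ L, HasSpecialization w (φ (aeval x p)) (aeval x p) := fun p => by
    rw [← AlgHom.comp_apply, comp_aeval, show (fun i => φ (x i)) = y from funext hφ]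
    exact HasSpecialization.aeval h p
  by_cases hq : aeval x q = 0
  · rw [hq, div_zero, map_zero]
    simpa using HasSpecialization.of_polynomial (w := w) (0 : MvPolynomial S L)
  · rw [map_div₀]
    exact (hp p).div (hp q) hq

end Specialization

section Fibers

variable {Γ : Type*} [Group Γ] [Fintype Γ] [DecidableEq Γ] {π : Γ →* Equiv.Perm (Fin 5)}

theorem card_fiber_eq (htrans : ∀ i j, ∃ g, π g i = j) (i : Fin 5) :
    (Finset.univ.filter fun g => π g 0 = i).card =
      (Finset.univ.filter fun g => π g 0 = 0).card := by
  obtain ⟨h, hh⟩ := htrans i 0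
  refine Finset.card_equiv (Equiv.mulLeft h) fun g => ?_
  simp only [Finset.mem_filter, Finset.mem_univ, true_and, Equiv.coe_mulLeft, map_mul,
    Equiv.Perm.mul_apply]
  rw [← hh, (π h).injective.eq_iff]

theorem coprime_card_fiber (hinj : Function.Injective π) (htrans : ∀ i j, ∃ g, π g i = j) :
    Nat.Coprime 5 (Finset.univ.filter fun g => π g 0 = 0).card := by
  rw [Nat.Prime.coprime_iff_not_dvd Nat.prime_five]
  intro hd
  have h1 : Fintype.card Γ = 5 * (Finset.univ.filter fun g => π g 0 = 0).card := by
    rw [← Finset.card_univ, Finset.card_eq_sum_card_fiberwise (f := fun g => π g 0)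
      (t := Finset.univ) (fun _ _ => Finset.mem_coe.2 (Finset.mem_univ _)),
      Finset.sum_congr rfl fun i _ => card_fiber_eq htrans i]
    simp
  have h2 : Fintype.card Γ ∣ 120 := by
    have := Subgroup.card_dvd_of_injective π hinj
    rw [Nat.card_eq_fintype_card, Nat.card_eq_fintype_card, Fintype.card_perm] at this
    simpa [Nat.factorial] using this
  have h3 : 25 ∣ 120 := by
    refine Dvd.dvd.trans ?_ h2
    rw [h1]
    exact mul_dvd_mul_left 5 hd
  revert h3
  decide

end Fibers

namespace NormOneAction

variable {k L K F Γ : Type*} [Field k] [Field L] [Field K] [Field F] [Algebra k L]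
    [Algebra k K] [Algebra L F] [Algebra K F] [Algebra k F] [Group Γ]
    (T : NormOneAction k L K F Γ)

theorem isRetractRational [Finite Γ] [IsScalarTower k L F] [IsScalarTower k K F] {γ : Γ}
    (h5 : T.π γ ^ 5 = 1) (h1 : T.π γ ≠ 1) : IsRetractRational k K := by
  classical
  have := Fintype.ofFinite Γ
  let δ : Γ →* Equiv.Perm (Fin 5 ⊕ Γ) :=
    (Equiv.Perm.sumCongrHom (Fin 5) Γ).comp (T.π.prod (MulAction.toPermHom Γ Γ))
  let y := cycleElement T.x (T.π γ) 0
  have hy0 : y ≠ 0 := cycleElement_ne_zero T.prod_x T.algInd h5 h1 0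
  have hy : T.ρ γ y = T.x 0 * y := by
    rw [map_cycleElement (T.ρ_x γ), mul_inv_cancel_right, cycleElement_apply T.prod_x h5 h1]
  let w : Fin 5 ⊕ Γ → F := Sum.elim T.x fun g => T.ρ g y
  have hw : ∀ g s, T.ρ g (w s) = w (δ g s) := by
    rintro g (i | h)
    · exact T.ρ_x g i
    · change T.ρ g (T.ρ h y) = T.ρ (g * h) y
      rw [map_mul]; rfl
  have hw0 : ∀ s, w s ≠ 0 := by
    rintro (i | h)
    · exact T.x_ne_zero i
    · exact (map_ne_zero _).2 hy0
  let V : Fin 5 ⊕ Γ → FractionRing (MvPolynomial (Fin 5 ⊕ Γ) L) := fun s =>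
    algebraMap (MvPolynomial (Fin 5 ⊕ Γ) L) _ (X s)
  have hV0 : ∀ s, V s ≠ 0 := fun s => by
    rw [Ne, map_eq_zero_iff _ (IsFractionRing.injective _ _)]
    exact X_ne_zero s
  have hVw : ∀ s, HasSpecialization w (V s) (w s) := fun s => by
    simpa using HasSpecialization.of_polynomial (w := w) (X s : MvPolynomial _ L)
  let ρE := fracAct (polyAct T.σ δ)
  have hρV : ∀ g s, ρE g (V s) = V (δ g s) := fun g s => by
    rw [fracAct_algebraMap, polyAct_X]
  let fib : Fin 5 → Finset Γ := fun i => Finset.univ.filter fun g => T.π g 0 = i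
  obtain ⟨u, v, huv⟩ := (Nat.isCoprime_iff_coprime.2
    (coprime_card_fiber T.π_injective T.transitive) : IsCoprime (_ : ℤ) _)
  let A : Fin 5 → FractionRing (MvPolynomial (Fin 5 ⊕ Γ) L) := fun i =>
    V (Sum.inl i) ^ 5 / ∏ j, V (Sum.inl j)
  let B : Fin 5 → FractionRing (MvPolynomial (Fin 5 ⊕ Γ) L) := fun i =>
    ∏ g ∈ fib i, V (Sum.inr (g * γ)) / V (Sum.inr g)
  let Z : Fin 5 → FractionRing (MvPolynomial (Fin 5 ⊕ Γ) L) := fun i => A i ^ u * B i ^ v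
  have hPV : ∏ j, V (Sum.inl j) ≠ 0 := Finset.prod_ne_zero_iff.2 fun j _ => hV0 _
  have hA : ∏ i, A i = 1 := by
    simp only [A, Finset.prod_div_distrib, Finset.prod_pow, Finset.prod_const, Finset.card_univ,
      Fintype.card_fin]
    exact div_self (pow_ne_zero _ hPV)
  have hB : ∏ i, B i = 1 := by
    simp only [B, fib]
    rw [Finset.prod_fiberwise, Finset.prod_div_distrib]
    rw [Fintype.prod_equiv (Equiv.mulRight γ) (fun g => V (Sum.inr (g * γ)))
      (fun g => V (Sum.inr g)) fun _ => rfl]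
    exact div_self (Finset.prod_ne_zero_iff.2 fun j _ => hV0 _)
  have hZ : ∏ i, Z i = 1 := by
    simp only [Z, Finset.prod_mul_distrib, Finset.prod_zpow, hA, hB, one_zpow, mul_one]
  have hZ0 : ∀ i, Z i ≠ 0 := fun i h0 => by
    rw [Finset.prod_eq_zero (Finset.mem_univ i) h0] at hZ
    exact zero_ne_one hZ
  have hAw : ∀ i, HasSpecialization w (A i) (T.x i ^ 5) := fun i => by
    have := ((hVw (Sum.inl i)).pow 5).div (HasSpecialization.prod Finset.univ fun j => hVw (Sum.inl j))
      (Finset.prod_ne_zero_iff.2 fun j _ => hw0 _)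
    have h2 : ∏ j, w (Sum.inl j) = 1 := T.prod_x
    rwa [h2, div_one] at this
  have hBw : ∀ i, HasSpecialization w (B i) (T.x i ^ (fib 0).card) := fun i => by
    have := HasSpecialization.prod (fib i) fun g => (hVw (Sum.inr (g * γ))).div (hVw (Sum.inr g)) (hw0 _)
    rw [← card_fiber_eq T.transitive i]
    convert this
    rw [← Finset.prod_const]
    refine Finset.prod_congr rfl fun g hg => ?_
    change _ = T.ρ (g * γ) y / T.ρ g y
    rw [eq_div_iff ((map_ne_zero _).2 hy0), map_mul]
    change _ = T.ρ g (T.ρ γ y)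
    rw [hy, map_mul, T.ρ_x, (Finset.mem_filter.1 hg).2]
  have hZw : ∀ i, HasSpecialization w (Z i) (T.x i) := fun i => by
    have hx := T.x_ne_zero i
    have := ((hAw i).zpow (pow_ne_zero _ hx) u).mul ((hBw i).zpow (pow_ne_zero _ hx) v)
    have h2 : (T.x i ^ 5) ^ u * (T.x i ^ (fib 0).card) ^ v = T.x i := by
      rw [← zpow_natCast, ← zpow_natCast, ← zpow_mul, ← zpow_mul, ← zpow_add₀ hx]
      rw [mul_comm _ u, mul_comm _ v]
      exact (congrArg (T.x i ^ ·) huv).trans (zpow_one _)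
    rwa [h2] at this
  have hρZ : ∀ g i, ρE g (Z i) = Z (T.π g i) := by
    intro g i
    have hρA : ρE g (A i) = A (T.π g i) := by
      simp only [A, map_div₀, map_pow, map_prod, hρV]
      congr 1
      exact Fintype.prod_equiv (T.π g) _ _ fun j => rfl
    have hρB : ρE g (B i) = B (T.π g i) := by
      simp only [B, map_div₀, map_prod, hρV]
      refine Finset.prod_equiv (Equiv.mulLeft g) (fun h => ?_) fun h _ => ?_
      · simp only [fib, Finset.mem_filter, Finset.mem_univ, true_and, Equiv.coe_mulLeft, map_mul,
          Equiv.Perm.mul_apply, (T.π g).injective.eq_iff]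
      · rw [Equiv.coe_mulLeft, mul_assoc]
        rfl
    simp only [Z, map_mul, map_zpow₀, hρA, hρB]
  obtain ⟨φ, hφ, hφw⟩ := exists_algHom_specializes T.algInd T.adjoin_x
    fun i : Fin 4 => hZw i.castSucc
  have hφ' : ∀ i, φ (T.x i) = Z i := by
    intro i
    obtain ⟨j, rfl⟩ | rfl := i.eq_castSucc_or_eq_last
    · exact hφ j
    · have h2 := congrArg φ T.prod_x
      rw [map_one, map_prod, ← hZ, Fin.prod_univ_castSucc (n := 4), Fin.prod_univ_castSucc (n := 4),
        Finset.prod_congr rfl fun i _ => hφ i] at h2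
      exact mul_left_cancel₀ (Finset.prod_ne_zero_iff.2 fun j _ => hZ0 _) h2
  refine T.isRetractRational_of_equivariant_section δ hw φ (fun g a => ?_) hφw
  refine RingHom.congr_fun (f := φ.toRingHom.comp (T.ρ g)) (g := (ρE g).comp φ.toRingHom)
    (ringHom_ext_of_adjoin_eq_top T.adjoin_x (fun a => ?_) fun i => ?_) a
  · change φ (T.ρ g _) = ρE g (φ _)
    have hC : ∀ a, algebraMap L (FractionRing (MvPolynomial (Fin 5 ⊕ Γ) L)) a =
        algebraMap (MvPolynomial (Fin 5 ⊕ Γ) L) _ (C a) := fun a =>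
      IsScalarTower.algebraMap_apply L (MvPolynomial (Fin 5 ⊕ Γ) L) _ a
    rw [T.ρ_algebraMap, AlgHom.commutes, AlgHom.commutes, hC, hC, fracAct_algebraMap, polyAct_C]
  · change φ (T.ρ g _) = ρE g (φ _)
    rw [T.ρ_x, hφ', hφ', hρZ]

end NormOneAction

section PermOrderFive

variable {S : Type*} {p : Equiv.Perm S}

theorem pow_apply_ne_of_pow_five (hp : p ^ 5 = 1) {s : S} (hs : p s ≠ s) {i : ℕ} (hi : ¬ 5 ∣ i) :
    (p ^ i) s ≠ s := by
  intro h
  apply hs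
  have hc : IsCoprime (5 : ℤ) i :=
    Nat.isCoprime_iff_coprime.2 ((Nat.Prime.coprime_iff_not_dvd Nat.prime_five).2 hi)
  obtain ⟨a, b, hab⟩ := hc
  have h1 : p ^ (1 : ℤ) = (p ^ i) ^ b := by
    rw [← hab, zpow_add, mul_comm a, mul_comm b, zpow_mul, zpow_mul, zpow_natCast,
      show p ^ (5 : ℤ) = p ^ 5 from zpow_natCast p 5, hp, one_zpow, one_mul]
  have h2 : ((p ^ i) ^ b) s = s := Equiv.Perm.zpow_apply_eq_self_of_apply_eq_self h b
  rwa [← h1, zpow_one] at h2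

/-- For a permutation of order dividing five, the sum over each nontrivial orbit of a suitable
weight is one. -/
theorem exists_weight (hp : p ^ 5 = 1) : ∃ e : S → ℤ, ∀ s,
    (p s = s → e s = 0) ∧ (p s ≠ s → ∑ i ∈ Finset.range 5, e ((p ^ i) s) = 1) := by
  classical
  let r := Equiv.Perm.SameCycle.setoid p
  let o : S → S := fun s => (Quotient.mk r s).out
  have ho : ∀ s, p.SameCycle (o s) s := fun s => Quotient.exact (s := r) (Quotient.out_eq _)
  have ho' : ∀ i : ℕ, ∀ s, o ((p ^ i) s) = o s := fun i s => by
    have : Quotient.mk r ((p ^ i) s) = Quotient.mk r s :=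
      Quotient.sound (s := r) (Equiv.Perm.SameCycle.symm ⟨i, by simp⟩)
    simp only [o, this]
  refine ⟨fun s => if p s ≠ s ∧ o s = s then 1 else 0, fun s => ⟨fun h => by simp [h], fun h => ?_⟩⟩
  have hmove : ∀ i : ℕ, p ((p ^ i) s) ≠ (p ^ i) s := fun i hi => h (by
    have h2 : (p ^ i) (p s) = (p ^ i) s := by
      rw [← Equiv.Perm.mul_apply, ← pow_succ, pow_succ', Equiv.Perm.mul_apply, hi]
    exact (p ^ i).injective h2)
  obtain ⟨n, hn⟩ := (ho s).symm
  have h5 : p ^ (5 : ℤ) = 1 := by rw [← hp]; exact zpow_natCast p 5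
  obtain ⟨l, hl5, hl⟩ : ∃ l : ℕ, l < 5 ∧ (p ^ l) s = o s := by
    refine ⟨(n % 5).toNat, by omega, ?_⟩
    rw [← zpow_natCast, Int.toNat_of_nonneg (Int.emod_nonneg _ (by norm_num)), ← hn]
    conv_rhs => rw [← Int.emod_add_mul_ediv n 5, zpow_add, zpow_mul, h5, one_zpow, mul_one]
  rw [Finset.sum_eq_single l]
  · exact if_pos ⟨hmove l, by rw [ho', hl]⟩
  · intro j hj hjl
    refine if_neg ?_
    rintro ⟨-, h2⟩
    rw [ho', ← hl] at h2
    have hj5 := Finset.mem_range.1 hj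
    rcases lt_or_gt_of_ne hjl with hlt | hlt
    · refine pow_apply_ne_of_pow_five hp h (i := l - j) (by omega) ((p ^ j).injective ?_)
      rw [← Equiv.Perm.mul_apply, ← pow_add, Nat.add_sub_of_le hlt.le, h2]
    · refine pow_apply_ne_of_pow_five hp h (i := j - l) (by omega) ((p ^ l).injective ?_)
      rw [← Equiv.Perm.mul_apply, ← pow_add, Nat.add_sub_of_le hlt.le, h2]
  · intro hl'
    exact absurd (Finset.mem_range.2 hl5) hl'

theorem exists_sub_eq_of_sum_eq_zero (hp : p ^ 5 = 1) {h : S → ℤ}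
    (hh : ∀ s, ∑ i ∈ Finset.range 5, h ((p ^ i) s) = 0) : ∃ g : S → ℤ, ∀ s, g (p s) - g s = h s := by
  obtain ⟨e, he⟩ := exists_weight hp
  refine ⟨fun s => -∑ i ∈ Finset.range 5, e ((p ^ i) s) * ∑ j ∈ Finset.range i, h ((p ^ j) s),
    fun s => ?_⟩
  have h5 : p (p (p (p (p s)))) = s := by
    have := DFunLike.congr_fun hp s
    simpa [pow_succ] using this
  have hs := hh s
  have hN : h s * (e s + e (p s) + e (p (p s)) + e (p (p (p s))) + e (p (p (p (p s))))) = h s := by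
    by_cases hf : p s = s
    · simp only [Finset.sum_range_succ, Finset.sum_range_zero, pow_succ, pow_zero, one_mul,
        Equiv.Perm.mul_apply, Equiv.Perm.one_apply, hf] at hs
      have : h s = 0 := by omega
      rw [this, zero_mul]
    · have := (he s).2 hf
      simp only [Finset.sum_range_succ, Finset.sum_range_zero, pow_succ, pow_zero, one_mul,
        Equiv.Perm.mul_apply, Equiv.Perm.one_apply, zero_add] at this
      rw [this, mul_one]
  simp only [Finset.sum_range_succ, Finset.sum_range_zero, pow_succ, pow_zero, one_mul,
    Equiv.Perm.mul_apply, Equiv.Perm.one_apply, zero_add, h5] at hs ⊢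
  linear_combination hN - e s * hs

theorem exists_sum_eq_of_invariant (hp : p ^ 5 = 1) {f : S → ℤ} (hf : ∀ s, f (p s) = f s)
    (hf5 : ∀ s, p s = s → 5 ∣ f s) :
    ∃ φ : S → ℤ, ∀ s, ∑ i ∈ Finset.range 5, φ ((p ^ i) s) = f s := by
  classical
  obtain ⟨e, he⟩ := exists_weight hp
  refine ⟨fun s => e s * f s + if p s = s then f s / 5 else 0, fun s => ?_⟩
  have hfi : ∀ i : ℕ, f ((p ^ i) s) = f s := fun i => by
    induction i with
    | zero => rfl
    | succ i ih => rw [pow_succ', Equiv.Perm.mul_apply, hf, ih]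
  by_cases hs : p s = s
  · have hpi : ∀ i : ℕ, (p ^ i) s = s := fun i =>
      Equiv.Perm.pow_apply_eq_self_of_apply_eq_self hs i
    simp only [hpi, (he s).1 hs, hs, if_true, Finset.sum_const, Finset.card_range]
    have := hf5 s hs
    rw [zero_mul, zero_add, nsmul_eq_mul]
    exact Int.mul_ediv_cancel' this
  · have hmove : ∀ i : ℕ, p ((p ^ i) s) ≠ (p ^ i) s := fun i hi => hs (by
      have h2 : (p ^ i) (p s) = (p ^ i) s := by
        rw [← Equiv.Perm.mul_apply, ← pow_succ, pow_succ', Equiv.Perm.mul_apply, hi]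
      exact (p ^ i).injective h2)
    simp only [hfi, hmove, if_false, add_zero]
    rw [← Finset.sum_mul, (he s).2 hs, one_mul]

end PermOrderFive

section Trace

variable {R V W : Type*} [CommRing R] [AddCommGroup V] [Module R V] [AddCommGroup W] [Module R W]

theorem LinearMap.trace_funLeft {S : Type*} [Finite S] (p : Equiv.Perm S) :
    LinearMap.trace R _ (LinearMap.funLeft R R p) = (Nat.card {s // p s = s} : R) := by
  classical
  have := Fintype.ofFinite S
  rw [LinearMap.trace_eq_matrix_trace R (Pi.basisFun R S), Matrix.trace,
    Nat.card_eq_fintype_card, Fintype.card_subtype, Finset.card_filter, Nat.cast_sum]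
  refine Finset.sum_congr rfl fun s _ => ?_
  simp [LinearMap.funLeft_apply, Pi.single_apply]

/-- The trace of an endomorphism of `W` that leaves the image of `V` invariant and acts through
a scalar on the one-dimensional quotient. -/
theorem LinearMap.trace_eq_add_of_extension [Nontrivial R] [Module.Free R V] [Module.Finite R V]
    {j : V →ₗ[R] W}
    {w : W} (hbij : Function.Bijective fun v : V × R => j v.1 + v.2 • w) {f : V →ₗ[R] V}
    {g : W →ₗ[R] W} (hj : ∀ v, g (j v) = j (f v)) {a : R} {b : V} (hw : g w = j b + a • w) :
    LinearMap.trace R W g = LinearMap.trace R V f + a := by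
  let E : (V × R) ≃ₗ[R] W := LinearEquiv.ofBijective
    (j.coprod (LinearMap.toSpanSingleton R W w)) hbij
  let M : V × R →ₗ[R] V × R := f.prodMap (a • LinearMap.id) +
    (LinearMap.inl R V R ∘ₗ LinearMap.toSpanSingleton R V b) ∘ₗ LinearMap.snd R V R
  have hM : E.conj M = g := by
    refine LinearMap.ext fun x => ?_
    obtain ⟨⟨v, r⟩, rfl⟩ := E.surjective x
    rw [LinearEquiv.conj_apply_apply, LinearEquiv.symm_apply_apply]
    have hE : ∀ v : V × R, E v = j v.1 + v.2 • w := fun _ => rfl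
    simp only [hE, map_add, map_smul, hj, hw]
    simp [M, smul_smul]
    module
  rw [← hM, LinearMap.trace_conj', map_add, LinearMap.trace_prodMap', LinearMap.trace_comp_comm']
  simp [← LinearMap.comp_assoc]

end Trace

/-- A surjective equivariant homomorphism from a `Γ`-module onto the permutation module of
integer-valued functions on a `Γ`-set `S`. -/
structure DivisorMap {Γ U : Type*} [Group Γ] [AddCommGroup U] (ρ : Γ →* AddMonoid.End U)
    (S : Type*) where
  α : Γ →* Equiv.Perm S
  f : U →+ (S → ℤ)
  equivariant : ∀ g u s, f (ρ g u) (α g s) = f u s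
  surjective : Function.Surjective f

namespace DivisorMap

variable {Γ U S : Type*} [Group Γ] [AddCommGroup U] {ρ : Γ →* AddMonoid.End U}
  (D : DivisorMap ρ S) {c : Γ}

theorem f_apply (g : Γ) (u : U) (s : S) : D.f (ρ g u) s = D.f u (D.α g⁻¹ s) := by
  rw [← D.equivariant g u, ← Equiv.Perm.mul_apply, ← map_mul]
  simp

theorem f_eq_zero_iff (g : Γ) (u : U) : D.f (ρ g u) = 0 ↔ D.f u = 0 := by
  constructor
  · intro h
    funext s
    rw [← D.equivariant g u s, h]
    rfl
  · intro h
    funext s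
    rw [f_apply, h]
    rfl

theorem f_pow_apply (u : U) (i : ℕ) (s : S) :
    D.f (ρ (c ^ i) u) s = D.f u ((D.α c⁻¹ ^ i) s) := by
  rw [f_apply, ← inv_pow, map_pow]

theorem f_pow_sub_eq_zero {u : U} (h : D.f (ρ c u - u) = 0) (n : ℕ) :
    D.f (ρ (c ^ n) u - u) = 0 := by
  induction n with
  | zero => simp
  | succ n ih =>
    have h1 : ρ (c ^ (n + 1)) u - u = ρ c (ρ (c ^ n) u - u) + (ρ c u - u) := by
      rw [pow_succ', map_mul, AddMonoid.End.coe_mul, Function.comp_apply, map_sub]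
      abel
    rw [h1, map_add, h, (D.f_eq_zero_iff c _).2 ih, add_zero]

theorem norm_sub (h5 : c ^ 5 = 1) (w : U) :
    ρ c (∑ i ∈ Finset.range 5, ρ (c ^ i) w) = ∑ i ∈ Finset.range 5, ρ (c ^ i) w := by
  rw [map_sum]
  have h : ∀ i, ρ c (ρ (c ^ i) w) = ρ (c ^ (i + 1)) w := fun i => by
    rw [pow_succ', map_mul, AddMonoid.End.coe_mul, Function.comp_apply]
  simp only [h]
  rw [Finset.sum_range_succ, h5, Finset.sum_range_succ' _ 4, pow_zero]

/-- The values modulo five of the divisor at the points fixed by `c`. -/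
def residue (c : Γ) : U →+ ({s // D.α c s = s} → ZMod 5) where
  toFun u s := (D.f u s : ZMod 5)
  map_zero' := by ext; simp
  map_add' u v := by ext; simp

theorem residue_eq_of_f_eq {u v : U} (h : D.f u = D.f v) : D.residue c u = D.residue c v := by
  funext s
  simp [residue, h]

theorem exists_residue_eq (φ : {s // D.α c s = s} → ZMod 5) :
    ∃ u, D.f (ρ c u - u) = 0 ∧ D.residue c u = φ := by
  classical
  obtain ⟨u, hu⟩ := D.surjective fun s => if h : D.α c s = s then ((φ ⟨s, h⟩).val : ℤ) else 0
  refine ⟨u, ?_, ?_⟩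
  · funext s
    obtain ⟨s, rfl⟩ := (D.α c).surjective s
    rw [map_sub, Pi.sub_apply, D.equivariant, Pi.zero_apply, sub_eq_zero, hu]
    by_cases h : D.α c s = s
    · rw [h]
    · have h' : ¬ D.α c (D.α c s) = D.α c s := fun h' => h ((D.α c).injective h')
      simp only [h, h', dif_neg, not_false_eq_true]
  · funext s
    simp [residue, hu, s.2]

theorem residue_norm (w : U) : D.residue c (∑ i ∈ Finset.range 5, ρ (c ^ i) w) = 0 := by
  funext s
  have hs : D.α c⁻¹ s = s := by
    rw [map_inv, Equiv.Perm.inv_eq_iff_eq, s.2]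
  have h : ∀ i, D.f (ρ (c ^ i) w) s = D.f w s := fun i => by
    rw [f_pow_apply, Equiv.Perm.pow_apply_eq_self_of_apply_eq_self hs]
  simp only [residue, AddMonoidHom.coe_mk, ZeroHom.coe_mk, map_sum, Finset.sum_apply, h]
  simp only [Finset.sum_const, Finset.card_range, Pi.zero_apply, nsmul_eq_mul]
  push_cast
  rw [show (5 : ZMod 5) = 0 from rfl, zero_mul]

theorem exists_eq_norm_add (h5 : c ^ 5 = 1) {u : U} (hu : D.f (ρ c u - u) = 0)
    (hr : D.residue c u = 0) :
    ∃ w m, u = ∑ i ∈ Finset.range 5, ρ (c ^ i) w + m ∧ D.f m = 0 := by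
  have hp : D.α c⁻¹ ^ 5 = 1 := by rw [← map_pow, inv_pow, h5, inv_one, map_one]
  obtain ⟨φ, hφ⟩ := exists_sum_eq_of_invariant (f := D.f u) hp (fun s => by
      rw [← f_apply, ← sub_eq_zero, ← Pi.sub_apply, ← map_sub, hu]; rfl)
    (fun s hs => by
      have hs' : D.α c s = s := by rwa [map_inv, Equiv.Perm.inv_eq_iff_eq, eq_comm] at hs
      exact (ZMod.intCast_zmod_eq_zero_iff_dvd _ 5).1 (congrFun hr ⟨s, hs'⟩))
  obtain ⟨w, rfl⟩ := D.surjective φ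
  refine ⟨w, u - ∑ i ∈ Finset.range 5, ρ (c ^ i) w, by abel, ?_⟩
  funext s
  rw [map_sub, map_sum, Pi.sub_apply, Finset.sum_apply, Pi.zero_apply, sub_eq_zero, ← hφ]
  simp only [f_pow_apply]

variable {t : Γ} {m n : ℕ}

theorem fixed_iff (ht : c * t = t * c ^ m) (ht' : c * t⁻¹ = t⁻¹ * c ^ n) (s : S) :
    D.α c (D.α t⁻¹ s) = D.α t⁻¹ s ↔ D.α c s = s := by
  constructor
  · intro h
    have h1 : D.α c (D.α t (D.α t⁻¹ s)) = D.α t (D.α t⁻¹ s) := by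
      rw [← Equiv.Perm.mul_apply (D.α c), ← map_mul, ht, map_mul, Equiv.Perm.mul_apply, map_pow,
        Equiv.Perm.pow_apply_eq_self_of_apply_eq_self h]
    simpa using h1
  · intro h
    rw [← Equiv.Perm.mul_apply (D.α c), ← map_mul, ht', map_mul, Equiv.Perm.mul_apply, map_pow,
      Equiv.Perm.pow_apply_eq_self_of_apply_eq_self h]

/-- The endomorphism of the residues at the fixed points of `c` induced by an element `t`
normalizing the subgroup generated by `c`. -/
def residueMap (ht : c * t = t * c ^ m) (ht' : c * t⁻¹ = t⁻¹ * c ^ n) :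
    ({s // D.α c s = s} → ZMod 5) →ₗ[ZMod 5] ({s // D.α c s = s} → ZMod 5) :=
  LinearMap.funLeft (ZMod 5) (ZMod 5) ((D.α t⁻¹).subtypePerm (D.fixed_iff ht ht'))

theorem residueMap_residue (ht : c * t = t * c ^ m) (ht' : c * t⁻¹ = t⁻¹ * c ^ n) (u : U) :
    D.residueMap ht ht' (D.residue c u) = D.residue c (ρ t u) := by
  funext s
  simp [residueMap, residue, LinearMap.funLeft_apply, f_apply]

theorem trace_residueMap [Finite S] (ht : c * t = t * c ^ m) (ht' : c * t⁻¹ = t⁻¹ * c ^ n) :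
    LinearMap.trace _ _ (D.residueMap ht ht') =
      (Nat.card {s // D.α c s = s ∧ D.α t s = s} : ZMod 5) := by
  rw [residueMap, LinearMap.trace_funLeft]
  congr 1
  refine Nat.card_congr ((Equiv.subtypeEquivRight fun s => ?_).trans
    (Equiv.subtypeSubtypeEquivSubtypeInter (fun s => D.α c s = s) fun s => D.α t s = s))
  rw [Subtype.ext_iff, Equiv.Perm.subtypePerm_apply]
  change D.α t⁻¹ s = s ↔ _
  rw [map_inv, Equiv.Perm.inv_eq_iff_eq, eq_comm]

theorem f_sub_eq_zero_of_comm (ht : c * t = t * c ^ m) {u : U} (hu : D.f (ρ c u - u) = 0) :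
    D.f (ρ c (ρ t u) - ρ t u) = 0 := by
  have h : ρ c (ρ t u) = ρ t (ρ (c ^ m) u) := by
    have h1 : ρ (c * t) u = ρ (t * c ^ m) u := by rw [ht]
    rwa [map_mul, map_mul] at h1
  rw [h, ← map_sub, f_eq_zero_iff]
  exact D.f_pow_sub_eq_zero hu m

end DivisorMap

/-- Two divisor maps `A`, `B` on the same module, whose kernels are related as for the unit groups
of a norm one torus and of an affine space, together with a homomorphism `d` describing the
character group of the torus modulo five. -/
structure DivisorComparison {Γ U SA SB : Type*} [Group Γ] [AddCommGroup U]
    (ρ : Γ →* AddMonoid.End U) (A : DivisorMap ρ SA) (B : DivisorMap ρ SB) (c : Γ) where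
  pow_five : c ^ 5 = 1
  d : U →+ ZMod 5
  le : ∀ u, B.f u = 0 → A.f u = 0
  d_smul : ∀ g u, A.f u = 0 → d (ρ g u) = d u
  d_eq_zero : ∀ u, B.f u = 0 → d u = 0
  eq_zero_of_fixed : ∀ u, A.f u = 0 → B.f (ρ c u - u) = 0 → B.f u = 0
  exists_sub : ∀ u, A.f u = 0 → d u = 0 → ∃ w, A.f w = 0 ∧ B.f (u - (ρ c w - w)) = 0
  exists_norm : ∃ x, A.f x = 0 ∧ d x = 1 ∧ B.f (∑ i ∈ Finset.range 5, ρ (c ^ i) x) = 0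

namespace DivisorComparison

variable {Γ U SA SB : Type*} [Group Γ] [AddCommGroup U] {ρ : Γ →* AddMonoid.End U}
  {A : DivisorMap ρ SA} {B : DivisorMap ρ SB} {c : Γ}

theorem residue_eq_zero_iff (E : DivisorComparison ρ A B c) {u : U} (hu : B.f (ρ c u - u) = 0) :
    B.residue c u = 0 ↔ A.residue c u = 0 := by
  constructor
  · intro h
    obtain ⟨w, m, rfl, hm⟩ := B.exists_eq_norm_add E.pow_five hu h
    rw [map_add, A.residue_norm, A.residue_eq_of_f_eq (v := 0) (by rw [E.le m hm, map_zero]),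
      map_zero, add_zero]
  · intro h
    obtain ⟨w, m, rfl, hm⟩ := A.exists_eq_norm_add E.pow_five (E.le _ hu) h
    rw [map_add, DivisorMap.norm_sub E.pow_five, add_sub_add_left_eq_sub] at hu
    rw [map_add, B.residue_norm, B.residue_eq_of_f_eq (v := 0)
      (by rw [E.eq_zero_of_fixed m hm hu, map_zero]), map_zero, add_zero]

/-- The obstruction for an element with `c`-invariant divisor. -/
def θ (E : DivisorComparison ρ A B c) : U →+ ZMod 5 := E.d.comp (AddMonoidHom.mk' (fun u => ρ c u - u) fun u v => by rw [map_add, add_sub_add_comm])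

theorem θ_apply (E : DivisorComparison ρ A B c) (u : U) : E.θ u = E.d (ρ c u - u) := rfl

theorem θ_eq_zero_of_residue_eq_zero (E : DivisorComparison ρ A B c) {u : U} (hu : A.f (ρ c u - u) = 0)
    (hr : A.residue c u = 0) : E.θ u = 0 := by
  obtain ⟨w, m, rfl, hm⟩ := A.exists_eq_norm_add E.pow_five hu hr
  rw [θ_apply, map_add, DivisorMap.norm_sub E.pow_five, add_sub_add_left_eq_sub, map_sub,
    E.d_smul c m hm, sub_self]

theorem exists_residue_eq_of_θ_eq_zero (E : DivisorComparison ρ A B c) {u : U} (hu : A.f (ρ c u - u) = 0) (hθ : E.θ u = 0) :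
    ∃ v, B.f (ρ c v - v) = 0 ∧ A.residue c v = A.residue c u := by
  obtain ⟨w, hw, hw'⟩ := E.exists_sub _ hu hθ
  refine ⟨u - w, ?_, A.residue_eq_of_f_eq (by rw [map_sub, hw, sub_zero])⟩
  rwa [map_sub (ρ c), sub_sub_sub_comm]

theorem exists_θ_eq_one (E : DivisorComparison ρ A B c) : ∃ u, A.f (ρ c u - u) = 0 ∧ E.θ u = 1 := by
  obtain ⟨x, hx, hdx, hN⟩ := E.exists_norm
  have hp : B.α c⁻¹ ^ 5 = 1 := by rw [← map_pow, inv_pow, E.pow_five, inv_one, map_one]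
  obtain ⟨g, hg⟩ := exists_sub_eq_of_sum_eq_zero (h := B.f x) hp fun s => by
    rw [← Pi.zero_apply (M := fun _ => ℤ) s, ← hN, map_sum, Finset.sum_apply]
    simp only [B.f_pow_apply]
  obtain ⟨u, rfl⟩ := B.surjective g
  have h : B.f (ρ c u - u - x) = 0 := by
    funext s
    rw [map_sub, map_sub, Pi.sub_apply, Pi.sub_apply, B.f_apply, hg, sub_self]
    rfl
  refine ⟨u, ?_, ?_⟩
  · have := E.le _ h
    rwa [map_sub, hx, sub_zero] at this
  · have := E.d_eq_zero _ h
    rwa [map_sub, hdx, sub_eq_zero] at this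

theorem θ_smul (E : DivisorComparison ρ A B c) {t : Γ} {m : ℕ} (ht : c * t = t * c ^ m) {u : U} (hu : A.f (ρ c u - u) = 0) :
    E.θ (ρ t u) = m * E.θ u := by
  have h : ρ c (ρ t u) = ρ t (ρ (c ^ m) u) := by
    have h1 : ρ (c * t) u = ρ (t * c ^ m) u := by rw [ht]
    rwa [map_mul, map_mul] at h1
  have hn : ∀ n : ℕ, E.d (ρ (c ^ n) u - u) = n * E.θ u := fun n => by
    induction n with
    | zero => simp
    | succ n ih =>
      have h1 : ρ (c ^ (n + 1)) u - u = ρ c (ρ (c ^ n) u - u) + (ρ c u - u) := by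
        rw [pow_succ', map_mul, AddMonoid.End.coe_mul, Function.comp_apply, map_sub]
        abel
      rw [h1, map_add, E.d_smul c _ (A.f_pow_sub_eq_zero hu n), ih, θ_apply]
      push_cast
      ring
  rw [θ_apply, h, ← map_sub, E.d_smul t _ (A.f_pow_sub_eq_zero hu m), hn]

theorem exists_residue_comparison (E : DivisorComparison ρ A B c) : ∃ j : ({s // B.α c s = s} → ZMod 5) →ₗ[ZMod 5]
    ({s // A.α c s = s} → ZMod 5),
    ∀ u, B.f (ρ c u - u) = 0 → j (B.residue c u) = A.residue c u := by
  choose sec hsec hsec' using B.exists_residue_eq (c := c)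
  have key : ∀ u v, B.f (ρ c u - u) = 0 → B.f (ρ c v - v) = 0 →
      B.residue c u = B.residue c v → A.residue c u = A.residue c v := fun u v hu hv h => by
    rw [← sub_eq_zero, ← map_sub] at h ⊢
    refine (E.residue_eq_zero_iff ?_).1 h
    rw [map_sub (ρ c), sub_sub_sub_comm, map_sub, hu, hv, sub_zero]
  refine ⟨AddMonoidHom.toZModLinearMap 5 (AddMonoidHom.mk' (fun φ => A.residue c (sec φ))
    fun φ ψ => ?_), fun u hu => key _ _ (hsec _) hu (hsec' _)⟩
  rw [← map_add]
  refine key _ _ (hsec _) ?_ (by rw [hsec', map_add, hsec', hsec'])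
  rw [map_add (ρ c), add_sub_add_comm, map_add, hsec, hsec, add_zero]

theorem card_fixed_eq (E : DivisorComparison ρ A B c) [Finite SA] [Finite SB] {t : Γ} {m n : ℕ} (ht : c * t = t * c ^ m)
    (ht' : c * t⁻¹ = t⁻¹ * c ^ n) :
    (Nat.card {s // A.α c s = s ∧ A.α t s = s} : ZMod 5) =
      Nat.card {s // B.α c s = s ∧ B.α t s = s} + m := by
  obtain ⟨j, hj⟩ := E.exists_residue_comparison
  obtain ⟨y, hy, hθy⟩ := E.exists_θ_eq_one
  have hX : ∀ u, B.f (ρ c u - u) = 0 → E.θ u = 0 := fun u hu => E.d_eq_zero _ hu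
  have hθr : ∀ r : ZMod 5, E.θ (r.val • y) = r := fun r => by
    rw [map_nsmul, hθy, nsmul_eq_mul, mul_one, ZMod.natCast_val, ZMod.cast_id]
  have hYr : ∀ r : ℕ, A.f (ρ c (r • y) - r • y) = 0 := fun r => by
    rw [map_nsmul (ρ c), ← nsmul_sub, map_nsmul, hy, nsmul_zero]
  have hres : ∀ r : ZMod 5, A.residue c (r.val • y) = r • A.residue c y := fun r => by
    rw [map_nsmul, ← Nat.cast_smul_eq_nsmul (ZMod 5), ZMod.natCast_val, ZMod.cast_id]
  have hYs : ∀ u v, A.f (ρ c u - u) = 0 → A.f (ρ c v - v) = 0 →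
      A.f (ρ c (u - v) - (u - v)) = 0 := fun u v hu hv => by
    rw [map_sub (ρ c), sub_sub_sub_comm, map_sub, hu, hv, sub_zero]
  have hbij : Function.Bijective fun v : ({s // B.α c s = s} → ZMod 5) × ZMod 5 =>
      j v.1 + v.2 • A.residue c y := by
    let J := j.coprod (LinearMap.toSpanSingleton (ZMod 5) _ (A.residue c y))
    change Function.Bijective J
    refine ⟨(injective_iff_map_eq_zero J).2 ?_, fun φ => ?_⟩
    · rintro ⟨v, r⟩ h
      obtain ⟨u, hu, rfl⟩ := B.exists_residue_eq v
      have h1 : A.residue c (u - (-r).val • y) = 0 := by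
        rw [map_sub, hres, ← hj u hu, neg_smul, sub_neg_eq_add]
        exact h
      have h2 := E.θ_eq_zero_of_residue_eq_zero (hYs _ _ (E.le _ hu) (hYr _)) h1
      rw [map_sub, hX u hu, hθr, zero_sub, neg_neg] at h2
      subst h2
      rw [neg_zero, ZMod.val_zero, zero_nsmul, sub_zero, ← E.residue_eq_zero_iff hu] at h1
      rw [h1]
      rfl
    · obtain ⟨u, hu, rfl⟩ := A.exists_residue_eq φ
      obtain ⟨v, hv, hvu⟩ := E.exists_residue_eq_of_θ_eq_zero
        (hYs u ((E.θ u).val • y) hu (hYr _)) (by rw [map_sub, hθr, sub_self])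
      refine ⟨(B.residue c v, E.θ u), ?_⟩
      change j (B.residue c v) + E.θ u • A.residue c y = _
      rw [hj v hv, hvu, map_sub, hres, sub_add_cancel]
  obtain ⟨v, hv, hvu⟩ := E.exists_residue_eq_of_θ_eq_zero
    (hYs _ ((m : ZMod 5).val • y) (A.f_sub_eq_zero_of_comm ht hy) (hYr _))
    (by rw [map_sub, E.θ_smul ht hy, hθr, hθy, mul_one, sub_self])
  have hw : A.residueMap ht ht' (A.residue c y) =
      j (B.residue c v) + (m : ZMod 5) • A.residue c y := by
    rw [A.residueMap_residue, hj v hv, hvu, map_sub, hres, sub_add_cancel]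
  have : Nontrivial (ZMod 5) := ⟨0, 1, by decide⟩
  have := LinearMap.trace_eq_add_of_extension hbij (f := B.residueMap ht ht')
    (g := A.residueMap ht ht') (fun v => by
      obtain ⟨u, hu, rfl⟩ := B.exists_residue_eq v
      rw [hj u hu, A.residueMap_residue, B.residueMap_residue,
        hj _ (B.f_sub_eq_zero_of_comm ht hu)]) hw
  rwa [A.trace_residueMap, B.trace_residueMap] at this

/-- A comparison of divisor maps cannot exist in the presence of an element which acts on the
five-element group generated by `c` through squaring. -/
theorem false (E : DivisorComparison ρ A B c) [Finite SA] [Finite SB] {t : Γ} (ht : t * c * t⁻¹ = c ^ 2) : False := by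
  have h1 : c * t⁻¹ = t⁻¹ * c ^ 2 := by rw [← ht]; group
  have h2 : c * t = t * c ^ 3 := by
    have h3 : t * c ^ 3 * t⁻¹ = c := by
      rw [← conj_pow, ht, ← pow_mul, show 2 * 3 = 5 + 1 from rfl, pow_add, E.pow_five, one_mul,
        pow_one]
    rw [← mul_inv_eq_iff_eq_mul.1 h3.symm.symm]
  have e1 := E.card_fixed_eq h2 h1
  have e2 := E.card_fixed_eq h1 (by rwa [inv_inv])
  simp only [map_inv, Equiv.Perm.inv_eq_iff_eq, eq_comm (b := A.α t _), eq_comm (b := B.α t _)] at e2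
  rw [e1, add_right_inj] at e2
  exact absurd e2 (by decide)

end DivisorComparison

section UnitAction

variable {E Γ : Type*} [Field E] [Group Γ]

/-- The underlying field element of a unit of a subring. -/
def unitVal {C : Subring E} (u : Additive Cˣ) : E := ((u.toMul : Cˣ) : C)

variable {C : Subring E}

theorem unitVal_zero : unitVal (0 : Additive Cˣ) = 1 := rfl

theorem unitVal_add (u v : Additive Cˣ) : unitVal (u + v) = unitVal u * unitVal v := rfl

theorem unitVal_ne_zero (u : Additive Cˣ) : unitVal u ≠ 0 := fun h =>
  u.toMul.ne_zero (Subtype.ext h)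

theorem unitVal_neg (u : Additive Cˣ) : unitVal (-u) = (unitVal u)⁻¹ := by
  refine eq_inv_of_mul_eq_one_left ?_
  rw [← unitVal_add, neg_add_cancel, unitVal_zero]

theorem unitVal_mem (u : Additive Cˣ) : unitVal u ∈ C := ((u.toMul : Cˣ) : C).2

theorem exists_unitVal {e : E} (h0 : e ≠ 0) (h : e ∈ C) (h' : e⁻¹ ∈ C) :
    ∃ u : Additive Cˣ, unitVal u = e :=
  ⟨Additive.ofMul ⟨⟨e, h⟩, ⟨e⁻¹, h'⟩, Subtype.ext (mul_inv_cancel₀ h0),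
    Subtype.ext (inv_mul_cancel₀ h0)⟩, rfl⟩

theorem unitVal_sum {α : Type*} (s : Finset α) (u : α → Additive Cˣ) :
    unitVal (∑ i ∈ s, u i) = ∏ i ∈ s, unitVal (u i) := by
  classical
  induction s using Finset.induction_on with
  | empty => simp [unitVal_zero]
  | insert a s ha ih => rw [Finset.sum_insert ha, Finset.prod_insert ha, unitVal_add, ih]

/-- The action on the units of a stable subring. -/
def unitAct (ρ : Γ →* (E →+* E)) (C : Subring E) (hC : ∀ g, ∀ a ∈ C, ρ g a ∈ C) :
    Γ →* AddMonoid.End (Additive Cˣ) where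
  toFun g := MonoidHom.toAdditive (Units.map ((ρ g).restrict C C (hC g)).toMonoidHom)
  map_one' := by
    refine AddMonoidHom.ext fun u => Additive.toMul.injective (Units.ext (Subtype.ext ?_))
    change ρ 1 _ = _
    rw [map_one]
    rfl
  map_mul' g h := by
    refine AddMonoidHom.ext fun u => Additive.toMul.injective (Units.ext (Subtype.ext ?_))
    change ρ (g * h) _ = _
    rw [map_mul]
    rfl

theorem unitVal_unitAct (ρ : Γ →* (E →+* E)) (hC : ∀ g, ∀ a ∈ C, ρ g a ∈ C) (g : Γ)
    (u : Additive Cˣ) : unitVal (unitAct ρ C hC g u) = ρ g (unitVal u) := rfl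

end UnitAction

section Order

variable {A E : Type*} [CommRing A] [IsDomain A] [UniqueFactorizationMonoid A] [Field E]
  {ι : A →+* E}

open Classical in
/-- The order of an element of the field `E` at a prime element of a subring `ι : A → E`. -/
def orderAt (ι : A →+* E) (p : A) (e : E) : ℤ :=
  if h : ∃ a : A × A, a.1 ≠ 0 ∧ a.2 ≠ 0 ∧ e * ι a.2 = ι a.1 then
    (multiplicity p h.choose.1 : ℤ) - multiplicity p h.choose.2 else 0

theorem multiplicity_mul_of_ne_zero {p a b : A} (hp : Prime p) (ha : a ≠ 0) (hb : b ≠ 0) :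
    multiplicity p (a * b) = multiplicity p a + multiplicity p b :=
  multiplicity_mul hp (FiniteMultiplicity.of_prime_left hp (mul_ne_zero ha hb))

theorem orderAt_eq (hι : Function.Injective ι) {p : A} (hp : Prime p) {a b : A} {e : E}
    (ha : a ≠ 0) (hb : b ≠ 0) (h : e * ι b = ι a) :
    orderAt ι p e = multiplicity p a - multiplicity p b := by
  have hex : ∃ a : A × A, a.1 ≠ 0 ∧ a.2 ≠ 0 ∧ e * ι a.2 = ι a.1 := ⟨(a, b), ha, hb, h⟩
  rw [orderAt, dif_pos hex]
  obtain ⟨ha', hb', h'⟩ := hex.choose_spec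
  have h1 : hex.choose.1 * b = a * hex.choose.2 := hι (by
    rw [map_mul, map_mul, ← h, ← h']; ring)
  have h2 := congrArg (multiplicity p) h1
  rw [multiplicity_mul_of_ne_zero hp ha' hb, multiplicity_mul_of_ne_zero hp ha hb'] at h2
  omega

theorem orderAt_map (hι : Function.Injective ι) {p a : A} (hp : Prime p) (ha : a ≠ 0) :
    orderAt ι p (ι a) = multiplicity p a := by
  rw [orderAt_eq hι hp ha one_ne_zero (by rw [map_one, mul_one]),
    multiplicity_of_isUnit_right hp.not_isUnit isUnit_one]
  simp

theorem exists_ne_zero_of_frac (hι : Function.Injective ι)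
    (hfrac : ∀ e : E, ∃ a b, b ≠ 0 ∧ e * ι b = ι a) {e : E} (he : e ≠ 0) :
    ∃ a b, a ≠ 0 ∧ b ≠ 0 ∧ e * ι b = ι a := by
  obtain ⟨a, b, hb, h⟩ := hfrac e
  refine ⟨a, b, ?_, hb, h⟩
  rintro rfl
  rw [map_zero, mul_eq_zero] at h
  exact h.elim he ((map_ne_zero_iff ι hι).2 hb)

theorem orderAt_mul (hι : Function.Injective ι) (hfrac : ∀ e : E, ∃ a b, b ≠ 0 ∧ e * ι b = ι a)
    {p : A} (hp : Prime p) {e f : E} (he : e ≠ 0) (hf : f ≠ 0) :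
    orderAt ι p (e * f) = orderAt ι p e + orderAt ι p f := by
  obtain ⟨a, b, ha, hb, h⟩ := exists_ne_zero_of_frac hι hfrac he
  obtain ⟨a', b', ha', hb', h'⟩ := exists_ne_zero_of_frac hι hfrac hf
  rw [orderAt_eq hι hp ha hb h, orderAt_eq hι hp ha' hb' h', orderAt_eq hι hp (mul_ne_zero ha ha')
    (mul_ne_zero hb hb') (by rw [map_mul, map_mul, ← h, ← h']; ring),
    multiplicity_mul_of_ne_zero hp ha ha', multiplicity_mul_of_ne_zero hp hb hb']
  push_cast
  ring

theorem orderAt_congr (hι : Function.Injective ι) (hfrac : ∀ e : E, ∃ a b, b ≠ 0 ∧ e * ι b = ι a)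
    {p q : A} (hp : Prime p) (h : Associated p q) {e : E} (he : e ≠ 0) :
    orderAt ι p e = orderAt ι q e := by
  obtain ⟨a, b, ha, hb, h'⟩ := exists_ne_zero_of_frac hι hfrac he
  rw [orderAt_eq hι hp ha hb h', orderAt_eq hι (h.prime hp) ha hb h',
    multiplicity_eq_of_associated_left h, multiplicity_eq_of_associated_left h]

theorem orderAt_equiv (hι : Function.Injective ι) (hfrac : ∀ e : E, ∃ a b, b ≠ 0 ∧ e * ι b = ι a)
    {p : A} (hp : Prime p) (τ : A ≃+* A) (r : E →+* E) (hr : ∀ a, ι (τ a) = r (ι a)) {e : E}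
    (he : e ≠ 0) : orderAt ι (τ p) (r e) = orderAt ι p e := by
  obtain ⟨a, b, ha, hb, h⟩ := exists_ne_zero_of_frac hι hfrac he
  rw [orderAt_eq hι hp ha hb h, orderAt_eq hι ((MulEquiv.prime_iff τ).2 hp) (a := τ a) (b := τ b)
    (by simpa) (by simpa) (by rw [hr, hr, ← h, map_mul]), multiplicity_map_eq, multiplicity_map_eq]

theorem exists_unit_iff_orderAt_eq_zero (hι : Function.Injective ι)
    (hfrac : ∀ e : E, ∃ a b, b ≠ 0 ∧ e * ι b = ι a) {e : E} (he : e ≠ 0) :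
    (∃ a : Aˣ, ι a = e) ↔ ∀ p, Prime p → orderAt ι p e = 0 := by
  constructor
  · rintro ⟨a, rfl⟩ p hp
    rw [orderAt_map hι hp a.ne_zero, multiplicity_of_isUnit_right hp.not_isUnit a.isUnit]
    rfl
  · intro h
    obtain ⟨a, b, ha, hb, hab⟩ := exists_ne_zero_of_frac hι hfrac he
    have hm : ∀ p, Prime p → emultiplicity p a = emultiplicity p b := fun p hp => by
      have h1 := h p hp
      rw [orderAt_eq hι hp ha hb hab] at h1
      rw [(FiniteMultiplicity.of_prime_left hp ha).emultiplicity_eq_multiplicity,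
        (FiniteMultiplicity.of_prime_left hp hb).emultiplicity_eq_multiplicity]
      congr 1
      omega
    have h1 : b ∣ a := (UniqueFactorizationMonoid.dvd_iff_emultiplicity_le hb).2
      fun p hp => (hm p hp).ge
    have h2 : a ∣ b := (UniqueFactorizationMonoid.dvd_iff_emultiplicity_le ha).2
      fun p hp => (hm p hp).le
    obtain ⟨u, hu⟩ := associated_of_dvd_dvd h1 h2
    refine ⟨u, mul_right_cancel₀ ((map_ne_zero_iff ι hι).2 hb) ?_⟩
    rw [hab, ← hu, map_mul, mul_comm]

/-- The order at a prime element, as a homomorphism on the units of a subring of `E`. -/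
def orderHom (hι : Function.Injective ι) (hfrac : ∀ e : E, ∃ a b, b ≠ 0 ∧ e * ι b = ι a)
    (C : Subring E) (p : A) (hp : Prime p) : Additive Cˣ →+ ℤ :=
  AddMonoidHom.mk' (fun u => orderAt ι p (unitVal u)) fun u v => by
    rw [unitVal_add, orderAt_mul hι hfrac hp (unitVal_ne_zero u) (unitVal_ne_zero v)]

/-- The divisor map attached to a unique factorization domain `A` and a stable overring `C`
obtained by inverting one element. -/
theorem exists_divisorMap {Γ : Type*} [Group Γ] (hι : Function.Injective ι)
    (hfrac : ∀ e : E, ∃ a b, b ≠ 0 ∧ e * ι b = ι a) {ρ : Γ →* (E →+* E)} {C : Subring E}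
    (hC : ∀ g, ∀ a ∈ C, ρ g a ∈ C) (hA : ∀ g a, ∃ a', ι a' = ρ g (ι a)) (hAC : ∀ a, ι a ∈ C)
    {c : A} (hc0 : c ≠ 0) (hc : (ι c)⁻¹ ∈ C) (hCA : ∀ u ∈ C, ∃ n a, u * ι c ^ n = ι a) :
    ∃ (S : Set (Additive Cˣ →+ ℤ)) (_ : Finite S) (D : DivisorMap (unitAct ρ C hC) S),
      ∀ u, D.f u = 0 ↔ ∃ a : Aˣ, ι a = unitVal u := by
  classical
  let S : Set (Additive Cˣ →+ ℤ) :=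
    {v | ∃ (p : A) (hp : Prime p), (ι p)⁻¹ ∈ C ∧ v = orderHom hι hfrac C p hp}
  have hι0 : ∀ {a : A}, a ≠ 0 → ι a ≠ 0 := fun h => (map_ne_zero_iff ι hι).2 h
  have hdvd : ∀ p : A, Prime p → ((ι p)⁻¹ ∈ C ↔ p ∣ c) := fun p hp => by
    constructor
    · intro h
      obtain ⟨n, a, ha⟩ := hCA _ h
      refine hp.dvd_of_dvd_pow (n := n) ⟨a, hι ?_⟩
      rw [map_mul, ← ha, mul_inv_cancel_left₀ (hι0 hp.ne_zero), map_pow]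
    · rintro ⟨a, ha⟩
      have : (ι p)⁻¹ = ι a * (ι c)⁻¹ := by
        have ha0 : ι a ≠ 0 := fun h => hι0 hc0 (by rw [ha, map_mul, h, mul_zero])
        rw [ha, map_mul, mul_inv, mul_comm, mul_assoc, inv_mul_cancel₀ ha0, mul_one]
      rw [this]
      exact C.mul_mem (hAC a) hc
  have hfin : S.Finite := by
    refine ((Multiset.finite_toSet (UniqueFactorizationMonoid.factors c)).image
      (fun p => if hp : Prime p then orderHom hι hfrac C p hp else 0)).subset ?_
    rintro v ⟨p, hp, hpC, rfl⟩
    obtain ⟨q, hq, hpq⟩ := UniqueFactorizationMonoid.exists_mem_factors_of_dvd hc0 hp.irreducible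
      ((hdvd p hp).1 hpC)
    refine ⟨q, hq, ?_⟩
    dsimp only
    rw [dif_pos (hpq.prime hp)]
    exact AddMonoidHom.ext fun u => (orderAt_congr hι hfrac hp hpq (unitVal_ne_zero u)).symm
  have hτ : ∀ g, ∃ τ : A ≃+* A, ∀ a, ι (τ a) = ρ g (ι a) := fun g => by
    choose τ hτ using hA
    have hinv : ∀ g a, τ g (τ g⁻¹ a) = a := fun g a => hι (by
      rw [hτ, hτ, ← RingHom.comp_apply, ← RingHom.mul_def, ← map_mul, mul_inv_cancel, map_one]
      rfl)
    refine ⟨{ toFun := τ g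
              invFun := τ g⁻¹
              left_inv := fun a => by simpa using hinv g⁻¹ a
              right_inv := hinv g
              map_mul' := fun a b => hι (by simp [hτ])
              map_add' := fun a b => hι (by simp [hτ]) }, hτ g⟩
  have hcomp : ∀ g h (u : Additive Cˣ), unitAct ρ C hC g (unitAct ρ C hC h u) =
      unitAct ρ C hC (g * h) u := fun g h u => by rw [map_mul]; rfl
  have hmem : ∀ g, ∀ v ∈ S, v.comp (unitAct ρ C hC g⁻¹) ∈ S := by
    rintro g v ⟨p, hp, hpC, rfl⟩
    obtain ⟨τ, hτ⟩ := hτ g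
    refine ⟨τ p, (MulEquiv.prime_iff τ).2 hp, ?_, AddMonoidHom.ext fun u => ?_⟩
    · rw [hτ, ← map_inv₀]
      exact hC g _ hpC
    · change orderAt ι p (unitVal (unitAct ρ C hC g⁻¹ u)) = orderAt ι (τ p) (unitVal u)
      rw [← orderAt_equiv hι hfrac hp τ (ρ g) hτ (unitVal_ne_zero _), ← unitVal_unitAct ρ hC, hcomp,
        mul_inv_cancel, map_one]
      rfl
  have hact : ∀ g h (v : Additive Cˣ →+ ℤ), (v.comp (unitAct ρ C hC h)).comp (unitAct ρ C hC g) =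
      v.comp (unitAct ρ C hC (h * g)) := fun g h v => AddMonoidHom.ext fun u =>
    congrArg v (hcomp h g u)
  have hone : ∀ v : Additive Cˣ →+ ℤ, v.comp (unitAct ρ C hC 1) = v := fun v =>
    AddMonoidHom.ext fun u => by rw [map_one]; rfl
  let α : Γ →* Equiv.Perm S :=
    { toFun := fun g =>
        { toFun := fun v => ⟨_, hmem g v.1 v.2⟩
          invFun := fun v => ⟨_, hmem g⁻¹ v.1 v.2⟩
          left_inv := fun v => Subtype.ext (by
            dsimp only; rw [hact, mul_inv_cancel, hone])
          right_inv := fun v => Subtype.ext (by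
            dsimp only; rw [hact, inv_mul_cancel, hone]) }
      map_one' := Equiv.ext fun v => Subtype.ext (by
        change v.1.comp (unitAct ρ C hC 1⁻¹) = v.1
        rw [inv_one, hone])
      map_mul' := fun g h => Equiv.ext fun v => Subtype.ext (by
        change v.1.comp (unitAct ρ C hC (g * h)⁻¹) =
          (v.1.comp (unitAct ρ C hC h⁻¹)).comp (unitAct ρ C hC g⁻¹)
        rw [hact, mul_inv_rev]) }
  have hfS := hfin.fintype
  refine ⟨S, hfin, ⟨α, AddMonoidHom.mk' (fun u v => v.1 u) fun u w => funext fun v => map_add v.1 u w,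
    fun g u s => ?_, fun φ => ?_⟩, fun u => ?_⟩
  · change s.1 (unitAct ρ C hC g⁻¹ (unitAct ρ C hC g u)) = s.1 u
    rw [hcomp, inv_mul_cancel, map_one]
    rfl
  · have hex : ∀ s : S, ∃ u : Additive Cˣ, ∀ s' : S, s'.1 u = if s = s' then 1 else 0 := by
      rintro ⟨v, p, hp, hpC, hv⟩
      obtain ⟨u, hu⟩ := exists_unitVal (hι0 hp.ne_zero) (hAC p) hpC
      refine ⟨u, ?_⟩
      rintro ⟨v', p', hp', hpC', hv'⟩
      have h1 : v' u = multiplicity p' p := by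
        rw [hv', ← orderAt_map hι hp' hp.ne_zero, ← hu]
        rfl
      dsimp only
      rw [h1]
      split_ifs with h
      · have h2 : v u = multiplicity p p := by
          rw [hv, ← orderAt_map hι hp hp.ne_zero, ← hu]
          rfl
        rw [← h1, ← Subtype.mk.inj h, h2, multiplicity_self]
        rfl
      · rw [Nat.cast_eq_zero, multiplicity_eq_zero]
        intro h2
        refine h (Subtype.ext ?_)
        have h3 := (Prime.dvd_prime_iff_associated hp' hp).1 h2
        change v = v'
        rw [hv, hv']
        exact AddMonoidHom.ext fun u =>
          (orderAt_congr hι hfrac hp' h3 (unitVal_ne_zero u)).symm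
    choose w hw using hex
    refine ⟨∑ s, φ s • w s, funext fun s' => ?_⟩
    change s'.1 (∑ s, φ s • w s) = φ s'
    rw [map_sum, Finset.sum_eq_single s']
    · rw [map_zsmul, hw, if_pos rfl, smul_eq_mul, mul_one]
    · intro s _ hs
      rw [map_zsmul, hw, if_neg hs, smul_zero]
    · exact fun h => absurd (Finset.mem_univ _) h
  · rw [exists_unit_iff_orderAt_eq_zero hι hfrac (unitVal_ne_zero u)]
    constructor
    · intro h p hp
      by_cases hpC : (ι p)⁻¹ ∈ C
      · exact congrFun h ⟨_, p, hp, hpC, rfl⟩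
      · have hpc : multiplicity p c = 0 :=
          multiplicity_eq_zero.2 fun h => hpC ((hdvd p hp).2 h)
        have hnn : ∀ u : Additive Cˣ, 0 ≤ orderHom hι hfrac C p hp u := fun u => by
          obtain ⟨n, a, ha⟩ := hCA _ (unitVal_mem u)
          have ha0 : a ≠ 0 := by
            rintro rfl
            rw [map_zero] at ha
            exact mul_ne_zero (unitVal_ne_zero u) (pow_ne_zero n (hι0 hc0)) ha
          change 0 ≤ orderAt ι p (unitVal u)
          rw [orderAt_eq hι hp ha0 (pow_ne_zero n hc0) (by rw [map_pow, ha]),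
            (FiniteMultiplicity.of_prime_left hp hc0).multiplicity_pow hp, hpc]
          simp
        have h1 : 0 ≤ orderAt ι p (unitVal u) := hnn u
        have h2 : 0 ≤ -orderAt ι p (unitVal u) := by
          have := hnn (-u)
          rwa [map_neg] at this
        exact le_antisymm (by omega) h1
    · rintro h
      funext ⟨v, p, hp, hpC, hv⟩
      change v u = 0
      rw [hv]
      exact h p hp

end Order

section TorusObstruction

variable {Γ U SA SB : Type*} [Group Γ] [AddCommGroup U] {ρ : Γ →* AddMonoid.End U}
  {A : DivisorMap ρ SA} {B : DivisorMap ρ SB} {π : Γ →* Equiv.Perm (Fin 5)} {ξ : Fin 5 → U}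

theorem act_sum_smul (hρ : ∀ g i, ρ g (ξ i) = ξ (π g i)) (g : Γ) (v : Fin 5 → ℤ) :
    ρ g (∑ i, v i • ξ i) = ∑ i, v (π g⁻¹ i) • ξ i := by
  rw [map_sum, ← Equiv.sum_comp (π g) fun i => v (π g⁻¹ i) • ξ i]
  refine Finset.sum_congr rfl fun i _ => ?_
  rw [map_zsmul, hρ, ← Equiv.Perm.mul_apply, ← map_mul, inv_mul_cancel, map_one,
    Equiv.Perm.one_apply]

/-- There is no pair of divisor maps whose kernels differ by the character group of the norm one
torus of a degree five extension, if the Galois group contains a Frobenius group of order 20. -/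
theorem DivisorMap.false_of_torus [Finite SA] [Finite SB] (hξ : ∑ i, ξ i = 0)
    (hρ : ∀ g i, ρ g (ξ i) = ξ (π g i))
    (hA : ∀ u, A.f u = 0 ↔ ∃ n, ∃ v : Fin 5 → ℤ, B.f n = 0 ∧ u = n + ∑ i, v i • ξ i)
    (hind : ∀ v : Fin 5 → ℤ, B.f (∑ i, v i • ξ i) = 0 → ∀ i j, v i = v j)
    (d : U →+ ZMod 5) (hdB : ∀ u, B.f u = 0 → d u = 0) (hdξ : ∀ i, d (ξ i) = 1) {c t : Γ}
    (h5 : c ^ 5 = 1) (h1 : π c ≠ 1) (ht : t * c * t⁻¹ = c ^ 2) : False := by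
  have hp5 : π c⁻¹ ^ 5 = 1 := by rw [← map_pow, inv_pow, h5, inv_one, map_one]
  have hp1 : π c⁻¹ ≠ 1 := by rwa [map_inv, inv_ne_one]
  have hπ5 : π c ^ 5 = 1 := by rw [← map_pow, h5, map_one]
  have hconst : ∀ v : Fin 5 → ℤ, (∀ i j, v i = v j) → ∑ i, v i • ξ i = 0 := fun v hv => by
    rw [Finset.sum_congr rfl fun i _ => by rw [hv i 0], ← Finset.smul_sum, hξ, smul_zero]
  have hd : ∀ n, ∀ v : Fin 5 → ℤ, B.f n = 0 → d (n + ∑ i, v i • ξ i) = ((∑ i, v i : ℤ) : ZMod 5) :=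
    fun n v hn => by
      rw [map_add, hdB n hn, zero_add, map_sum, Int.cast_sum]
      exact Finset.sum_congr rfl fun i _ => by rw [map_zsmul, hdξ, zsmul_one]
  refine DivisorComparison.false (A := A) (B := B) (c := c) ⟨h5, d, fun u hu => ?_,
    fun g u hu => ?_, hdB, fun u hu hu' => ?_, fun u hu hdu => ?_, ?_⟩ ht
  · exact (hA u).2 ⟨u, 0, hu, by simp⟩
  · obtain ⟨n, v, hn, rfl⟩ := (hA u).1 hu
    rw [hd n v hn, map_add, act_sum_smul hρ, hd _ _ ((B.f_eq_zero_iff g n).2 hn),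
      Equiv.sum_comp (π g⁻¹) v]
  · obtain ⟨n, v, hn, rfl⟩ := (hA u).1 hu
    have h2 : B.f (∑ i, (v (π c⁻¹ i) - v i) • ξ i) = 0 := by
      rw [map_add, act_sum_smul hρ, add_sub_add_comm, map_add, map_sub,
        (B.f_eq_zero_iff c n).2 hn, hn, sub_zero, zero_add, ← Finset.sum_sub_distrib] at hu'
      simpa only [sub_smul] using hu'
    have h3 := hind _ h2
    have h4 : ∀ i, v (π c⁻¹ i) = v i := fun i => by
      have h6 : ∑ i, (v (π c⁻¹ i) - v i) = 0 := by
        rw [Finset.sum_sub_distrib, Equiv.sum_comp (π c⁻¹) v, sub_self]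
      rw [Finset.sum_congr rfl fun j _ => h3 j i, Finset.sum_const, Finset.card_univ,
        Fintype.card_fin, smul_eq_zero] at h6
      exact sub_eq_zero.1 (h6.resolve_left (by norm_num))
    have h6 : ∀ l : ℕ, ∀ i, v ((π c⁻¹ ^ l) i) = v i := fun l i => by
      induction l with
      | zero => rfl
      | succ l ih => rw [pow_succ', Equiv.Perm.mul_apply, h4, ih]
    rw [hconst v fun i j => ?_, add_zero, hn]
    obtain ⟨l, rfl⟩ := exists_pow_five_cycle hp5 hp1 i j
    exact (h6 l i).symm
  · obtain ⟨n, v, hn, rfl⟩ := (hA u).1 hu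
    rw [hd n v hn] at hdu
    obtain ⟨b, hb⟩ := (ZMod.intCast_zmod_eq_zero_iff_dvd _ 5).1 hdu
    obtain ⟨g, hg⟩ := exists_sub_eq_of_sum_eq_zero (h := fun i => v i - b) hp5 fun i => by
      rw [sum_pow_five_cycle hp5 hp1 (fun i => v i - b), Finset.sum_sub_distrib, hb]
      simp
    refine ⟨∑ i, g i • ξ i, (hA _).2 ⟨0, g, map_zero _, (zero_add _).symm⟩, ?_⟩
    rw [act_sum_smul hρ, ← Finset.sum_sub_distrib]
    simp only [← sub_smul, hg]
    simp only [sub_smul, Finset.sum_sub_distrib, ← Finset.smul_sum, hξ, smul_zero, sub_zero]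
    rwa [add_sub_cancel_right]
  · refine ⟨ξ 0, (hA _).2 ⟨0, Pi.single 0 1, map_zero _, ?_⟩, hdξ 0, ?_⟩
    · simp [Pi.single_apply]
    · simp only [hρ]
      simp only [map_pow π]
      rw [sum_pow_five_cycle hπ5 h1, hξ, map_zero]

end TorusObstruction

universe u v

section TorusModel

variable {L : Type u} {E S : Type*} [Field L] [Field E] [Algebra L E]

theorem aeval_mem_subring (C : Subring E) (hL : ∀ l, algebraMap L E l ∈ C) {w : S → E}
    (hw : ∀ i, w i ∈ C) (p : MvPolynomial S L) : aeval w p ∈ C := by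
  induction p using MvPolynomial.induction_on with
  | C a => rw [aeval_C]; exact hL a
  | add p q hp hq => rw [map_add]; exact C.add_mem hp hq
  | mul_X p i hp => rw [map_mul, aeval_X]; exact C.mul_mem hp (hw i)

theorem exists_unit_map_iff {A : Type*} [CommRing A] {ι : A →+* E}
    (hι : Function.Injective ι) {e : E} :
    (∃ a : Aˣ, ι a = e) ↔ e ≠ 0 ∧ (∃ a, ι a = e) ∧ ∃ a, ι a = e⁻¹ := by
  constructor
  · rintro ⟨a, rfl⟩
    have h : ι a * ι (a⁻¹ : Aˣ) = 1 := by rw [← map_mul, Units.mul_inv, map_one]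
    exact ⟨left_ne_zero_of_mul_eq_one h, ⟨a, rfl⟩, _, eq_inv_of_mul_eq_one_right h⟩
  · rintro ⟨h0, ⟨a, rfl⟩, b, hb⟩
    have h1 : a * b = 1 := hι (by rw [map_mul, hb, mul_inv_cancel₀ h0, map_one])
    exact ⟨Units.mkOfMulEqOne a b h1, rfl⟩

theorem exists_localization_model {S : Type v} {w : S → E} (hw : AlgebraicIndependent L w)
    {Q : MvPolynomial S L} (hQ : Q ≠ 0) :
    ∃ (A : Type (max u v)) (_ : CommRing A) (_ : IsDomain A) (_ : UniqueFactorizationMonoid A)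
      (ι : A →+* E), Function.Injective ι ∧
        ∀ e, (∃ a, ι a = e) ↔ ∃ n, ∃ p : MvPolynomial S L, e * aeval w Q ^ n = aeval w p := by
  have hQ0 : aeval w Q ≠ 0 := (map_ne_zero_iff _ hw).2 hQ
  have hQu : IsUnit ((aeval w : MvPolynomial S L →ₐ[L] E).toRingHom Q) := hQ0.isUnit
  have hd : IsDomain (Localization.Away Q) := IsLocalization.isDomain_localization
    (powers_le_nonZeroDivisors_of_noZeroDivisors hQ)
  have hlift : ∀ p, IsLocalization.Away.lift (S := Localization.Away Q) Q hQu
      (algebraMap _ _ p) = aeval w p := fun p => IsLocalization.Away.lift_eq Q hQu p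
  refine ⟨Localization.Away Q, inferInstance, hd, inferInstance,
    IsLocalization.Away.lift Q hQu, ?_, fun e => ⟨?_, ?_⟩⟩
  · rw [injective_iff_map_eq_zero]
    intro a ha
    obtain ⟨n, p, hp⟩ := IsLocalization.Away.surj Q a
    have h1 := congrArg (IsLocalization.Away.lift (S := Localization.Away Q) Q hQu) hp
    rw [map_mul, ha, zero_mul, hlift] at h1
    have h2 : p = 0 := hw (by rw [← h1, map_zero])
    rw [h2, map_zero] at hp
    exact ((IsLocalization.Away.algebraMap_isUnit Q).pow n).mul_left_eq_zero.1 hp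
  · rintro ⟨a, rfl⟩
    obtain ⟨n, p, hp⟩ := IsLocalization.Away.surj Q a
    refine ⟨n, p, ?_⟩
    have h1 := congrArg (IsLocalization.Away.lift (S := Localization.Away Q) Q hQu) hp
    rwa [map_mul, map_pow, hlift, hlift] at h1
  · rintro ⟨n, p, hp⟩
    refine ⟨algebraMap _ _ p * IsLocalization.Away.invSelf Q ^ n, ?_⟩
    have h1 := congrArg (IsLocalization.Away.lift (S := Localization.Away Q) Q hQu)
      (IsLocalization.Away.mul_invSelf (S := Localization.Away Q) Q)
    rw [map_mul, hlift, map_one] at h1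
    rw [map_mul, map_pow, hlift, ← hp, mul_assoc, ← mul_pow, h1, one_pow, mul_one]

theorem eq_mul_prod_zpow {I : Type*} [Fintype I] {w : I ⊕ S → E} (hw : AlgebraicIndependent L w)
    {e : E} (he : e ≠ 0) {n m : ℕ} {p q : MvPolynomial (I ⊕ S) L}
    (hp : e * aeval w (∏ i : I, X (Sum.inl i) : MvPolynomial (I ⊕ S) L) ^ n = aeval w p)
    (hq : e⁻¹ * aeval w (∏ i : I, X (Sum.inl i) : MvPolynomial (I ⊕ S) L) ^ m = aeval w q) :
    ∃ l : L, l ≠ 0 ∧ ∃ v : I → ℤ, e = algebraMap L E l * ∏ i, w (Sum.inl i) ^ v i := by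
  classical
  have hw0 : ∀ i, w i ≠ 0 := hw.ne_zero
  set Q : MvPolynomial (I ⊕ S) L := ∏ i : I, X (Sum.inl i) with hQ
  let s : I ⊕ S →₀ ℕ := ∑ i : I, Finsupp.single (Sum.inl i) (n + m)
  have hpq : p * q = monomial s 1 := by
    have h1 : Q ^ (n + m) = monomial s 1 := by
      rw [hQ, ← Finset.prod_pow, monomial_sum_one]
      exact Finset.prod_congr rfl fun i _ => X_pow_eq_monomial
    rw [← h1]
    refine hw ?_
    change aeval w _ = aeval w _
    rw [map_mul, ← hp, ← hq, map_pow, pow_add]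
    field_simp
  obtain ⟨r, b, hr, hb, rfl⟩ := (dvd_monomial_iff_exists one_ne_zero).1 (Dvd.intro _ hpq)
  have hrS : ∀ j : S, r (Sum.inr j) = 0 := fun j => by
    have := hr (Sum.inr j)
    simpa [s, Finsupp.finsetSum_apply] using this
  refine ⟨b, (isUnit_of_dvd_one hb).ne_zero, fun i => (r (Sum.inl i) : ℤ) - n, ?_⟩
  have hr' : r.prod (fun i k => w i ^ k) = ∏ i : I, w (Sum.inl i) ^ r (Sum.inl i) := by
    rw [Finsupp.prod_of_support_subset r (s := Finset.univ.map Function.Embedding.inl)]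
    · rw [Finset.prod_map]; rfl
    · intro i hi
      rcases i with i | j
      · simp
      · exact absurd (hrS j) (Finsupp.mem_support_iff.1 hi)
    · simp
  rw [aeval_monomial, hr', map_prod, ← Finset.prod_pow] at hp
  simp only [aeval_X] at hp
  have h2 : ∏ i : I, w (Sum.inl i) ^ n ≠ 0 :=
    Finset.prod_ne_zero_iff.2 fun i _ => pow_ne_zero _ (hw0 _)
  refine mul_right_cancel₀ h2 ?_
  rw [hp, mul_assoc, ← Finset.prod_mul_distrib]
  congr 1
  refine Finset.prod_congr rfl fun i _ => ?_
  rw [zpow_sub₀ (hw0 _), zpow_natCast, zpow_natCast, div_mul_cancel₀ _ (pow_ne_zero _ (hw0 _))]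

end TorusModel

section Overring

variable {E Γ : Type*} [Field E] [Group Γ] (ρ : Γ →* (E →+* E)) {R R' : Subring E}

/-- The elements of `E` which are carried into `R` by a power of `s`. -/
def awaySubring (R : Subring E) {s : E} (hs : s ∈ R) : Subring E where
  carrier := {e | ∃ n, e * s ^ n ∈ R}
  one_mem' := ⟨0, by simp⟩
  zero_mem' := ⟨0, by simp⟩
  mul_mem' := by
    rintro a b ⟨n, hn⟩ ⟨m, hm⟩
    refine ⟨n + m, ?_⟩
    have := R.mul_mem hn hm
    rwa [mul_mul_mul_comm, ← pow_add] at this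
  add_mem' := by
    rintro a b ⟨n, hn⟩ ⟨m, hm⟩
    refine ⟨n + m, ?_⟩
    have := R.add_mem (R.mul_mem hn (R.pow_mem hs m)) (R.mul_mem hm (R.pow_mem hs n))
    rwa [mul_assoc, ← pow_add, mul_assoc, ← pow_add, add_comm m n, ← add_mul] at this
  neg_mem' := by
    rintro a ⟨n, hn⟩
    exact ⟨n, by rw [neg_mul]; exact R.neg_mem hn⟩

theorem exists_invariant_denominator [Finite Γ] {J : Type*} [Finite J]
    (hR : ∀ g, ∀ a ∈ R, ρ g a ∈ R) (hfrac : ∀ e, ∃ s ∈ R, s ≠ 0 ∧ e * s ∈ R) (z : J → E) :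
    ∃ a ∈ R, a ≠ 0 ∧ (∀ g, ρ g a = a) ∧ ∀ j, z j * a ∈ R := by
  classical
  have := Fintype.ofFinite Γ
  have := Fintype.ofFinite J
  choose s hsR hs0 hs using fun j => hfrac (z j)
  have hP : ∏ j, s j ∈ R := R.prod_mem fun j _ => hsR j
  refine ⟨∏ g, ρ g (∏ j, s j), R.prod_mem fun g _ => hR g _ hP,
    Finset.prod_ne_zero_iff.2 fun g _ => (map_ne_zero _).2 (Finset.prod_ne_zero_iff.2 fun j _ => hs0 j),
    fun h => ?_, fun j => ?_⟩
  · rw [map_prod]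
    refine Fintype.prod_equiv (Equiv.mulLeft h) _ _ fun g => ?_
    rw [Equiv.coe_mulLeft, map_mul]
    rfl
  · rw [← Finset.mul_prod_erase _ _ (Finset.mem_univ (1 : Γ)), map_one, RingHom.one_def,
      RingHom.id_apply, ← Finset.mul_prod_erase _ _ (Finset.mem_univ j), ← mul_assoc, ← mul_assoc]
    exact R.mul_mem (R.mul_mem (hs j) (R.prod_mem fun j _ => hsR j))
      (R.prod_mem fun g _ => hR g _ (by rwa [Finset.mul_prod_erase _ _ (Finset.mem_univ j)]))

theorem exists_inverted_element {C : Subring E} {a b : E} (ha : a ∈ R) (hb : b ∈ R') (ha0 : a ≠ 0)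
    (hb0 : b ≠ 0) (hRR' : ∀ e ∈ R', ∃ n, e * a ^ n ∈ R)
    (hC : C = Subring.closure ((R ∪ R') ∪ {a⁻¹, b⁻¹})) :
    ∃ c ∈ R, c ≠ 0 ∧ c⁻¹ ∈ C ∧ ∀ u ∈ C, ∃ n, u * c ^ n ∈ R := by
  obtain ⟨N, hN⟩ := hRR' b hb
  have haC : a⁻¹ ∈ C := by rw [hC]; exact Subring.subset_closure (Or.inr (Or.inl rfl))
  have hbC : b⁻¹ ∈ C := by rw [hC]; exact Subring.subset_closure (Or.inr (Or.inr rfl))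
  have hc : b * a ^ N * a ∈ R := R.mul_mem hN ha
  refine ⟨b * a ^ N * a, hc, mul_ne_zero (mul_ne_zero hb0 (pow_ne_zero _ ha0)) ha0, ?_, ?_⟩
  · rw [mul_inv, mul_inv, ← inv_pow]
    exact C.mul_mem (C.mul_mem hbC (C.pow_mem haC _)) haC
  · suffices h : C ≤ awaySubring R hc from h
    rw [hC, Subring.closure_le]
    rintro e ((he | he) | (rfl | rfl))
    · exact ⟨0, by rwa [pow_zero, mul_one]⟩
    · obtain ⟨n, hn⟩ := hRR' e he
      refine ⟨n, ?_⟩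
      rw [mul_pow, mul_comm (_ ^ n), ← mul_assoc]
      exact R.mul_mem hn (R.pow_mem hN n)
    · refine ⟨1, ?_⟩
      rw [pow_one, mul_comm, mul_inv_cancel_right₀ ha0]
      exact hN
    · refine ⟨1, ?_⟩
      rw [pow_one, mul_assoc, inv_mul_cancel_left₀ hb0, ← pow_succ]
      exact R.pow_mem ha _

theorem exists_common_overring (hR : ∀ g, ∀ a ∈ R, ρ g a ∈ R) (hR' : ∀ g, ∀ a ∈ R', ρ g a ∈ R')
    {a b : E} (ha : a ∈ R) (hb : b ∈ R') (ha0 : a ≠ 0) (hb0 : b ≠ 0) (hρa : ∀ g, ρ g a = a)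
    (hρb : ∀ g, ρ g b = b) (hRR' : ∀ e ∈ R', ∃ n, e * a ^ n ∈ R)
    (hR'R : ∀ e ∈ R, ∃ n, e * b ^ n ∈ R') :
    ∃ C : Subring E, (∀ g, ∀ a ∈ C, ρ g a ∈ C) ∧ R ≤ C ∧ R' ≤ C ∧
      (∃ c ∈ R, c ≠ 0 ∧ c⁻¹ ∈ C ∧ ∀ u ∈ C, ∃ n, u * c ^ n ∈ R) ∧
      ∃ c ∈ R', c ≠ 0 ∧ c⁻¹ ∈ C ∧ ∀ u ∈ C, ∃ n, u * c ^ n ∈ R' := by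
  refine ⟨Subring.closure ((R ∪ R') ∪ {a⁻¹, b⁻¹}), fun g => ?_,
    fun e he => Subring.subset_closure (Or.inl (Or.inl he)),
    fun e he => Subring.subset_closure (Or.inl (Or.inr he)),
    exists_inverted_element ha hb ha0 hb0 hRR' rfl,
    exists_inverted_element hb ha hb0 ha0 hR'R (by rw [Set.union_comm (R : Set E), Set.pair_comm])⟩
  suffices h : Subring.closure ((R ∪ R') ∪ {a⁻¹, b⁻¹}) ≤
      (Subring.closure (((R : Set E) ∪ R') ∪ {a⁻¹, b⁻¹})).comap (ρ g) from h
  rw [Subring.closure_le]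
  rintro e ((he | he) | (rfl | rfl))
  · exact Subring.subset_closure (Or.inl (Or.inl (hR g e he)))
  · exact Subring.subset_closure (Or.inl (Or.inr (hR' g e he)))
  · change ρ g _ ∈ Subring.closure _
    rw [map_inv₀, hρa]
    exact Subring.subset_closure (Or.inr (Or.inl rfl))
  · change ρ g _ ∈ Subring.closure _
    rw [map_inv₀, hρb]
    exact Subring.subset_closure (Or.inr (Or.inr rfl))

end Overring

section Generators

theorem unitVal_injective {E : Type*} [Field E] {C : Subring E} :
    Function.Injective (unitVal : Additive Cˣ → E) := fun _ _ h =>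
  Additive.toMul.injective (Units.ext (Subtype.ext h))

theorem unitVal_zsmul {E : Type*} [Field E] {C : Subring E} (n : ℤ) (u : Additive Cˣ) :
    unitVal (n • u) = unitVal u ^ n := by
  have h : ∀ n : ℕ, unitVal (n • u) = unitVal u ^ n := fun n => by
    induction n with
    | zero => rw [zero_nsmul, pow_zero, unitVal_zero]
    | succ n ih => rw [succ_nsmul, unitVal_add, ih, pow_succ]
  obtain ⟨m, rfl | rfl⟩ := n.eq_nat_or_neg
  · rw [natCast_zsmul, h, zpow_natCast]
  · rw [neg_smul, unitVal_neg, natCast_zsmul, h, zpow_neg, zpow_natCast]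

theorem exists_frac_of_adjoin_eq_top {L E S : Type*} [Field L] [Field E] [Algebra L E] {w : S → E}
    (hw : IntermediateField.adjoin L (Set.range w) = ⊤) (e : E) :
    ∃ p q : MvPolynomial S L, aeval w q ≠ 0 ∧ e * aeval w q = aeval w p := by
  have he : e ∈ IntermediateField.adjoin L (Set.range w) := hw ▸ IntermediateField.mem_top
  obtain ⟨p, q, rfl⟩ := (IntermediateField.mem_adjoin_range_iff L w e).1 he
  by_cases hq : aeval w q = 0
  · exact ⟨0, 1, by simp, by simp [hq]⟩
  · exact ⟨p, q, hq, div_mul_cancel₀ _ hq⟩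

/-- The order at `X j` of a monomial in units of which the first four are variables and the last
is the inverse of their product. -/
theorem sum_zsmul_order {U : Type*} [AddCommGroup U] {ξ : Fin 5 → U} (hξ : ∑ i, ξ i = 0)
    {δ : U →+ ℤ} {j : Fin 4} (hδ : ∀ i : Fin 4, δ (ξ i.castSucc) = if i = j then 1 else 0) :
    δ (ξ (Fin.last 4)) = -1 ∧
    ∀ v : Fin 5 → ℤ, δ (∑ i, v i • ξ i) = v j.castSucc - v (Fin.last 4) := by
  have h1 : δ (ξ (Fin.last 4)) = -1 := by
    have := congrArg δ hξ
    rw [Fin.sum_univ_castSucc, map_add, map_sum, map_zero, Finset.sum_congr rfl fun i _ => hδ i,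
      Finset.sum_ite_eq' Finset.univ j, if_pos (Finset.mem_univ j)] at this
    omega
  refine ⟨h1, fun v => ?_⟩
  rw [Fin.sum_univ_castSucc, map_add, map_sum, map_zsmul, h1]
  simp only [map_zsmul, hδ, smul_eq_mul, mul_ite, mul_one, mul_zero, Finset.sum_ite_eq',
    Finset.mem_univ, if_true, mul_neg]
  ring

theorem exists_order_homs {L E S : Type*} [Field L] [Field E] [Algebra L E] {x : Fin 5 → E}
    {y : S → E}
    (hw : AlgebraicIndependent L (Sum.elim (fun i : Fin 4 => x i.castSucc) y))
    (hwtop : IntermediateField.adjoin L (Set.range (Sum.elim (fun i : Fin 4 => x i.castSucc) y)) = ⊤)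
    {C : Subring E} {ξ : Fin 5 → Additive Cˣ} (hξ : ∀ i, unitVal (ξ i) = x i) :
    ∃ δ : Fin 4 → (Additive Cˣ →+ ℤ),
      (∀ j u, (∃ l : L, l ≠ 0 ∧ unitVal u = algebraMap L E l) → δ j u = 0) ∧
      ∀ i j, δ j (ξ (Fin.castSucc i)) = if i = j then 1 else 0 := by
  classical
  set w := Sum.elim (fun i : Fin 4 => x i.castSucc) y
  have hι : Function.Injective (aeval w : MvPolynomial (Fin 4 ⊕ S) L →ₐ[L] E).toRingHom := hw
  have hfrac : ∀ e : E, ∃ a b, b ≠ 0 ∧ e * (aeval w : MvPolynomial (Fin 4 ⊕ S) L →ₐ[L] E).toRingHom b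
      = (aeval w : MvPolynomial (Fin 4 ⊕ S) L →ₐ[L] E).toRingHom a := fun e => by
    obtain ⟨p, q, hq, h⟩ := exists_frac_of_adjoin_eq_top hwtop e
    exact ⟨p, q, fun h0 => hq (by rw [h0, map_zero]), h⟩
  refine ⟨fun j => orderHom hι hfrac C (X (Sum.inl j)) X_prime, ?_, fun i j => ?_⟩
  · rintro j u ⟨l, hl, hu⟩
    refine (exists_unit_iff_orderAt_eq_zero hι hfrac (unitVal_ne_zero u)).1
      ⟨Units.map (MvPolynomial.C : L →+* MvPolynomial (Fin 4 ⊕ S) L).toMonoidHom (Units.mk0 l hl), ?_⟩ _ X_prime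
    rw [hu]
    exact aeval_C w l
  · change orderAt _ _ (unitVal (ξ _)) = _
    have h1 : unitVal (ξ i.castSucc) =
        (aeval w : MvPolynomial (Fin 4 ⊕ S) L →ₐ[L] E).toRingHom (X (Sum.inl i)) := by
      rw [hξ]
      exact (aeval_X w (Sum.inl i)).symm
    rw [h1, orderAt_map hι X_prime (X_ne_zero _)]
    split_ifs with h
    · rw [h, multiplicity_self, Nat.cast_one]
    · rw [Nat.cast_eq_zero, multiplicity_eq_zero, X_dvd_X]
      simpa using fun h' => h h'.symm

end Generators

section NotStable

variable {L : Type u} {E Γ : Type*} {J : Type v} {κ : Type*} [Field L] [Field E] [Algebra L E]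
  [Group Γ] (σ : Γ →* (L →+* L)) (ρ : Γ →* (E →+* E))

theorem map_aeval_mem (hσ : ∀ g a, ρ g (algebraMap L E a) = algebraMap L E (σ g a)) {S : Type*}
    {w : S → E} {R : Subring E} (hL : ∀ l, algebraMap L E l ∈ R) {g : Γ} (hw : ∀ i, ρ g (w i) ∈ R)
    (p : MvPolynomial S L) : ρ g (aeval w p) ∈ R :=
  aeval_mem_subring (R.comap (ρ g)) (fun l => by
    change ρ g _ ∈ R
    rw [hσ]
    exact hL _) hw p

/-- A purely transcendental extension of the function field of the torus `∏ i, x i = 1` has no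
algebraically independent generators fixed by `Γ`, if `Γ` contains an element acting by a
`5`-cycle `c` and an element conjugating `c` to `c ^ 2`. -/
theorem false_of_generators [Finite Γ] [Finite J] [Finite κ]
    (hσ : ∀ g a, ρ g (algebraMap L E a) = algebraMap L E (σ g a)) (π : Γ →* Equiv.Perm (Fin 5))
    {x : Fin 5 → E} (hx : ∏ i, x i = 1) (hρx : ∀ g i, ρ g (x i) = x (π g i)) {y : J → E}
    (hρy : ∀ g j, ρ g (y j) = y j)
    (hw : AlgebraicIndependent L (Sum.elim (fun i : Fin 4 => x i.castSucc) y))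
    (hwtop : IntermediateField.adjoin L (Set.range (Sum.elim (fun i : Fin 4 => x i.castSucc) y)) = ⊤)
    {z : κ → E} (hz : AlgebraicIndependent L z) (hρz : ∀ g j, ρ g (z j) = z j)
    (hztop : IntermediateField.adjoin L (Set.range z) = ⊤) {c t : Γ} (h5 : c ^ 5 = 1)
    (h1 : π c ≠ 1) (ht : t * c * t⁻¹ = c ^ 2) : False := by
  classical
  set w := Sum.elim (fun i : Fin 4 => x i.castSucc) y with hwdef
  have hx0 : ∀ i, x i ≠ 0 := fun i h => by
    rw [Finset.prod_eq_zero (Finset.mem_univ i) h] at hx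
    exact zero_ne_one hx
  have hQ : aeval w (∏ i : Fin 4, X (Sum.inl i) : MvPolynomial (Fin 4 ⊕ J) L) * x (Fin.last 4)
      = 1 := by
    rw [map_prod, ← hx, Fin.prod_univ_castSucc x]
    simp only [aeval_X, hwdef, Sum.elim_inl]
  have hQ0 : (∏ i : Fin 4, X (Sum.inl i) : MvPolynomial (Fin 4 ⊕ J) L) ≠ 0 := fun h => by
    rw [h, map_zero, zero_mul] at hQ
    exact zero_ne_one hQ
  obtain ⟨A, _, _, _, ι, hι, hιr⟩ := exists_localization_model hw hQ0
  set Q := (∏ i : Fin 4, X (Sum.inl i) : MvPolynomial (Fin 4 ⊕ J) L) with hQdef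
  have hpA : ∀ p : MvPolynomial (Fin 4 ⊕ J) L, aeval w p ∈ ι.range := fun p =>
    (hιr _).2 ⟨0, p, by rw [pow_zero, mul_one]⟩
  have hLA : ∀ l, algebraMap L E l ∈ ι.range := fun l => by
    have := hpA (C l)
    rwa [aeval_C] at this
  have hyA : ∀ j, y j ∈ ι.range := fun j => by
    have := hpA (X (Sum.inr j))
    rwa [aeval_X] at this
  have hxA : ∀ i, x i ∈ ι.range := fun i => by
    induction i using Fin.lastCases with
    | cast i =>
      have := hpA (X (Sum.inl i))
      rwa [aeval_X] at this
    | last => exact (hιr _).2 ⟨1, 1, by rw [pow_one, mul_comm, hQ, map_one]⟩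
  have hAx : ∀ e ∈ ι.range, ∃ n, ∃ p : MvPolynomial (Fin 4 ⊕ J) L,
      e = aeval w p * x (Fin.last 4) ^ n := fun e he => by
    obtain ⟨n, p, h⟩ := (hιr e).1 he
    exact ⟨n, p, by rw [← h, mul_assoc, ← mul_pow, hQ, one_pow, mul_one]⟩
  have hAsub : ∀ R : Subring E, (∀ l, algebraMap L E l ∈ R) → (∀ i, x i ∈ R) → (∀ j, y j ∈ R) →
      ι.range ≤ R := fun R hL hxR hyR e he => by
    obtain ⟨n, p, rfl⟩ := hAx e he
    exact R.mul_mem (aeval_mem_subring R hL (Sum.rec (fun i => hxR _) hyR) p) (R.pow_mem (hxR _) n)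
  have hρA : ∀ g, ∀ a ∈ ι.range, ρ g a ∈ ι.range := fun g =>
    hAsub (ι.range.comap (ρ g)) (fun l => by
      change ρ g _ ∈ ι.range
      rw [hσ]
      exact hLA _) (fun i => by
      change ρ g _ ∈ ι.range
      rw [hρx]
      exact hxA _) fun j => by
      change ρ g _ ∈ ι.range
      rw [hρy]
      exact hyA _
  let ιz : MvPolynomial κ L →+* E := (aeval z : MvPolynomial κ L →ₐ[L] E).toRingHom
  have hιz : Function.Injective ιz := hz
  have hLB : ∀ l, algebraMap L E l ∈ ιz.range := fun l => ⟨C l, aeval_C z l⟩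
  have hzB : ∀ j, z j ∈ ιz.range := fun j => ⟨X j, aeval_X z j⟩
  have hρB : ∀ g, ∀ a ∈ ιz.range, ρ g a ∈ ιz.range := by
    rintro g _ ⟨p, rfl⟩
    exact map_aeval_mem σ ρ hσ hLB (fun i => by rw [hρz]; exact hzB i) p
  have hfracA : ∀ e, ∃ s ∈ ι.range, s ≠ 0 ∧ e * s ∈ ι.range := fun e => by
    obtain ⟨p, q, hq, h⟩ := exists_frac_of_adjoin_eq_top hwtop e
    exact ⟨_, hpA q, hq, h ▸ hpA p⟩
  have hfracB : ∀ e, ∃ s ∈ ιz.range, s ≠ 0 ∧ e * s ∈ ιz.range := fun e => by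
    obtain ⟨p, q, hq, h⟩ := exists_frac_of_adjoin_eq_top hztop e
    exact ⟨_, ⟨q, rfl⟩, hq, h ▸ ⟨p, rfl⟩⟩
  obtain ⟨a, ha, ha0, hρa, hza⟩ := exists_invariant_denominator ρ hρA hfracA z
  obtain ⟨b, hb, hb0, hρb, hxb⟩ := exists_invariant_denominator ρ hρB hfracB (Sum.elim x y)
  obtain ⟨R, hρR, hAR, hBR, ⟨_, ⟨cA, rfl⟩, hcA0, hcA, hRA⟩, _, ⟨cB, rfl⟩, hcB0, hcB, hRB⟩ :=
    exists_common_overring ρ hρA hρB ha hb ha0 hb0 hρa hρb (by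
      rintro _ ⟨p, rfl⟩
      exact aeval_mem_subring (awaySubring ι.range ha)
        (fun l => ⟨0, by rw [pow_zero, mul_one]; exact hLA l⟩)
        (fun j => ⟨1, by rw [pow_one]; exact hza j⟩) p)
      (hAsub (awaySubring ιz.range hb) (fun l => ⟨0, by rw [pow_zero, mul_one]; exact hLB l⟩)
        (fun i => ⟨1, by rw [pow_one]; exact hxb (Sum.inl i)⟩)
        fun j => ⟨1, by rw [pow_one]; exact hxb (Sum.inr j)⟩)
  have hfrac : ∀ {A : Type _} [CommRing A] (ι : A →+* E),
      (∀ e, ∃ s ∈ ι.range, s ≠ 0 ∧ e * s ∈ ι.range) → ∀ e, ∃ a b, b ≠ 0 ∧ e * ι b = ι a := by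
    intro A _ ι h e
    obtain ⟨_, ⟨s, rfl⟩, hs, r, hr⟩ := h e
    exact ⟨r, s, fun h => hs (by rw [h, map_zero]), hr.symm⟩
  obtain ⟨SA, _, DA, hDA⟩ := exists_divisorMap hι (hfrac ι hfracA) hρR
    (fun g a => hρA g _ ⟨a, rfl⟩) (fun a => hAR ⟨a, rfl⟩)
    (fun h => hcA0 (by rw [h, map_zero])) hcA (fun u hu => by
      obtain ⟨n, a, h⟩ := hRA u hu
      exact ⟨n, a, h.symm⟩)
  obtain ⟨SB, _, DB, hDB⟩ := exists_divisorMap hιz (fun e => by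
      obtain ⟨p, q, hq, h⟩ := exists_frac_of_adjoin_eq_top hztop e
      exact ⟨p, q, fun h => hq (by rw [h, map_zero]), h⟩) hρR
    (fun g a => hρB g _ ⟨a, rfl⟩) (fun a => hBR ⟨a, rfl⟩)
    (fun h => hcB0 (by rw [h, map_zero])) hcB (fun u hu => by
      obtain ⟨n, a, h⟩ := hRB u hu
      exact ⟨n, a, h.symm⟩)
  have hxinv : ∀ i, (x i)⁻¹ ∈ ι.range := fun i => by
    have : (x i)⁻¹ = ∏ j ∈ Finset.univ.erase i, x j :=
      inv_eq_of_mul_eq_one_right (by rw [Finset.mul_prod_erase _ _ (Finset.mem_univ i), hx])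
    rw [this]
    exact Subring.prod_mem _ fun j _ => hxA j
  choose ξ hξ using fun i => exists_unitVal (hx0 i) (hAR (hxA i)) (hAR (hxinv i))
  have hξsum : ∑ i, ξ i = 0 := unitVal_injective (by
    rw [unitVal_sum, unitVal_zero, ← hx]
    exact Finset.prod_congr rfl fun i _ => hξ i)
  have hDB' : ∀ u, DB.f u = 0 ↔ ∃ l : L, l ≠ 0 ∧ unitVal u = algebraMap L E l := fun u => by
    rw [hDB]
    constructor
    · rintro ⟨p, hp⟩
      obtain ⟨l, hl, hpl⟩ := isUnit_iff_eq_C_of_isReduced.1 p.isUnit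
      refine ⟨l, hl.ne_zero, ?_⟩
      rw [← hp, hpl]
      exact aeval_C z l
    · rintro ⟨l, hl, h⟩
      exact ⟨Units.map (C : L →+* MvPolynomial κ L).toMonoidHom (Units.mk0 l hl), by
        rw [h]; exact aeval_C z l⟩
  have hDA' : ∀ u, DA.f u = 0 ↔ unitVal u ∈ ι.range ∧ (unitVal u)⁻¹ ∈ ι.range := fun u => by
    rw [hDA, exists_unit_map_iff hι]
    exact and_iff_right (unitVal_ne_zero u)
  obtain ⟨δ, hδ0, hδ⟩ := exists_order_homs hw hwtop hξ
  have hδ' := fun j => sum_zsmul_order hξsum (hδ · j)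
  refine DivisorMap.false_of_torus (A := DA) (B := DB) (π := π) (ξ := ξ) hξsum ?_ ?_ ?_
    (∑ j, (Int.castAddHom (ZMod 5)).comp (δ j)) ?_ ?_ h5 h1 ht
  · intro g i
    exact unitVal_injective (by rw [unitVal_unitAct, hξ, hξ, hρx])
  · intro u
    constructor
    · intro hu
      obtain ⟨⟨n, p, hp⟩, hu'⟩ := (hDA' u).1 hu |>.imp_left (hιr _).1
      obtain ⟨m, q, hq⟩ := (hιr _).1 hu'
      obtain ⟨l, hl, v, hlv⟩ := eq_mul_prod_zpow hw (unitVal_ne_zero u) hp hq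
      have hl0 : algebraMap L E l ≠ 0 := (map_ne_zero _).2 hl
      obtain ⟨n, hn⟩ := exists_unitVal hl0 (hAR (hLA l)) (by
        rw [← map_inv₀]; exact hAR (hLA _))
      refine ⟨n, Fin.snoc v 0, (hDB' n).2 ⟨l, hl, hn⟩, unitVal_injective ?_⟩
      rw [unitVal_add, hn, unitVal_sum, Fin.prod_univ_castSucc, hlv]
      simp only [unitVal_zsmul, hξ, hwdef, Sum.elim_inl, Fin.snoc_castSucc, Fin.snoc_last, zpow_zero,
        mul_one]
    · rintro ⟨n, v, hn, rfl⟩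
      obtain ⟨l, hl, hnl⟩ := (hDB' n).1 hn
      have h2 : DA.f n = 0 := (hDA' n).2 (by
        rw [hnl, ← map_inv₀]
        exact ⟨hLA l, hLA _⟩)
      have h3 : ∀ i, DA.f (ξ i) = 0 := fun i => (hDA' _).2 (by
        rw [hξ]
        exact ⟨hxA i, hxinv i⟩)
      rw [map_add, h2, zero_add, map_sum]
      exact Finset.sum_eq_zero fun i _ => by rw [map_zsmul, h3, smul_zero]
  · intro v hv
    have h2 : ∀ i, v i = v (Fin.last 4) := fun i => by
      induction i using Fin.lastCases with
      | last => rfl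
      | cast j =>
        have := hδ0 j _ ((hDB' _).1 hv)
        rw [(hδ' j).2 v] at this
        omega
    exact fun i j => (h2 i).trans (h2 j).symm
  · intro u hu
    rw [AddMonoidHom.finsetSum_apply]
    exact Finset.sum_eq_zero fun j _ => by
      rw [AddMonoidHom.comp_apply, hδ0 j u ((hDB' u).1 hu), map_zero]
  · intro i
    rw [AddMonoidHom.finsetSum_apply]
    induction i using Fin.lastCases with
    | last =>
      simp only [AddMonoidHom.comp_apply, (hδ' _).1]
      decide
    | cast i =>
      simp only [AddMonoidHom.comp_apply, hδ, apply_ite, Int.coe_castAddHom, Int.cast_one,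
        Int.cast_zero, Finset.sum_ite_eq, Finset.mem_univ, if_true]

end NotStable

section NotStablyRational

theorem eq_top_of_algebraMap_mem {L F E S : Type*} [Field L] [Field F] [Field E] [Algebra L E]
    [Algebra F E] {y : S → E} (hy : IntermediateField.adjoin F (Set.range y) = ⊤)
    {M : IntermediateField L E} (hF : ∀ a, algebraMap F E a ∈ M) (hM : ∀ s, y s ∈ M) : M = ⊤ := by
  rw [eq_top_iff]
  rintro e -
  have he : e ∈ IntermediateField.adjoin F (Set.range y) := hy ▸ IntermediateField.mem_top
  induction he using IntermediateField.adjoin_induction with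
  | mem a ha => obtain ⟨s, rfl⟩ := ha; exact hM s
  | algebraMap a => exact hF a
  | add a b _ _ ha hb => exact add_mem ha hb
  | inv a _ ha => exact inv_mem ha
  | mul a b _ _ ha hb => exact mul_mem ha hb

variable {k L K F Γ : Type*} [Field k] [Field L] [Field K] [Field F] [Algebra k L]
    [Algebra k K] [Algebra L F] [Algebra K F] [Algebra k F] [Group Γ]
    (T : NormOneAction k L K F Γ)

theorem NormOneAction.false_of_algEquiv [Finite Γ] [IsScalarTower k L F] [IsScalarTower k K F]
    [Algebra.IsAlgebraic k L] {E : Type*} [Field E] [Algebra k E] [Algebra K E] [Algebra L E]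
    [Algebra F E] [IsScalarTower k K E] [IsScalarTower k L E] [IsScalarTower L F E]
    [IsScalarTower K F E] {m n : ℕ} {y : Fin m → E} (hyF : AlgebraicIndependent F y)
    (hytop : IntermediateField.adjoin F (Set.range y) = ⊤) (ρE : Γ →* (E →+* E))
    (hρE : ∀ g a, ρE g (algebraMap F E a) = algebraMap F E (T.ρ g a))
    (hρy : ∀ g j, ρE g (y j) = y j)
    (f : FractionRing (MvPolynomial (Fin m) K) ≃ₐ[k] FractionRing (MvPolynomial (Fin n) k))
    {c t : Γ} (h5 : c ^ 5 = 1) (h1 : T.π c ≠ 1) (ht : t * c * t⁻¹ = c ^ 2) : False := by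
  have hyK : AlgebraicIndependent K y := hyF.restrictScalars (algebraMap K F).injective
  obtain ⟨z, hz, hyz⟩ := exists_generators_of_algEquiv f hyK
  have hfix : ∀ g, ∀ e ∈ IntermediateField.adjoin K (Set.range y), ρE g e = e := by
    intro g e he
    induction he using IntermediateField.adjoin_induction with
    | mem a ha => obtain ⟨s, rfl⟩ := ha; exact hρy g s
    | algebraMap a => rw [IsScalarTower.algebraMap_apply K F E, hρE, T.ρ_base]
    | add a b _ _ ha hb => rw [map_add, ha, hb]
    | inv a _ ha => rw [map_inv₀, ha]
    | mul a b _ _ ha hb => rw [map_mul, ha, hb]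
  have hρz : ∀ g j, ρE g (z j) = z j := fun g j => hfix g _ (by
    have : z j ∈ IntermediateField.adjoin k (Set.range z) :=
      IntermediateField.subset_adjoin _ _ ⟨j, rfl⟩
    rwa [← hyz] at this)
  have hsub : ∀ e ∈ IntermediateField.adjoin K (Set.range y),
      e ∈ IntermediateField.adjoin L (Set.range z) := fun e he => by
    have h : e ∈ (IntermediateField.adjoin K (Set.range y)).restrictScalars k := he
    rw [hyz] at h
    have hle : IntermediateField.adjoin k (Set.range z) ≤
        (IntermediateField.adjoin L (Set.range z)).restrictScalars k :=
      IntermediateField.adjoin_le_iff.2 (IntermediateField.subset_adjoin L _)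
    exact hle h
  have hspan := span_invariants_eq T.σ T.σ_injective T.ρ T.ρ_algebraMap ⊤ fun _ _ _ => trivial
  have hztop : IntermediateField.adjoin L (Set.range z) = ⊤ := by
    refine eq_top_of_algebraMap_mem hytop (fun a => ?_) fun j =>
      hsub _ (IntermediateField.subset_adjoin _ _ ⟨j, rfl⟩)
    have ha : a ∈ Submodule.span L {v | v ∈ (⊤ : Submodule L F) ∧ ∀ g, T.ρ g v = v} :=
      hspan.ge trivial
    induction ha using Submodule.span_induction with
    | mem a ha =>
      obtain ⟨b, rfl⟩ := T.ρ_fixed a ha.2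
      rw [← IsScalarTower.algebraMap_apply]
      exact hsub _ (IntermediateField.algebraMap_mem _ b)
    | zero => rw [map_zero]; exact zero_mem _
    | add a b _ _ ha hb => rw [map_add]; exact add_mem ha hb
    | smul l a _ ha =>
      rw [Algebra.smul_def, map_mul, ← IsScalarTower.algebraMap_apply]
      exact mul_mem (IntermediateField.algebraMap_mem _ l) ha
  have hw : AlgebraicIndependent L
      (Sum.elim (fun i : Fin 4 => algebraMap F E (T.x i.castSucc)) y) := by
    have := (T.algInd.sumElim_comp hyF).comp Sum.swap Sum.swap_leftInverse.injective
    convert this using 1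
    ext (i | j) <;> rfl
  have hwtop : IntermediateField.adjoin L (Set.range
      (Sum.elim (fun i : Fin 4 => algebraMap F E (T.x i.castSucc)) y)) = ⊤ := by
    refine eq_top_of_algebraMap_mem hytop (fun a => ?_) fun j =>
      IntermediateField.subset_adjoin _ _ ⟨Sum.inr j, rfl⟩
    have ha : a ∈ IntermediateField.adjoin L (Set.range fun i : Fin 4 => T.x i.castSucc) :=
      T.adjoin_x ▸ IntermediateField.mem_top
    have hle : IntermediateField.adjoin L (Set.range fun i : Fin 4 => T.x i.castSucc) ≤
        (IntermediateField.adjoin L (Set.range (Sum.elim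
          (fun i : Fin 4 => algebraMap F E (T.x i.castSucc)) y))).comap
            (IsScalarTower.toAlgHom L F E) := by
      rw [IntermediateField.adjoin_le_iff]
      rintro _ ⟨i, rfl⟩
      exact IntermediateField.subset_adjoin L _ ⟨Sum.inl i, rfl⟩
    exact hle ha
  refine false_of_generators T.σ ρE (fun g a => ?_) T.π (x := fun i => algebraMap F E (T.x i)) ?_
    (fun g i => ?_) hρy hw hwtop (hz.extendScalars L) hρz hztop h5 h1 ht
  · rw [IsScalarTower.algebraMap_apply L F E, hρE, T.ρ_algebraMap,
      ← IsScalarTower.algebraMap_apply]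
  · rw [← map_prod, T.prod_x, map_one]
  · rw [hρE, T.ρ_x]

/-- If `Γ` contains an element acting by a `5`-cycle `c` and an element conjugating `c` to `c ^ 2`,
the torus is not stably rational. -/
theorem NormOneAction.not_isStablyRational [Finite Γ] [IsScalarTower k L F] [IsScalarTower k K F]
    [Algebra.IsAlgebraic k L] {c t : Γ} (h5 : c ^ 5 = 1) (h1 : T.π c ≠ 1)
    (ht : t * c * t⁻¹ = c ^ 2) : ¬ IsStablyRational k K := by
  rintro ⟨m, n, ⟨f⟩⟩
  refine T.false_of_algEquiv (algebraicIndependent_fractionRing_X F (Fin m))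
    (adjoin_fractionRing_X F (Fin m)) (fracAct (polyAct T.ρ 1)) (fun g a => ?_) (fun g j => ?_)
    f h5 h1 ht
  · have h : ∀ a, algebraMap F (FractionRing (MvPolynomial (Fin m) F)) a =
        algebraMap (MvPolynomial (Fin m) F) _ (C a) := fun a =>
      IsScalarTower.algebraMap_apply F (MvPolynomial (Fin m) F) _ a
    rw [h, h, fracAct_algebraMap, polyAct_C]
  · rw [fracAct_algebraMap, polyAct_X]
    rfl

end NotStablyRational

/-- **Hoshi–Yamasaki.** Let `K/k` be a separable extension of degree 5 with Galois closure
`L/k`, `G = Gal(L/k)` a transitive subgroup of `S₅`, acting on `L(x₁,x₂,x₃,x₄)` by extending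
its Galois action on `L` and permuting `x₁, …, x₄, x₅ := 1/(x₁x₂x₃x₄)` according to its action
on `{1, …, 5}` (the function field of the norm one torus `R^{(1)}_{K/k}(𝔾_m)`). Then:
(1) the fixed field is stably `k`-rational iff `G ≅ C₅`, `D₅` or `A₅`;
(2) it is not stably but retract `k`-rational iff `G ≅ F₂₀` or `S₅`. -/
theorem norm_one_torus_degree_five_rationality
    (k L : Type*) [Field k] [Field L] [Algebra k L] [IsGalois k L] [FiniteDimensional k L]
    (G : Subgroup (Equiv.Perm (Fin 5)))
    (htrans : ∀ i j : Fin 5, ∃ σ ∈ G, σ i = j)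
    (e : (L ≃ₐ[k] L) ≃* G)
    (x : Fin 5 → FractionRing (MvPolynomial (Fin 4) L))
    (hxlt : ∀ (i : Fin 5) (h : (i : ℕ) < 4),
      x i = algebraMap (MvPolynomial (Fin 4) L) _ (X (⟨(i : ℕ), h⟩ : Fin 4)))
    (hxlast : x 4 = (∏ i : Fin 4, algebraMap (MvPolynomial (Fin 4) L) _ (X i))⁻¹)
    (ρ : (L ≃ₐ[k] L) →*
      (FractionRing (MvPolynomial (Fin 4) L) ≃ₐ[k] FractionRing (MvPolynomial (Fin 4) L)))
    (hext : ∀ (σ : L ≃ₐ[k] L) (c : L),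
      ρ σ (algebraMap L (FractionRing (MvPolynomial (Fin 4) L)) c) =
        algebraMap L (FractionRing (MvPolynomial (Fin 4) L)) (σ c))
    (hρx : ∀ (σ : L ≃ₐ[k] L) (i : Fin 5), ρ σ (x i) = x (((e σ : G) : Equiv.Perm (Fin 5)) i)) :
    (IsStablyRational k (IntermediateField.fixedField ρ.range) ↔
      (Nonempty (G ≃* Multiplicative (ZMod 5)) ∨ Nonempty (G ≃* DihedralGroup 5) ∨
        Nonempty (G ≃* alternatingGroup (Fin 5)))) ∧
    ((¬ IsStablyRational k (IntermediateField.fixedField ρ.range) ∧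
        IsRetractRational k (IntermediateField.fixedField ρ.range)) ↔
      (IsFrobeniusGroup20 G ∨ Nonempty (G ≃* Equiv.Perm (Fin 5)))) := by
  have hxc : (fun i : Fin 4 => x i.castSucc) = fun i =>
      algebraMap (MvPolynomial (Fin 4) L) (FractionRing (MvPolynomial (Fin 4) L)) (X i) :=
    funext fun i => hxlt i.castSucc i.isLt
  have hX0 : ∏ i : Fin 4, algebraMap (MvPolynomial (Fin 4) L)
      (FractionRing (MvPolynomial (Fin 4) L)) (X i) ≠ 0 :=
    Finset.prod_ne_zero_iff.2 fun i _ => (algebraicIndependent_fractionRing_X L (Fin 4)).ne_zero i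
  let T : NormOneAction k L (IntermediateField.fixedField ρ.range)
      (FractionRing (MvPolynomial (Fin 4) L)) (L ≃ₐ[k] L) :=
    { x := x
      prod_x := by
        rw [Fin.prod_univ_castSucc, show Fin.last 4 = 4 from rfl, hxlast,
          Finset.prod_congr rfl fun i _ => congrFun hxc i, mul_inv_cancel₀ hX0]
      algInd := hxc ▸ algebraicIndependent_fractionRing_X L (Fin 4)
      adjoin_x := hxc ▸ adjoin_fractionRing_X L (Fin 4)
      σ := ⟨⟨fun g => (g : L →+* L), rfl⟩, fun _ _ => rfl⟩
      ρ := ⟨⟨fun g => (ρ g : _ →+* _), by rw [map_one]; rfl⟩, fun g h => by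
        dsimp only
        rw [map_mul]
        rfl⟩
      π := G.subtype.comp e.toMonoidHom
      σ_injective := fun g h hgh => AlgEquiv.ext fun a => DFunLike.congr_fun hgh a
      π_injective := G.subtype_injective.comp e.injective
      ρ_algebraMap := hext
      ρ_x := hρx
      σ_base := fun g b => g.commutes b
      σ_fixed := fun a ha => (IsGalois.mem_range_algebraMap_iff_fixed a).2 ha
      ρ_base := fun g b => b.2 ⟨_, g, rfl⟩
      ρ_fixed := fun a ha => ⟨⟨a, by
        rintro ⟨_, g, rfl⟩
        exact ha g⟩, rfl⟩
      transitive := fun i j => by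
        obtain ⟨τ, hτ, h⟩ := htrans i j
        obtain ⟨g, hg⟩ := e.surjective ⟨τ, hτ⟩
        refine ⟨g, ?_⟩
        change ((e g : G) : Equiv.Perm (Fin 5)) i = j
        rw [hg, h] }
  have hπ : ∀ τ ∈ G, ∃ g, T.π g = τ := fun τ hτ =>
    (e.surjective ⟨τ, hτ⟩).imp fun g hg => congrArg Subtype.val hg
  obtain ⟨c, hcG, hc5, hc1, hcases⟩ := transitive_subgroup_perm_five G htrans
  obtain ⟨γ, rfl⟩ := hπ c hcG
  have hretract := T.isRetractRational hc5 hc1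
  rcases hcases with ⟨hA, hG⟩ | ⟨hG, τ, hτG, hτ⟩
  · have hS := T.isStablyRational_of_sign_eq_one fun g =>
      Equiv.Perm.mem_alternatingGroup.1 (hA (e g).2)
    exact ⟨iff_of_true hS hG, iff_of_false (fun h => h.1 hS) (not_frobenius_or_perm_of_mulEquiv hG)⟩
  · obtain ⟨t, rfl⟩ := hπ τ hτG
    have hN := T.not_isStablyRational (c := γ) (t := t)
      (T.π_injective (by rw [map_pow, hc5, map_one])) hc1
      (T.π_injective (by rw [map_mul, map_mul, map_inv, map_pow, hτ]))
    exact ⟨iff_of_false hN fun h => not_frobenius_or_perm_of_mulEquiv h hG,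
      iff_of_true ⟨hN, hretract⟩ hG⟩
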